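/- arXiv:2408.05015 — 2 statements merged into one kernel-verified Lean document; each statement's English description precedes it below -/
import Mathlib

section
/- Let q be a prime power, m ≥ 1, and n = 2m−1. The eigenspace of the eigenvalue −q^{(n²−1)/2} of the adjacency matrix of the opposition graph on maximal flags of F_q^{n+1} equals the direct sum col(F_1) ⊕ col(F_2) ⊕ ⋯ ⊕ col(F_m) of the column spaces of the matrices F_1,…,F_m. -/
open Matrix

def MaxFlag2 (F : Type) [Field F] (m : ℕ) : Type :=
  {U : Fin (2 * m + 1) → Submodule F (Fin (2 * m) → F) //
    Monotone U ∧ ∀ k : Fin (2 * m + 1), Module.finrank F (U k) = (k : ℕ)}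

instance (F : Type) [Field F] [Fintype F] (m : ℕ) : Finite (MaxFlag2 F m) :=
  Subtype.finite

noncomputable instance (F : Type) [Field F] [Fintype F] (m : ℕ) : Fintype (MaxFlag2 F m) :=
  Fintype.ofFinite _

def Point2 (F : Type) [Field F] (m : ℕ) : Type :=
  {X : Submodule F (Fin (2 * m) → F) // Module.finrank F X = 1}

instance (F : Type) [Field F] [Fintype F] (m : ℕ) : Finite (Point2 F m) :=
  Subtype.finite

noncomputable instance (F : Type) [Field F] [Fintype F] (m : ℕ) : Fintype (Point2 F m) :=
  Fintype.ofFinite _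

noncomputable def flagMem2 {F : Type} [Field F] {m : ℕ} (c : MaxFlag2 F m) (k : ℕ) :
    Submodule F (Fin (2 * m) → F) :=
  if h : k < 2 * m + 1 then c.1 ⟨k, h⟩ else ⊤

/-- The type of a maximal flag of `F^(2m)` with respect to a point `X`. -/
noncomputable def flagType2 {F : Type} [Field F] {m : ℕ} (c : MaxFlag2 F m)
    (X : Submodule F (Fin (2 * m) → F)) : ℕ :=
  sInf {k : ℕ | X ≤ flagMem2 c k}

def Opp2 {F : Type} [Field F] {m : ℕ} (c d : MaxFlag2 F m) : Prop :=
  ∀ i : Fin (2 * m + 1), c.1 i ⊓ d.1 i.rev = ⊥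

open Classical in
noncomputable def adj2 (F : Type) [Field F] [Fintype F] (m : ℕ) :
    Matrix (MaxFlag2 F m) (MaxFlag2 F m) ℚ :=
  fun c d => if Opp2 c d then 1 else 0

open Classical in
/-- `T_i`: the flag-by-point `{0,1}` matrix of the `type i` relation. -/
noncomputable def Tmat2 (F : Type) [Field F] [Fintype F] (m : ℕ) (i : ℕ) :
    Matrix (MaxFlag2 F m) (Point2 F m) ℚ :=
  fun c X => if flagType2 c X.1 = i then 1 else 0

/-- `F_j = q^j ∑_{i=m-j+1}^{m} T_i - ∑_{i=m+1}^{m+j} T_i`. -/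
noncomputable def Fmat2 (F : Type) [Field F] [Fintype F] (m j : ℕ) :
    Matrix (MaxFlag2 F m) (Point2 F m) ℚ :=
  (Fintype.card F : ℚ) ^ j • (∑ i ∈ Finset.Icc (m - j + 1) m, Tmat2 F m i) -
    ∑ i ∈ Finset.Icc (m + 1) (m + j), Tmat2 F m i

/-- The quadratic, braid and commutation relations of the Iwahori–Hecke algebra of type `A_n`. -/
structure HeckeRel {K R : Type*} [CommRing K] [Ring R] [Module K R] (q : K) (n : ℕ)
    (T : ℕ → R) : Prop where
  quad : ∀ i, i < n → T i * T i = (q - 1) • T i + q • (1 : R)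
  braid : ∀ i, i + 1 < n → T i * T (i + 1) * T i = T (i + 1) * T i * T (i + 1)
  comm : ∀ i j, i + 2 ≤ j → j < n → T i * T j = T j * T i

section Words

variable {R : Type*} [Monoid R] (T : ℕ → R)

/-- The product `T (k-1) * ⋯ * T 0`. -/
def descWord : ℕ → R
  | 0 => 1
  | k + 1 => T k * descWord k

/-- The product `T 0 * ⋯ * T (k-1)`. -/
def ascWord : ℕ → R
  | 0 => 1
  | k + 1 => ascWord k * T k

/-- The multiplicative Jucys–Murphy elements. -/
def jucysMurphy : ℕ → R
  | 0 => 1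
  | k + 1 => T k * jucysMurphy k * T k

/-- A word for the longest element in the first `k` generators. -/
def longWord : ℕ → R
  | 0 => 1
  | k + 1 => longWord k * descWord T (k + 1)

theorem jucysMurphy_eq_desc_mul_asc (k : ℕ) :
    jucysMurphy T k = descWord T k * ascWord T k := by
  induction k with
  | zero => simp [jucysMurphy, descWord, ascWord]
  | succ k ih => simp only [jucysMurphy, descWord, ascWord, ih, mul_assoc]

end Words

namespace HeckeRel

variable {K R : Type*} [CommRing K] [Ring R] [Module K R] {q : K} {n : ℕ} {T : ℕ → R}

theorem commute_jucysMurphy_of_lt (h : HeckeRel q n T) {i k : ℕ} (hki : k < i) (hi : i < n) :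
    Commute (T i) (jucysMurphy T k) := by
  induction k with
  | zero => exact Commute.one_right _
  | succ k ih =>
    have h1 : Commute (T i) (T k) := (h.comm k i (by omega) hi).symm
    exact (h1.mul_right (ih (by omega))).mul_right h1

theorem commute_jucysMurphy_of_succ_lt (h : HeckeRel q n T) {i k : ℕ} (hik : i + 1 < k)
    (hk : k ≤ n) : Commute (T i) (jucysMurphy T k) := by
  induction k with
  | zero => omega
  | succ k ih =>
    rcases Nat.lt_or_ge (i + 1) k with hlt | hge
    · have h1 : Commute (T i) (T k) := h.comm i k (by omega) (by omega)
      exact (h1.mul_right (ih hlt (by omega))).mul_right h1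
    · obtain rfl : k = i + 1 := by omega
      have hb := h.braid i (by omega)
      have hc : T (i + 1) * jucysMurphy T i = jucysMurphy T i * T (i + 1) :=
        h.commute_jucysMurphy_of_lt (by omega) (by omega)
      change T i * (T (i + 1) * (T i * jucysMurphy T i * T i) * T (i + 1)) =
        T (i + 1) * (T i * jucysMurphy T i * T i) * T (i + 1) * T i
      calc T i * (T (i + 1) * (T i * jucysMurphy T i * T i) * T (i + 1))
          = (T i * T (i + 1) * T i) * jucysMurphy T i * T i * T (i + 1) := by
            simp only [mul_assoc]
        _ = T (i + 1) * T i * (T (i + 1) * jucysMurphy T i) * T i * T (i + 1) := by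
            rw [hb]; simp only [mul_assoc]
        _ = T (i + 1) * T i * jucysMurphy T i * (T (i + 1) * T i * T (i + 1)) := by
            rw [hc]; simp only [mul_assoc]
        _ = _ := by rw [← hb]; simp only [mul_assoc]

theorem commute_jucysMurphy (h : HeckeRel q n T) {j k : ℕ} (hjk : j ≤ k) (hk : k ≤ n) :
    Commute (jucysMurphy T j) (jucysMurphy T k) := by
  induction j with
  | zero => exact Commute.one_left _
  | succ j ih =>
    rcases Nat.lt_or_ge (j + 1) k with hlt | hge
    · have h1 := h.commute_jucysMurphy_of_succ_lt hlt hk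
      exact (h1.mul_left (ih (by omega))).mul_left h1
    · obtain rfl : k = j + 1 := by omega
      exact Commute.refl _

theorem commute_longWord_jucysMurphy (h : HeckeRel q n T) {j k : ℕ} (hjk : j < k) (hk : k ≤ n) :
    Commute (longWord T j) (jucysMurphy T k) := by
  have hd : ∀ l, l < k → Commute (descWord T l) (jucysMurphy T k) := by
    intro l
    induction l with
    | zero => exact fun _ => Commute.one_left _
    | succ l ih =>
      exact fun hl => (h.commute_jucysMurphy_of_succ_lt hl hk).mul_left (ih (by omega))
  induction j with
  | zero => exact Commute.one_left _
  | succ j ih => exact (ih (by omega)).mul_left (hd _ hjk)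

theorem longWord_succ_sq (h : HeckeRel q n T)
    (hl : ∀ k, k < n → longWord T (k + 1) = ascWord T (k + 1) * longWord T k) {k : ℕ}
    (hk : k < n) :
    longWord T (k + 1) * longWord T (k + 1) =
      longWord T k * longWord T k * jucysMurphy T (k + 1) := by
  have hc := h.commute_longWord_jucysMurphy (Nat.lt_succ_self k) hk
  calc longWord T (k + 1) * longWord T (k + 1)
      = longWord T k * descWord T (k + 1) * (ascWord T (k + 1) * longWord T k) := by
        rw [← hl k hk]; rfl
    _ = longWord T k * (jucysMurphy T (k + 1) * longWord T k) := by
        rw [jucysMurphy_eq_desc_mul_asc]; simp only [mul_assoc]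
    _ = _ := by rw [← hc.eq]; simp only [mul_assoc]

theorem commute_longWord_sq_jucysMurphy (h : HeckeRel q n T)
    (hl : ∀ k, k < n → longWord T (k + 1) = ascWord T (k + 1) * longWord T k) {j k : ℕ}
    (hj : j ≤ n) (hk : k ≤ n) :
    Commute (longWord T j * longWord T j) (jucysMurphy T k) := by
  induction j with
  | zero => simp [longWord]
  | succ j ih =>
    rw [h.longWord_succ_sq hl (by omega)]
    refine (ih (by omega)).mul_left ?_
    rcases le_total (j + 1) k with h' | h'
    · exact h.commute_jucysMurphy h' hk
    · exact (h.commute_jucysMurphy h' hj).symm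

theorem mul_ascWord (h : HeckeRel q n T) {i k : ℕ} (hik : i + 1 < k) (hk : k ≤ n) :
    T (i + 1) * ascWord T k = ascWord T k * T i := by
  induction k with
  | zero => omega
  | succ k ih =>
    rcases Nat.lt_or_ge (i + 1) k with hlt | hge
    · simp only [ascWord]
      rw [← mul_assoc, ih hlt (by omega), mul_assoc, h.comm i k (by omega) (by omega), mul_assoc]
    · obtain rfl : k = i + 1 := by omega
      have hc : ∀ j, j ≤ i → Commute (T (i + 1)) (ascWord T j) := by
        intro j
        induction j with
        | zero => exact fun _ => Commute.one_right _
        | succ j ih =>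
          exact fun hj => (ih (by omega)).mul_right (h.comm j (i + 1) (by omega) (by omega)).symm
      simp only [ascWord]
      have hb := h.braid i (by omega)
      calc T (i + 1) * (ascWord T i * T i * T (i + 1))
          = (T (i + 1) * ascWord T i) * T i * T (i + 1) := by simp only [mul_assoc]
        _ = ascWord T i * (T (i + 1) * T i * T (i + 1)) := by
            rw [(hc i le_rfl).eq]; simp only [mul_assoc]
        _ = _ := by rw [← hb]; simp only [mul_assoc]

end HeckeRel

section Spectrum

variable {V : Type*} [NormedAddCommGroup V] [InnerProductSpace ℝ V] {q : ℝ} {n : ℕ}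
  {T : ℕ → Module.End ℝ V}

/-- `v` is an eigenvector for the index character of the first `k` generators. -/
def IndexInvariant (q : ℝ) (T : ℕ → Module.End ℝ V) (k : ℕ) (v : V) : Prop :=
  ∀ i, i < k → T i v = q • v

theorem IndexInvariant.succ {k : ℕ} {v : V} (hv : IndexInvariant q T k v)
    (hk : T k v = q • v) : IndexInvariant q T (k + 1) v := by
  intro i hi
  rcases Nat.lt_succ_iff_lt_or_eq.1 hi with h | rfl
  exacts [hv i h, hk]

theorem IndexInvariant.jucysMurphy_apply {k : ℕ} {v : V} (hv : IndexInvariant q T k v) :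
    jucysMurphy T k v = q ^ (2 * k) • v := by
  induction k with
  | zero => simp [jucysMurphy]
  | succ k ih =>
    have h1 := hv k (Nat.lt_succ_self k)
    have h2 := ih fun i hi => hv i (by omega)
    simp only [jucysMurphy, Module.End.mul_apply, h1, map_smul, h2, smul_smul]
    congr 1; ring

theorem eq_of_smul_eq_smul_of_ne_zero {v : V} (hv : v ≠ 0) {a b : ℝ} (h : a • v = b • v) :
    a = b :=
  smul_left_injective ℝ hv h

theorem jucysMurphy_isSymmetric (hs : ∀ i, i < n → (T i).IsSymmetric) {k : ℕ} (hk : k ≤ n) :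
    (jucysMurphy T k).IsSymmetric := by
  induction k with
  | zero => exact LinearMap.IsSymmetric.id
  | succ k ih =>
    intro x y
    simp only [jucysMurphy, Module.End.mul_apply]
    rw [hs k hk, ih (by omega), hs k hk]

namespace HeckeRel

/-- The intertwining step: an eigenvector of two consecutive Jucys–Murphy elements is an
eigenvector of the generator between them, or the two eigenvalues can be exchanged. -/
theorem exchange (h : HeckeRel q n T) (hq : 1 < q) (hs : ∀ i, i < n → (T i).IsSymmetric)
    {k : ℕ} (hk : k < n) {v : V} (hv : v ≠ 0) {a b : ℝ} (ha : a ≠ 0)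
    (hka : jucysMurphy T k v = a • v) (hkb : jucysMurphy T (k + 1) v = b • v) :
    b ≠ q * a ∧ ((b = q ^ 2 * a ∧ T k v = q • v) ∨ (b = a ∧ T k v = -v) ∨
      ∃ s t : ℝ, s • T k v + t • v ≠ 0 ∧
        jucysMurphy T k (s • T k v + t • v) = (b / q) • (s • T k v + t • v) ∧
        jucysMurphy T (k + 1) (s • T k v + t • v) = (q * a) • (s • T k v + t • v)) := by
  have hq0 : q ≠ 0 := by positivity
  have hquad : ∀ x, T k (T k x) = (q - 1) • T k x + q • x := fun x => by
    have := congrArg (fun f : Module.End ℝ V => f x) (h.quad k hk)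
    simpa using this
  have hb1 : T k (jucysMurphy T k (T k v)) = b • v := hkb
  have hlow : jucysMurphy T k (T k v) = (b / q) • (T k v - (q - 1) • v) := by
    have h2 := hquad (jucysMurphy T k (T k v))
    rw [hb1, map_smul] at h2
    have h3 : q • jucysMurphy T k (T k v) = b • T k v - ((q - 1) * b) • v := by
      rw [h2, smul_smul]; abel
    have h4 : jucysMurphy T k (T k v) = q⁻¹ • (b • T k v - ((q - 1) * b) • v) := by
      rw [← h3, smul_smul, inv_mul_cancel₀ hq0, one_smul]
    rw [h4]; module
  have hhigh : jucysMurphy T (k + 1) (T k v) = ((q - 1) * b) • v + (q * a) • T k v := by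
    have : jucysMurphy T (k + 1) (T k v) = T k (jucysMurphy T k (T k (T k v))) := rfl
    rw [this, hquad, map_add, map_smul, map_smul, map_add, map_smul, map_smul, hb1, hka, map_smul]
    module
  have hne : b ≠ q * a := by
    rintro rfl
    have hsym := jucysMurphy_isSymmetric hs hk.le (T k v) v
    rw [hlow, hka, inner_smul_left, inner_sub_left, inner_smul_left, inner_smul_right] at hsym
    have hvv : inner ℝ v v ≠ 0 := inner_self_ne_zero.2 hv
    have e : q * a / q = a := by field_simp
    simp only [e, RCLike.conj_to_real] at hsym
    have : a * (q - 1) * inner ℝ v v = 0 := by linarith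
    have hq1 : q - 1 ≠ 0 := by linarith
    simp_all
  refine ⟨hne, ?_⟩
  by_cases h0 : (b - q * a) • T k v + (-(b * (q - 1))) • v = 0
  · have hba : b - q * a ≠ 0 := sub_ne_zero.2 hne
    obtain ⟨x, hx⟩ : ∃ x, x = b * (q - 1) / (b - q * a) := ⟨_, rfl⟩
    have hTx : T k v = x • v := by
      have : (b - q * a) • T k v = (b * (q - 1)) • v := by
        rw [neg_smul] at h0; exact add_neg_eq_zero.1 h0
      rw [hx, div_eq_inv_mul, mul_smul, ← this, smul_smul, inv_mul_cancel₀ hba, one_smul]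
    have hxx : x * (b - q * a) = b * (q - 1) := by rw [hx]; field_simp
    have h2 := hquad v
    rw [hTx, map_smul, hTx, smul_smul, smul_smul, ← add_smul] at h2
    have h3 := eq_of_smul_eq_smul_of_ne_zero hv h2
    have h4 : (x - q) * (x + 1) = 0 := by linarith
    rcases mul_eq_zero.1 h4 with h5 | h5
    · obtain rfl : x = q := by linarith
      exact Or.inl ⟨by linarith, hTx⟩
    · obtain rfl : x = -1 := by linarith
      refine Or.inr (Or.inl ⟨?_, by simpa using hTx⟩)
      have : q * (b - a) = 0 := by linarith
      rcases mul_eq_zero.1 this with h6 | h6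
      · exact absurd h6 hq0
      · linarith
  · refine Or.inr (Or.inr ⟨_, _, h0, ?_, ?_⟩)
    · rw [map_add, map_smul, map_smul, hlow, hka]
      match_scalars
      · field_simp
      · field_simp; ring
    · rw [map_add, map_smul, map_smul, hhigh, hkb]
      module

theorem jucysMurphy_apply_smul_add (h : HeckeRel q n T) {i k : ℕ} (hi : i < k) (hk : k < n)
    {v : V} {x : ℝ} (hv : jucysMurphy T i v = x • v) (s t : ℝ) :
    jucysMurphy T i (s • T k v + t • v) = x • (s • T k v + t • v) := by
  have hc : jucysMurphy T i (T k v) = T k (jucysMurphy T i v) :=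
    congrArg (fun f : Module.End ℝ V => f v) (h.commute_jucysMurphy_of_lt hi hk).eq.symm
  rw [map_add, map_smul, map_smul, hc, hv, map_smul]
  module

theorem eigenvalue_pos_and_le (h : HeckeRel q n T) (hq : 1 < q)
    (hs : ∀ i, i < n → (T i).IsSymmetric) {k : ℕ} (hk : k ≤ n) {v : V} (hv : v ≠ 0) {χ : ℕ → ℝ}
    (hχ : ∀ i, i ≤ k → jucysMurphy T i v = χ i • v) :
    0 < χ k ∧ (IndexInvariant q T k v ∨ χ k * q ≤ q ^ (2 * k)) := by
  have hq0 : 0 < q := by positivity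
  induction k generalizing v χ with
  | zero =>
    have h0 := hχ 0 le_rfl
    have : (1 : ℝ) • v = χ 0 • v := by simpa [jucysMurphy] using h0
    rw [← eq_of_smul_eq_smul_of_ne_zero hv this]
    exact ⟨one_pos, Or.inl fun i hi => absurd hi (Nat.not_lt_zero i)⟩
  | succ k ih =>
    have hle : ∀ {w : V} {ψ : ℕ → ℝ}, w ≠ 0 → (∀ i, i ≤ k → jucysMurphy T i w = ψ i • w) →
        0 < ψ k ∧ ψ k ≤ q ^ (2 * k) := by
      intro w ψ hw hψ
      obtain ⟨h1, h2⟩ := ih (by omega) hw hψ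
      refine ⟨h1, ?_⟩
      rcases h2 with h2 | h2
      · exact (eq_of_smul_eq_smul_of_ne_zero hw ((hψ k le_rfl).symm.trans h2.jucysMurphy_apply)).le
      · nlinarith
    have hpw : q ^ (2 * (k + 1)) = q ^ 2 * q ^ (2 * k) := by ring
    have hpos := hle hv (fun i hi => hχ i (by omega))
    obtain ⟨-, ⟨hb, hT⟩ | ⟨hb, -⟩ | ⟨s, t, hw, h1, -⟩⟩ :=
      h.exchange hq hs hk hv hpos.1.ne' (hχ k (by omega)) (hχ (k + 1) le_rfl)
    · refine ⟨by rw [hb]; have := hpos.1; positivity, ?_⟩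
      rcases (ih (by omega) hv (fun i hi => hχ i (by omega))).2 with h2 | h2
      · exact Or.inl (h2.succ hT)
      · right
        rw [hb, hpw, mul_assoc]
        gcongr
    · refine ⟨by rw [hb]; exact hpos.1, Or.inr ?_⟩
      have h3 : χ k * q ≤ q ^ (2 * k) * q := mul_le_mul_of_nonneg_right hpos.2 hq0.le
      have h4 : 0 < q ^ (2 * k) * (q * (q - 1)) := by
        have := sub_pos.2 hq
        positivity
      rw [hb, hpw]
      linarith
    · have h2 := hle (ψ := Function.update χ k (χ (k + 1) / q)) hw (by
        intro i hi
        rcases hi.lt_or_eq with hi | rfl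
        · rw [Function.update_of_ne hi.ne]
          exact h.jucysMurphy_apply_smul_add hi hk (hχ i (by omega)) s t
        · rw [Function.update_self]; exact h1)
      rw [Function.update_self, div_pos_iff_of_pos_right hq0, div_le_iff₀ hq0] at h2
      refine ⟨h2.1, Or.inr ?_⟩
      rw [hpw]
      nlinarith [h2.2]

theorem indexInvariant_of_lt (h : HeckeRel q n T) (hq : 1 < q)
    (hs : ∀ i, i < n → (T i).IsSymmetric) {k : ℕ} (hk : k < n) {v : V} (hv : v ≠ 0) {b : ℝ}
    (hinv : IndexInvariant q T k v) (hb : jucysMurphy T (k + 1) v = b • v) :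
    b = q ^ k ∨ T k v = q • v := by
  have hq0 : 0 < q := by positivity
  induction k generalizing v b with
  | zero =>
    obtain ⟨hne, ⟨hb, hT⟩ | ⟨hb, -⟩ | ⟨s, t, hw, h1, -⟩⟩ :=
      h.exchange hq hs hk hv (a := 1) one_ne_zero (by simp [jucysMurphy]) hb
    · exact Or.inr hT
    · exact Or.inl (by simpa using hb)
    · have : (1 : ℝ) = b / q := by
        apply eq_of_smul_eq_smul_of_ne_zero hw
        rw [← h1]; simp [jucysMurphy]
      field_simp at this
      exact absurd this.symm (by simpa using hne)
  | succ k ih =>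
    obtain ⟨hne, ⟨hb, hT⟩ | ⟨hb, hT⟩ | ⟨s, t, hw, h1, -⟩⟩ :=
      h.exchange hq hs hk hv (a := q ^ (2 * (k + 1))) (by positivity) hinv.jucysMurphy_apply hb
    · exact Or.inr hT
    · have hbr := congrArg (fun f : Module.End ℝ V => f v) (h.braid k hk)
      have hTk := hinv k (Nat.lt_succ_self k)
      simp only [Module.End.mul_apply, hTk, hT, map_smul, map_neg, smul_neg, neg_neg,
        smul_smul] at hbr
      rw [← neg_smul] at hbr
      have := eq_of_smul_eq_smul_of_ne_zero hv hbr
      nlinarith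
    · have hw_inv : IndexInvariant q T k (s • T (k + 1) v + t • v) := by
        intro i hi
        have hc : T i (T (k + 1) v) = T (k + 1) (T i v) :=
          congrArg (fun f : Module.End ℝ V => f v) (h.comm i (k + 1) (by omega) hk)
        rw [map_add, map_smul, map_smul, hc, hinv i (by omega), map_smul]
        module
      rcases ih (by omega) hw hw_inv h1 with h2 | h2
      · left; field_simp at h2; rw [h2]; ring
      · have h3 := eq_of_smul_eq_smul_of_ne_zero hw
          (h1.symm.trans (hw_inv.succ h2).jucysMurphy_apply)
        field_simp at h3
        exact absurd h3 hne

theorem longWord_sq_apply (h : HeckeRel q n T)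
    (hl : ∀ k, k < n → longWord T (k + 1) = ascWord T (k + 1) * longWord T k) {v : V} {χ : ℕ → ℝ}
    (hχ : ∀ i, i ≤ n → jucysMurphy T i v = χ i • v) {k : ℕ} (hk : k ≤ n) :
    (longWord T k * longWord T k) v = (∏ i ∈ Finset.range (k + 1), χ i) • v := by
  induction k with
  | zero =>
    have := hχ 0 (Nat.zero_le _)
    simpa [longWord, jucysMurphy] using this
  | succ k ih =>
    rw [h.longWord_succ_sq hl hk, Module.End.mul_apply, hχ _ hk, map_smul, ih (by omega),
      smul_smul, Finset.prod_range_succ _ (k + 1), mul_comm]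

theorem exists_indexInvariant_of_exchange (h : HeckeRel q n T) (hq : 1 < q)
    (hs : ∀ i, i < n → (T i).IsSymmetric) {M : Submodule ℝ V}
    (hM : ∀ i, i < n → ∀ v ∈ M, T i v ∈ M) {r d : ℕ} (hrd : r + 1 + d = n) {v : V} (hvM : v ∈ M)
    (hv : v ≠ 0) {χ : ℕ → ℝ} (hχ : ∀ i, i ≤ n → jucysMurphy T i v = χ i • v)
    (hinv : IndexInvariant q T r v) (hr : χ (r + 1) = q ^ r)
    (hhigh : ∀ k, r + 1 < k → k ≤ n → χ k * q = q ^ (2 * k)) :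
    ∃ w ∈ M, w ≠ 0 ∧ IndexInvariant q T (n - 1) w := by
  have hq0 : 0 < q := by positivity
  have hinj := pow_right_injective₀ hq0 hq.ne'
  induction d generalizing r v χ with
  | zero =>
    obtain rfl : n = r + 1 := by omega
    exact ⟨v, hvM, hv, hinv⟩
  | succ d ih =>
    have hrn : r + 1 < n := by omega
    have hb : χ (r + 2) = q ^ (2 * r + 3) := by
      have := hhigh (r + 2) (by omega) (by omega)
      have e : q ^ (2 * (r + 2)) = q ^ (2 * r + 3) * q := by ring
      exact mul_right_cancel₀ hq0.ne' (this.trans e)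
    obtain ⟨-, ⟨hba, -⟩ | ⟨hba, -⟩ | ⟨s, t, hw, h1, h2⟩⟩ :=
      h.exchange hq hs hrn hv (a := q ^ r) (b := χ (r + 2)) (by positivity)
        (hr ▸ hχ (r + 1) (by omega)) (hχ (r + 2) (by omega))
    · rw [hb, ← pow_add] at hba
      have := hinj hba
      omega
    · rw [hb] at hba
      have := hinj hba
      omega
    · have hjoint : ∀ i, i ≤ n → jucysMurphy T i (s • T (r + 1) v + t • v) =
          Function.update (Function.update χ (r + 1) (χ (r + 2) / q)) (r + 2) (q * q ^ r) i •
            (s • T (r + 1) v + t • v) := by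
        intro i hi
        rcases lt_trichotomy i (r + 1) with hlt | rfl | hgt
        · rw [Function.update_of_ne (by omega), Function.update_of_ne (by omega)]
          exact h.jucysMurphy_apply_smul_add hlt hrn (hχ i hi) s t
        · rw [Function.update_of_ne (by omega), Function.update_self]
          exact h1
        · rcases Nat.lt_or_ge (r + 2) i with hgt' | hle
          · rw [Function.update_of_ne (by omega), Function.update_of_ne (by omega)]
            have hc : jucysMurphy T i (T (r + 1) v) = T (r + 1) (jucysMurphy T i v) :=
              congrArg (fun f : Module.End ℝ V => f v)
                (h.commute_jucysMurphy_of_succ_lt (i := r + 1) (by omega) hi).eq.symm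
            rw [map_add, map_smul, map_smul, hc, hχ i hi, map_smul]
            module
          · obtain rfl : i = r + 2 := by omega
            rw [Function.update_self]
            exact h2
      refine ih (r := r + 1) (by omega)
        (M.add_mem (M.smul_mem _ (hM _ hrn v hvM)) (M.smul_mem _ hvM)) hw hjoint ?_ ?_ ?_
      · refine ((h.eigenvalue_pos_and_le hq hs (k := r + 1) hrn.le hw
          (fun i hi => hjoint i (by omega))).2).resolve_right ?_
        rw [Function.update_of_ne (by omega), Function.update_self, div_mul_cancel₀ _ hq0.ne', hb,
          not_le]
        exact pow_lt_pow_right₀ hq (by omega)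
      · rw [Function.update_self]; ring
      · intro k hk hkn
        rw [Function.update_of_ne (by omega), Function.update_of_ne (by omega)]
        exact hhigh k (by omega) hkn

theorem exists_indexInvariant_of_joint (h : HeckeRel q n T) (hq : 1 < q)
    (hs : ∀ i, i < n → (T i).IsSymmetric) {M : Submodule ℝ V}
    (hM : ∀ i, i < n → ∀ v ∈ M, T i v ∈ M) {v : V} (hvM : v ∈ M)
    (hv : v ≠ 0) {χ : ℕ → ℝ} (hχ : ∀ i, i ≤ n → jucysMurphy T i v = χ i • v)
    (hprod : (∏ i ∈ Finset.range (n + 1), χ i) * q = q ^ (n * n)) :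
    ∃ w ∈ M, w ≠ 0 ∧ IndexInvariant q T (n - 1) w := by
  have hq0 : 0 < q := by positivity
  by_cases hn : IndexInvariant q T n v
  · exact ⟨v, hvM, hv, fun i hi => hn i (by omega)⟩
  obtain ⟨r, hrn, hr, hr'⟩ : ∃ r, r < n ∧ IndexInvariant q T r v ∧
      ¬ IndexInvariant q T (r + 1) v := by
    by_contra! hcon
    have : ∀ k, k ≤ n → IndexInvariant q T k v := by
      intro k
      induction k with
      | zero => exact fun _ i hi => absurd hi (Nat.not_lt_zero i)
      | succ k ih => exact fun hk => hcon k hk (ih (by omega))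
    exact hn (this n le_rfl)
  have hlow : ∀ i, i ≤ r → χ i = q ^ (2 * i) := fun i hi =>
    eq_of_smul_eq_smul_of_ne_zero hv ((hχ i (by omega)).symm.trans
      (IndexInvariant.jucysMurphy_apply fun j hj => hr j (by omega)))
  have hmid : χ (r + 1) = q ^ r :=
    (h.indexInvariant_of_lt hq hs hrn hv hr (hχ _ hrn)).resolve_right fun hT => hr' (hr.succ hT)
  have hpos : ∀ i, i ≤ n → 0 < χ i ∧ (IndexInvariant q T i v ∨ χ i * q ≤ q ^ (2 * i)) :=
    fun i hi => h.eigenvalue_pos_and_le hq hs hi hv fun j hj => hχ j (by omega)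
  have hhigh : ∀ i, r + 1 < i → i ≤ n → χ i ≤ q ^ (2 * i - 1) := by
    intro i hi hin
    have h1 := (hpos i hin).2.resolve_left fun h2 => hr' fun j hj => h2 j (by omega)
    have e : q ^ (2 * i) = q ^ (2 * i - 1) * q := by
      rw [← pow_succ]; congr 1; omega
    rw [e] at h1
    exact le_of_mul_le_mul_right h1 hq0
  obtain ⟨u, hu⟩ : ∃ u : ℕ → ℝ, u = fun i =>
      if i ≤ r then q ^ (2 * i) else if i = r + 1 then q ^ r else q ^ (2 * i - 1) := ⟨_, rfl⟩
  have hu_low : ∀ i, i ≤ r → u i = q ^ (2 * i) := fun i hi => by simp [hu, hi]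
  have hu_mid : u (r + 1) = q ^ r := by simp [hu]
  have hu_high : ∀ i, r + 1 < i → u i = q ^ (2 * i - 1) := fun i hi => by
    have h1 : ¬ i ≤ r := by omega
    have h2 : i ≠ r + 1 := by omega
    simp [hu, h1, h2]
  have hle : ∀ i, i ≤ n → χ i ≤ u i := by
    intro i hi
    rcases lt_trichotomy i (r + 1) with hlt | rfl | hgt
    · rw [hlow i (by omega), hu_low i (by omega)]
    · rw [hmid, hu_mid]
    · rw [hu_high i hgt]; exact hhigh i hgt hi
  have hprod_low : ∀ k, k ≤ r + 1 → ∏ i ∈ Finset.range k, u i = q ^ (k * (k - 1)) := by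
    intro k
    induction k with
    | zero => simp
    | succ k ih =>
      intro hk
      rw [Finset.prod_range_succ, ih (by omega), hu_low k (by omega), ← pow_add]
      congr 1
      rcases k with _ | k
      · rfl
      · simp only [Nat.add_sub_cancel]; ring
  have hprod_high : ∀ d, (∏ i ∈ Finset.range (r + 2 + d), u i) * q =
      q ^ ((r + 1 + d) * (r + 1 + d)) := by
    intro d
    induction d with
    | zero =>
      rw [Nat.add_zero, Nat.add_zero, Finset.prod_range_succ, hprod_low _ le_rfl, hu_mid,
        Nat.add_sub_cancel]
      ring
    | succ d ih =>
      rw [← Nat.add_assoc, Finset.prod_range_succ, hu_high _ (by omega), mul_right_comm, ih,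
        ← pow_add]
      congr 1
      have : 2 * (r + 2 + d) - 1 = 2 * (r + 1 + d) + 1 := by omega
      rw [this]; ring
  obtain ⟨d, hd⟩ : ∃ d, n = r + 1 + d := ⟨n - (r + 1), by omega⟩
  have hprod_eq : ∏ i ∈ Finset.range (n + 1), χ i = ∏ i ∈ Finset.range (n + 1), u i := by
    have h1 := hprod_high d
    rw [← hd, show r + 2 + d = n + 1 by omega, ← hprod] at h1
    exact (mul_right_cancel₀ hq0.ne' h1).symm
  have heq : ∀ i, i ≤ n → χ i = u i := by
    intro i hi
    by_contra hne
    refine hprod_eq.not_lt (Finset.prod_lt_prod (fun j hj => (hpos j ?_).1)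
      (fun j hj => hle j ?_) ⟨i, ?_, lt_of_le_of_ne (hle i hi) hne⟩)
    · exact Nat.lt_succ_iff.1 (Finset.mem_range.1 hj)
    · exact Nat.lt_succ_iff.1 (Finset.mem_range.1 hj)
    · exact Finset.mem_range.2 (Nat.lt_succ_of_le hi)
  refine h.exists_indexInvariant_of_exchange hq hs hM hd.symm hvM hv hχ hr hmid ?_
  intro k hk hkn
  rw [heq k hkn, hu_high k hk, ← pow_succ]
  congr 1
  omega

end HeckeRel

theorem exists_joint_eigenvector [FiniteDimensional ℝ V] {ι : Type*} {S : ι → Module.End ℝ V}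
    (hs : ∀ i, (S i).IsSymmetric) (hc : ∀ i j, Commute (S i) (S j)) {E : Submodule ℝ V}
    (hE : ∀ i, ∀ v ∈ E, S i v ∈ E) {v : V} (hvE : v ∈ E) (hv : v ≠ 0) :
    ∃ w ∈ E, w ≠ 0 ∧ ∃ χ : ι → ℝ, ∀ i, S i w = χ i • w := by
  have htop := LinearMap.IsSymmetric.iSup_iInf_eq_top_of_commute
    (T := fun i => (S i).restrict (hE i)) (fun i => (hs i).restrict_invariant (hE i))
    (fun i j _ => by
      apply LinearMap.ext
      intro x
      apply Subtype.ext
      exact congrArg (fun f : Module.End ℝ V => f x) (hc i j).eq)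
  obtain ⟨χ, hχ⟩ : ∃ χ : ι → ℝ,
      ⨅ i, Module.End.eigenspace ((S i).restrict (hE i)) (χ i) ≠ ⊥ := by
    by_contra! hcon
    simp only [hcon, iSup_bot] at htop
    have : (⟨v, hvE⟩ : E) ∈ (⊥ : Submodule ℝ E) := htop ▸ Submodule.mem_top
    exact hv (congrArg Subtype.val ((Submodule.mem_bot ℝ).1 this))
  obtain ⟨w, hw, hw0⟩ := Submodule.exists_mem_ne_zero_of_ne_bot hχ
  refine ⟨w, w.2, fun h0 => hw0 (Subtype.ext h0), χ, fun i => ?_⟩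
  have := Module.End.mem_eigenspace_iff.1 ((Submodule.mem_iInf _).1 hw i)
  exact congrArg Subtype.val this

theorem HeckeRel.exists_indexInvariant [FiniteDimensional ℝ V] (h : HeckeRel q n T) (hq : 1 < q)
    (hs : ∀ i, i < n → (T i).IsSymmetric)
    (hl : ∀ k, k < n → longWord T (k + 1) = ascWord T (k + 1) * longWord T k)
    {M : Submodule ℝ V} (hM : ∀ i, i < n → ∀ v ∈ M, T i v ∈ M) {v : V} (hvM : v ∈ M) (hv : v ≠ 0)
    {μ : ℝ} (hμ : μ * q = q ^ (n * n)) (hvμ : (longWord T n * longWord T n) v = μ • v) :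
    ∃ w ∈ M, w ≠ 0 ∧ IndexInvariant q T (n - 1) w := by
  have hMj : ∀ k, k ≤ n → ∀ v ∈ M, jucysMurphy T k v ∈ M := by
    intro k
    induction k with
    | zero => exact fun _ v hv => hv
    | succ k ih => exact fun hk v hv => hM k hk _ (ih (by omega) _ (hM k hk _ hv))
  obtain ⟨w, hwE, hw, χ, hχ⟩ := exists_joint_eigenvector
    (S := fun i : Fin (n + 1) => jucysMurphy T i)
    (E := M ⊓ Module.End.eigenspace (longWord T n * longWord T n) μ)
    (fun i => jucysMurphy_isSymmetric hs (Nat.lt_succ_iff.1 i.2))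
    (fun i j => by
      rcases le_total (i : ℕ) j with hij | hij
      · exact h.commute_jucysMurphy hij (Nat.lt_succ_iff.1 j.2)
      · exact (h.commute_jucysMurphy hij (Nat.lt_succ_iff.1 i.2)).symm)
    (by
      rintro i x ⟨hx1, hx2⟩
      refine ⟨hMj _ (Nat.lt_succ_iff.1 i.2) _ hx1, Module.End.mem_eigenspace_iff.2 ?_⟩
      have hc := h.commute_longWord_sq_jucysMurphy hl le_rfl (Nat.lt_succ_iff.1 i.2)
      have := congrArg (fun f : Module.End ℝ V => f x) hc.eq
      simp only [Module.End.mul_apply (jucysMurphy T i)] at this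
      rw [Module.End.mul_apply] at this
      rw [this, Module.End.mem_eigenspace_iff.1 hx2, map_smul])
    ⟨hvM, Module.End.mem_eigenspace_iff.2 hvμ⟩ hv
  have hχ' : ∀ i, i ≤ n → jucysMurphy T i w =
      (fun i => if hi : i < n + 1 then χ ⟨i, hi⟩ else 0) i • w := fun i hi => by
    simpa [Nat.lt_succ_of_le hi] using hχ ⟨i, Nat.lt_succ_of_le hi⟩
  refine h.exists_indexInvariant_of_joint hq hs hM hwE.1 hw hχ' ?_
  have h1 := (h.longWord_sq_apply hl hχ' le_rfl).symm.trans
    (Module.End.mem_eigenspace_iff.1 hwE.2)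
  rw [eq_of_smul_eq_smul_of_ne_zero hw h1, hμ]

end Spectrum

/-- Relations between the generators and the point-flag incidence maps: `S i` records the
incidence of points with the `i`-dimensional members of flags. -/
structure IncidenceChain {K U V : Type*} [Field K] [AddCommGroup U] [Module K U] [AddCommGroup V]
    [Module K V] (q : K) (n : ℕ) (T : ℕ → Module.End K V) (S : ℕ → U →ₗ[K] V) : Prop where
  bot : S 0 = 0
  top : S (n + 1) = 0
  apply_of_ne : ∀ k j, k < n → j ≤ n + 1 → j ≠ k + 1 → ∀ u, T k (S j u) = q • S j u
  apply_succ : ∀ k, k < n → ∀ u, T k (S (k + 1) u) = q • S k u + S (k + 2) u - S (k + 1) u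

section LongWord

variable {K V : Type*} [Field K] [AddCommGroup V] [Module K V] {q : K} {n : ℕ}
  {T : ℕ → Module.End K V}

theorem descWord_apply_of_forall_smul {k : ℕ} {x : V} (hx : ∀ i, i < k → T i x = q • x) :
    descWord T k x = q ^ k • x := by
  induction k with
  | zero => simp [descWord]
  | succ k ih =>
    rw [descWord, Module.End.mul_apply, ih fun i hi => hx i (by omega), map_smul, hx k (by omega),
      smul_smul, pow_succ]

theorem longWord_apply_of_forall_smul {k : ℕ} {x : V} (hx : ∀ i, i < k → T i x = q • x) :
    longWord T k x = q ^ (∑ i ∈ Finset.range (k + 1), i) • x := by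
  induction k with
  | zero => simp [longWord]
  | succ k ih =>
    rw [longWord, Module.End.mul_apply, descWord_apply_of_forall_smul hx, map_smul,
      ih fun i hi => hx i (by omega), smul_smul, ← pow_add, Finset.sum_range_succ _ (k + 1),
      add_comm (k + 1)]

end LongWord

namespace IncidenceChain

section Field

variable {K U V : Type*} [Field K] [AddCommGroup U] [Module K U] [AddCommGroup V]
    [Module K V] {q : K} {n : ℕ} {T : ℕ → Module.End K V} {S : ℕ → U →ₗ[K] V}

theorem descWord_apply (h : IncidenceChain q n T S) {j k : ℕ} (hjk : j < k) (hk : k ≤ n) (u : U) :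
    descWord T k (S (j + 1) u) = q ^ k • S j u + q ^ j • (S (k + 1) u - S k u) := by
  induction k with
  | zero => omega
  | succ k ih =>
    rw [descWord, Module.End.mul_apply]
    rcases Nat.lt_or_ge j k with hlt | hge
    · rw [ih hlt (by omega), map_add, map_smul, map_smul, map_sub, h.apply_succ k hk,
        h.apply_of_ne k k hk (by omega) (by omega), h.apply_of_ne k j hk (by omega) (by omega)]
      match_scalars <;> ring
    · obtain rfl : j = k := by omega
      rw [descWord_apply_of_forall_smul fun i hi =>
        h.apply_of_ne i (j + 1) (by omega) (by omega) (by omega) u, map_smul, h.apply_succ j hk]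
      match_scalars <;> ring

theorem longWord_apply_of_lt (h : IncidenceChain q n T S) {j k : ℕ} (hkj : k < j) (hk : k ≤ n)
    (hj : j ≤ n + 1) (u : U) :
    longWord T k (S j u) = q ^ (∑ i ∈ Finset.range (k + 1), i) • S j u :=
  longWord_apply_of_forall_smul fun i hi =>
    h.apply_of_ne i j (by omega) hj (by omega) u

theorem longWord_apply (h : IncidenceChain q n T S) {j k : ℕ} (hjk : j ≤ k + 1) (hk : k ≤ n)
    (u : U) :
    q ^ (k + 1) • longWord T k (S j u) =
      q ^ (∑ i ∈ Finset.range (k + 1), i + j) • (S (k + 1) u - S (k + 1 - j) u) := by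
  induction k generalizing j with
  | zero =>
    obtain rfl | rfl : j = 0 ∨ j = 1 := by omega
    · simp [h.bot]
    · simp [h.bot, longWord]
  | succ k ih =>
    rcases j with _ | j
    · simp [h.bot]
    · rcases Nat.lt_or_ge j (k + 1) with hlt | hge
      · rw [longWord, Module.End.mul_apply, h.descWord_apply (j := j) (k := k + 1) (by omega) hk,
          map_add, map_smul,
          map_smul, map_sub, smul_add, smul_smul (q ^ (k + 1 + 1)), mul_comm (q ^ (k + 1 + 1)),
          ← smul_smul, pow_succ q (k + 1), mul_comm (q ^ (k + 1)), ← smul_smul q (q ^ (k + 1)),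
          ih (j := j) (by omega) (by omega),
          h.longWord_apply_of_lt (j := k + 1 + 1) (by omega) (by omega) (by omega),
          h.longWord_apply_of_lt (j := k + 1) (by omega) (by omega) (by omega),
          Finset.sum_range_succ _ (k + 1)]
        have e : k + 1 + 1 - (j + 1) = k + 1 - j := by omega
        rw [e]
        match_scalars <;> ring
      · obtain rfl : j = k + 1 := by omega
        rw [h.longWord_apply_of_lt (by omega) hk (by omega), Nat.sub_self, h.bot,
          LinearMap.zero_apply, sub_zero, smul_smul, ← pow_add, add_comm]

/-- The combination of incidence maps whose range lies in the smallest eigenspace. -/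
def minEigenMap (q : K) (m : ℕ) (S : ℕ → U →ₗ[K] V) (j : ℕ) : U →ₗ[K] V :=
  (q ^ j + 1) • S m - q ^ j • S (m - j) - S (m + j)

theorem minEigenMap_apply (q : K) (m : ℕ) (S : ℕ → U →ₗ[K] V) (j : ℕ) (u : U) :
    minEigenMap q m S j u = (q ^ j + 1) • S m u - q ^ j • S (m - j) u - S (m + j) u := rfl

end Field

variable {K U V : Type*} [Field K] [LinearOrder K] [IsStrictOrderedRing K] [AddCommGroup U]
  [Module K U] [AddCommGroup V] [Module K V] {q : K} {n m : ℕ} {T : ℕ → Module.End K V}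
  {S : ℕ → U →ₗ[K] V}

/-- A single second-order recurrence relation forces a chain with zero ends to vanish. -/
theorem eq_zero_of_recurrence (h : IncidenceChain q n T S) (hq : 1 < q) {k : ℕ} (hk : k < n)
    {u : U} (hu : q • S k u + S (k + 2) u - (q + 1) • S (k + 1) u = 0) {j : ℕ} (hj : j ≤ n + 1) :
    S j u = 0 := by
  have hq0 : 0 < q := by positivity
  have hdown : ∀ i, i ≤ k → q • S i u + S (i + 2) u - (q + 1) • S (i + 1) u = 0 := by
    intro i hi
    induction hi using Nat.decreasingInduction with
    | self => exact hu
    | of_succ i hi ih =>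
      have h1 := congrArg (T i) ih
      rw [map_sub, map_add, map_smul, map_smul, h.apply_succ i (by omega),
        h.apply_of_ne i (i + 1 + 2) (by omega) (by omega) (by omega),
        h.apply_of_ne i (i + 1 + 1) (by omega) (by omega) (by omega), map_zero] at h1
      rw [show i + 1 + 1 = i + 2 from rfl, show i + 1 + 2 = i + 3 from rfl] at h1 ih
      have h2 : q • (q • S i u + S (i + 2) u - (q + 1) • S (i + 1) u) =
          (q • (q • S i u + S (i + 2) u - S (i + 1) u) + q • S (i + 3) u -
            (q + 1) • q • S (i + 2) u) -
          q • (q • S (i + 1) u + S (i + 3) u - (q + 1) • S (i + 2) u) := by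
        module
      rw [h1, ih, smul_zero, sub_zero] at h2
      exact (smul_eq_zero.1 h2).resolve_left hq0.ne'
  have hup : ∀ i, k ≤ i → i < n → q • S i u + S (i + 2) u - (q + 1) • S (i + 1) u = 0 := by
    intro i hi
    induction i, hi using Nat.le_induction with
    | base => exact fun _ => hu
    | succ i hi ih =>
      intro hin
      have ih := ih (by omega)
      have h1 := congrArg (T (i + 1)) ih
      rw [map_sub, map_add, map_smul, map_smul, h.apply_succ (i + 1) hin,
        h.apply_of_ne (i + 1) i (by omega) (by omega) (by omega),
        h.apply_of_ne (i + 1) (i + 1) (by omega) (by omega) (by omega), map_zero] at h1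
      rw [show i + 1 + 1 = i + 2 from rfl] at h1 ⊢
      have h2 : q • S (i + 1) u + S (i + 1 + 2) u - (q + 1) • S (i + 2) u =
          (q • q • S i u + (q • S (i + 1) u + S (i + 1 + 2) u - S (i + 2) u) -
            (q + 1) • q • S (i + 1) u) -
          q • (q • S i u + S (i + 2) u - (q + 1) • S (i + 1) u) := by
        module
      rw [h2, h1, ih, smul_zero, sub_zero]
  have hall : ∀ i, i < n → S (i + 2) u = (q + 1) • S (i + 1) u - q • S i u := by
    intro i hi
    have : q • S i u + S (i + 2) u - (q + 1) • S (i + 1) u = 0 := by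
      rcases le_total i k with hik | hik
      exacts [hdown i hik, hup i hik hi]
    exact eq_sub_of_add_eq' (eq_of_sub_eq_zero this)
  have hdiff : ∀ i, i ≤ n → S (i + 1) u - S i u = q ^ i • S 1 u := by
    intro i
    induction i with
    | zero => simp [h.bot]
    | succ i ih =>
      intro hi
      rw [hall i (by omega), pow_succ', mul_smul, ← ih (by omega)]
      module
  have hgeom : ∀ i, i ≤ n + 1 → S i u = (∑ l ∈ Finset.range i, q ^ l) • S 1 u := by
    intro i
    induction i with
    | zero => simp [h.bot]
    | succ i ih =>
      intro hi
      rw [Finset.sum_range_succ, add_smul, ← ih (by omega), ← hdiff i (by omega)]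
      abel
  have h1 : S 1 u = 0 := by
    have := hgeom (n + 1) le_rfl
    rw [h.top, LinearMap.zero_apply] at this
    refine (smul_eq_zero.1 this.symm).resolve_left (ne_of_gt ?_)
    exact Finset.sum_pos (fun i _ => by positivity) ⟨0, by simp⟩
  rw [hgeom j hj, h1, smul_zero]

theorem iSupIndep_range_minEigenMap (h : IncidenceChain q n T S) (hq : 1 < q)
    (hnm : n + 1 = 2 * m) :
    iSupIndep fun j : Fin m => LinearMap.range (minEigenMap q m S (j + 1)) := by
  have hq0 : 0 < q := by positivity
  rw [iSupIndep_iff_finsetSum_eq_zero_imp_eq_zero]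
  intro s f hf hsum
  have hlow : ∀ i ∈ s, (i : ℕ) + 1 < m → f i = 0 := by
    intro i hi him
    obtain ⟨k, hk⟩ : ∃ k, m = (i : ℕ) + 1 + (k + 1) := ⟨m - i - 2, by omega⟩
    obtain ⟨u, hu⟩ := hf i hi
    have hother : ∀ l ∈ s, l ≠ i → T k (f l) = q • f l := by
      intro l hl hli
      obtain ⟨w, hw⟩ := hf l hl
      have hne : (l : ℕ) ≠ i := fun e => hli (Fin.ext e)
      have hlm := l.2
      rw [← hw, minEigenMap_apply, map_sub, map_sub, map_smul, map_smul,
        h.apply_of_ne k _ (by omega) (by omega) (by omega),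
        h.apply_of_ne k _ (by omega) (by omega) (by omega),
        h.apply_of_ne k _ (by omega) (by omega) (by omega)]
      module
    have h1 : T k (f i) = q • f i := by
      have h2 := congrArg (T k) hsum
      have h3 := congrArg (q • ·) hsum
      simp only [map_sum, map_zero, Finset.smul_sum, smul_zero] at h2 h3
      rw [← Finset.add_sum_erase _ _ hi] at h2 h3
      rw [Finset.sum_congr rfl fun l hl =>
        hother l (Finset.mem_of_mem_erase hl) (Finset.ne_of_mem_erase hl)] at h2
      exact add_right_cancel (h2.trans h3.symm)
    have e : m - ((i : ℕ) + 1) = k + 1 := by omega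
    rw [← hu, minEigenMap_apply, map_sub, map_sub, map_smul, map_smul, e,
      h.apply_of_ne k m (by omega) (by omega) (by omega),
      h.apply_of_ne k (m + _) (by omega) (by omega) (by omega), h.apply_succ k (by omega)] at h1
    have h4 : q ^ ((i : ℕ) + 1) • (q • S k u + S (k + 2) u - (q + 1) • S (k + 1) u) = 0 := by
      rw [← sub_self (q • ((q ^ ((i : ℕ) + 1) + 1) • S m u - q ^ ((i : ℕ) + 1) • S (k + 1) u -
        S (m + (i + 1)) u))]
      nth_rewrite 2 [← h1]
      module
    have h5 := (smul_eq_zero.1 h4).resolve_left (by positivity)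
    rw [← hu, minEigenMap_apply, h.eq_zero_of_recurrence hq (by omega) h5 (by omega),
      h.eq_zero_of_recurrence hq (by omega) h5 (by omega),
      h.eq_zero_of_recurrence hq (by omega) h5 (by omega)]
    simp
  intro i hi
  by_cases him : (i : ℕ) + 1 < m
  · exact hlow i hi him
  · rw [← hsum]
    symm
    refine Finset.sum_eq_single i (fun l hl hli => hlow l hl ?_) fun h' => absurd hi h'
    have hne : (l : ℕ) ≠ i := fun e => hli (Fin.ext e)
    have := l.2
    omega

theorem longWord_top_apply (h : IncidenceChain q n T S) (hq : 1 < q) (hnm : n + 1 = 2 * m) {i : ℕ}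
    (hi : i ≤ 2 * m) (u : U) :
    longWord T n (S i u) = -((q ^ (2 * m ^ 2 - 2 * m) * q ^ i * (q ^ m)⁻¹) • S (2 * m - i) u) := by
  have hq0 : 0 < q := by positivity
  have h1 := h.longWord_apply (by omega : i ≤ n + 1) le_rfl u
  rw [h.top, LinearMap.zero_apply, zero_sub, hnm] at h1
  have hexp : ∑ i ∈ Finset.range (2 * m), i + m = 2 * m ^ 2 - 2 * m + 2 * m := by
    have h2 := Finset.sum_range_id_mul_two (2 * m)
    have h3 : 2 * m ≤ 2 * m ^ 2 := by
      nlinarith [Nat.zero_le (m * (m - 1)), Nat.le_self_pow (n := 2) (by norm_num) m]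
    have h4 : 2 * m * (2 * m - 1) + 2 * m = 2 * m * (2 * m) := by
      rcases m with _ | m
      · rfl
      · rw [show 2 * (m + 1) - 1 = 2 * m + 1 by omega]; ring
    have h5 : 2 * m * (2 * m) = 4 * m ^ 2 := by ring
    omega
  have hpow : q ^ (∑ i ∈ Finset.range (2 * m), i) =
      q ^ (2 * m ^ 2 - 2 * m) * q ^ (2 * m) * (q ^ m)⁻¹ := by
    rw [← pow_add, ← hexp, pow_add]
    field_simp
  have h6 : longWord T n (S i u) = (q ^ (2 * m))⁻¹ • (q ^ (2 * m) • longWord T n (S i u)) := by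
    rw [smul_smul, inv_mul_cancel₀ (by positivity), one_smul]
  rw [h6, h1, pow_add, hpow]
  match_scalars
  field_simp

theorem longWord_apply_minEigenMap (h : IncidenceChain q n T S) (hq : 1 < q) (hnm : n + 1 = 2 * m)
    {j : ℕ} (hj : j ≤ m) (u : U) :
    longWord T n (minEigenMap q m S j u) =
      -(q ^ (2 * m ^ 2 - 2 * m)) • minEigenMap q m S j u := by
  have hq0 : 0 < q := by positivity
  obtain ⟨k, rfl⟩ : ∃ k, m = k + j := ⟨m - j, by omega⟩
  rw [minEigenMap_apply, map_sub, map_sub, map_smul, map_smul, h.longWord_top_apply hq hnm,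
    h.longWord_top_apply hq hnm, h.longWord_top_apply hq hnm,
    show 2 * (k + j) - (k + j) = k + j by omega, show k + j - j = k by omega,
    show 2 * (k + j) - k = k + j + j by omega, show 2 * (k + j) - (k + j + j) = k by omega]
  · match_scalars <;> field_simp <;> ring
  all_goals omega

theorem mem_iSup_range_minEigenMap (h : IncidenceChain q n T S) (hq : 1 < q) (hnm : n + 1 = 2 * m)
    {u : ℕ → U} {f : V} (hf : f = ∑ i ∈ Finset.range (2 * m + 1), S i (u i))
    (hAf : longWord T n f = -(q ^ (2 * m ^ 2 - 2 * m)) • f) :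
    f ∈ ⨆ j : Fin m, LinearMap.range (minEigenMap q m S (j + 1)) := by
  have hq0 : 0 < q := by positivity
  have hm : 0 < m := by omega
  set W := ⨆ j : Fin m, LinearMap.range (minEigenMap q m S (j + 1)) with hW
  have hmemW : ∀ j, j ≤ m → ∀ u, minEigenMap q m S j u ∈ W := by
    intro j hj u
    rcases j with _ | j
    · have : minEigenMap q m S 0 u = 0 := by
        rw [minEigenMap_apply, Nat.sub_zero, Nat.add_zero]; module
      rw [this]; exact W.zero_mem
    · exact Submodule.mem_iSup_of_mem (⟨j, hj⟩ : Fin m) ⟨u, rfl⟩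
  have hmid : ∀ u, S m u ∈ W := by
    intro u
    have h1 := hmemW m le_rfl u
    rw [minEigenMap_apply, Nat.sub_self, ← two_mul, ← hnm, h.top, h.bot, LinearMap.zero_apply,
      smul_zero, sub_zero, sub_zero] at h1
    exact (W.smul_mem_iff (by positivity)).1 h1
  have hpair : ∀ j, j ≤ m → ∀ u, q ^ j • S (m - j) u + S (m + j) u ∈ W := by
    intro j hj u
    have := W.sub_mem (W.smul_mem (q ^ j + 1) (hmid u)) (hmemW j hj u)
    rw [minEigenMap_apply] at this
    convert this using 1
    module
  have hterm : ∀ i, i ≤ 2 * m → ∀ u,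
      q ^ (2 * m ^ 2 - 2 * m) • S i u - longWord T n (S i u) ∈ W := by
    intro i hi u
    rw [h.longWord_top_apply hq hnm hi]
    rcases le_total i m with him | him
    · obtain ⟨j, rfl⟩ : ∃ j, m = i + j := ⟨m - i, by omega⟩
      have := W.smul_mem (q ^ (2 * (i + j) ^ 2 - 2 * (i + j)) * (q ^ j)⁻¹) (hpair j (by omega) u)
      rw [show i + j - j = i by omega] at this
      rw [show 2 * (i + j) - i = i + j + j by omega]
      convert this using 1
      match_scalars <;> field_simp
      ring
    · obtain ⟨j, rfl⟩ : ∃ j, i = m + j := ⟨i - m, by omega⟩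
      have := W.smul_mem (q ^ (2 * m ^ 2 - 2 * m)) (hpair j (by omega) u)
      rw [show 2 * m - (m + j) = m - j by omega]
      convert this using 1
      match_scalars <;> field_simp
      ring
  have h2 : (2 * q ^ (2 * m ^ 2 - 2 * m)) • f ∈ W := by
    have h3 : (2 * q ^ (2 * m ^ 2 - 2 * m)) • f =
        q ^ (2 * m ^ 2 - 2 * m) • f - longWord T n f := by
      rw [hAf]; module
    rw [h3]
    nth_rewrite 2 [hf]
    nth_rewrite 1 [hf]
    rw [map_sum, Finset.smul_sum, ← Finset.sum_sub_distrib]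
    exact W.sum_mem fun i hi => hterm i (by have := Finset.mem_range.1 hi; omega) _
  exact (W.smul_mem_iff (by positivity)).1 h2

end IncidenceChain

/-! ### Maximal flags -/

section Flags

variable {F : Type} [Field F] {m : ℕ} {c d e : MaxFlag2 F m}

theorem flagMem2_eq (c : MaxFlag2 F m) (i : Fin (2 * m + 1)) : c.1 i = flagMem2 c i := by
  simp [flagMem2, i.2]

theorem flagMem2_mono (c : MaxFlag2 F m) : Monotone (flagMem2 c) := by
  intro i j hij
  unfold flagMem2
  split_ifs with hi hj
  · exact c.2.1 hij
  · exact le_top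
  · omega
  · exact le_rfl

theorem finrank_flagMem2 (c : MaxFlag2 F m) {k : ℕ} (hk : k ≤ 2 * m) :
    Module.finrank F (flagMem2 c k) = k := by
  rw [flagMem2, dif_pos (by omega), c.2.2]

theorem flagMem2_zero (c : MaxFlag2 F m) : flagMem2 c 0 = ⊥ :=
  Submodule.finrank_eq_zero.1 (finrank_flagMem2 c (Nat.zero_le _))

theorem flagMem2_of_le (c : MaxFlag2 F m) {k : ℕ} (hk : 2 * m ≤ k) : flagMem2 c k = ⊤ := by
  refine top_unique (le_trans (Eq.ge ?_) (flagMem2_mono c hk))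
  exact Submodule.eq_top_of_finrank_eq (by simp [finrank_flagMem2 c le_rfl])

theorem flagMem2_injective (h : ∀ k, 1 ≤ k → k < 2 * m → flagMem2 c k = flagMem2 d k) : c = d := by
  refine Subtype.ext (funext fun i => ?_)
  rw [flagMem2_eq, flagMem2_eq]
  rcases Nat.eq_zero_or_pos (i : ℕ) with hi | hi
  · rw [hi, flagMem2_zero, flagMem2_zero]
  · rcases Nat.lt_or_ge (i : ℕ) (2 * m) with hlt | hge
    · exact h i hi hlt
    · rw [flagMem2_of_le c hge, flagMem2_of_le d hge]

theorem exists_flag_update (c : MaxFlag2 F m) {k : ℕ} (hk : k + 2 ≤ 2 * m)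
    {W : Submodule F (Fin (2 * m) → F)} (h1 : flagMem2 c k ≤ W) (h2 : W ≤ flagMem2 c (k + 2))
    (hW : Module.finrank F W = k + 1) :
    ∃ d : MaxFlag2 F m, flagMem2 d (k + 1) = W ∧ ∀ j, j ≠ k + 1 → flagMem2 d j = flagMem2 c j := by
  obtain ⟨g, hg, hg'⟩ : ∃ g : ℕ → Submodule F (Fin (2 * m) → F),
      g (k + 1) = W ∧ ∀ j, j ≠ k + 1 → g j = flagMem2 c j :=
    ⟨fun i => if i = k + 1 then W else flagMem2 c i, if_pos rfl, fun j hj => if_neg hj⟩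
  have hmono : Monotone g := by
    intro i j hij
    rcases eq_or_ne i (k + 1) with hi | hi <;> rcases eq_or_ne j (k + 1) with hj | hj
    · rw [hi, hj]
    · rw [hi, hg, hg' j hj]
      exact h2.trans (flagMem2_mono c (by omega))
    · rw [hj, hg, hg' i hi]
      exact (flagMem2_mono c (by omega)).trans h1
    · rw [hg' i hi, hg' j hj]
      exact flagMem2_mono c hij
  have hfin : ∀ i : Fin (2 * m + 1), Module.finrank F (g i) = i := by
    intro i
    rcases eq_or_ne (i : ℕ) (k + 1) with hi | hi
    · rw [hi, hg, hW]
    · rw [hg' i hi, finrank_flagMem2 c (by omega)]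
  obtain ⟨d, hd⟩ : ∃ d : MaxFlag2 F m, ∀ j, j < 2 * m + 1 → flagMem2 d j = g j :=
    ⟨⟨fun i => g i, fun i j hij => hmono hij, hfin⟩, fun j hj => dif_pos hj⟩
  refine ⟨d, by rw [hd _ (by omega), hg], fun j hj => ?_⟩
  by_cases hjm : j < 2 * m + 1
  · rw [hd j hjm, hg' j hj]
  · rw [flagMem2_of_le d (by omega), flagMem2_of_le c (by omega)]

/-- Two flags that agree except possibly in dimension `k + 1`. -/
def SamePanel (k : ℕ) (c d : MaxFlag2 F m) : Prop :=
  ∀ j, j ≠ k + 1 → flagMem2 c j = flagMem2 d j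

/-- Two flags that differ exactly in dimension `k + 1`. -/
def PanelAdj (k : ℕ) (c d : MaxFlag2 F m) : Prop :=
  SamePanel k c d ∧ flagMem2 c (k + 1) ≠ flagMem2 d (k + 1)

theorem SamePanel.refl (k : ℕ) (c : MaxFlag2 F m) : SamePanel k c c := fun _ _ => rfl

theorem SamePanel.symm {k : ℕ} (h : SamePanel k c d) : SamePanel k d c :=
  fun j hj => (h j hj).symm

theorem SamePanel.trans {k : ℕ} (h : SamePanel k c d) (h' : SamePanel k d e) : SamePanel k c e :=
  fun j hj => (h j hj).trans (h' j hj)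

theorem PanelAdj.symm {k : ℕ} (h : PanelAdj k c d) : PanelAdj k d c := ⟨h.1.symm, h.2.symm⟩

theorem SamePanel.eq_of_eq {k : ℕ} (h : SamePanel k c d)
    (h' : flagMem2 c (k + 1) = flagMem2 d (k + 1)) : c = d :=
  flagMem2_injective fun j _ _ => by
    by_cases hj : j = k + 1
    · rw [hj, h']
    · exact h j hj

theorem exists_samePanel (c : MaxFlag2 F m) {k : ℕ} (hk : k + 2 ≤ 2 * m)
    {W : Submodule F (Fin (2 * m) → F)} (h1 : flagMem2 c k ≤ W) (h2 : W ≤ flagMem2 c (k + 2))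
    (hW : Module.finrank F W = k + 1) :
    ∃ d : MaxFlag2 F m, flagMem2 d (k + 1) = W ∧ SamePanel k c d := by
  obtain ⟨d, hd, hd'⟩ := exists_flag_update c hk h1 h2 hW
  exact ⟨d, hd, fun j hj => (hd' j hj).symm⟩

end Flags

section Hyperplane

variable {F V : Type*} [Field F] [AddCommGroup V] [Module F V] [FiniteDimensional F V]
  {A B C : Submodule F V} {a : ℕ}

theorem finrank_inf_of_hyperplane (hA : A ≤ C) (hB : B ≤ C) (hAB : ¬ A ≤ B)
    (hb : Module.finrank F C = Module.finrank F B + 1) :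
    Module.finrank F (A ⊓ B : Submodule F V) + 1 = Module.finrank F A := by
  have h1 := Submodule.finrank_sup_add_finrank_inf_eq A B
  have h2 : Module.finrank F (A ⊔ B : Submodule F V) ≤ Module.finrank F C :=
    Submodule.finrank_mono (sup_le hA hB)
  have h3 : Module.finrank F B < Module.finrank F (A ⊔ B : Submodule F V) :=
    Submodule.finrank_lt_finrank_of_lt (lt_of_le_of_ne le_sup_right fun h =>
      hAB (h ▸ le_sup_left))
  omega

theorem finrank_sup_of_inter (hA : C ≤ A) (hB : C ≤ B) (hAB : ¬ A ≤ B)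
    (ha : Module.finrank F A = Module.finrank F C + 1) :
    Module.finrank F (A ⊔ B : Submodule F V) = Module.finrank F B + 1 := by
  have h1 := Submodule.finrank_sup_add_finrank_inf_eq A B
  have h2 : Module.finrank F C ≤ Module.finrank F (A ⊓ B : Submodule F V) :=
    Submodule.finrank_mono (le_inf hA hB)
  have h3 : Module.finrank F (A ⊓ B : Submodule F V) < Module.finrank F A :=
    Submodule.finrank_lt_finrank_of_lt (lt_of_le_of_ne inf_le_left fun h =>
      hAB (h ▸ inf_le_right))
  omega

theorem not_le_of_inf_eq_bot (hB : B ≤ C) (hAB : A ⊓ B = ⊥)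
    (hlt : Module.finrank F C < Module.finrank F A + Module.finrank F B) : ¬ A ≤ C := by
  intro hA
  have h1 := Submodule.finrank_sup_add_finrank_inf_eq A B
  rw [hAB, finrank_bot] at h1
  have h2 : Module.finrank F (A ⊔ B : Submodule F V) ≤ Module.finrank F C :=
    Submodule.finrank_mono (sup_le hA hB)
  omega

end Hyperplane

section RelMatrix

variable {K : Type*} {α β γ : Type*}

open Classical in
/-- The `0/1`-matrix of a relation. -/
noncomputable def relMatrix (K : Type*) [Zero K] [One K] (r : α → β → Prop) : Matrix α β K :=
  Matrix.of fun a b => if r a b then 1 else 0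

open Classical in
theorem relMatrix_apply [Zero K] [One K] (r : α → β → Prop) (a : α) (b : β) :
    relMatrix K r a b = if r a b then 1 else 0 := rfl

theorem relMatrix_transpose [Zero K] [One K] (r : α → β → Prop) :
    (relMatrix K r)ᵀ = relMatrix K fun b a => r a b := rfl

theorem relMatrix_transpose_of_symm [Zero K] [One K] {r : α → α → Prop}
    (h : ∀ a b, r a b → r b a) : (relMatrix K r)ᵀ = relMatrix K r := by
  rw [relMatrix_transpose]
  congr 1
  funext a b
  exact propext ⟨h b a, h a b⟩

open Classical in
theorem relMatrix_mul_apply [Semiring K] [Fintype β] (r : α → β → Prop) (s : β → γ → Prop)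
    (a : α) (c : γ) :
    (relMatrix K r * relMatrix K s) a c = (Finset.univ.filter fun b => r a b ∧ s b c).card := by
  rw [Matrix.mul_apply, Finset.card_filter, Nat.cast_sum]
  refine Finset.sum_congr rfl fun b _ => ?_
  rw [relMatrix_apply, relMatrix_apply]
  by_cases h1 : r a b <;> by_cases h2 : s b c <;> simp [h1, h2]

theorem relMatrix_mul [Semiring K] [Fintype β] {r : α → β → Prop} {s : β → γ → Prop}
    {t : α → γ → Prop} (h : ∀ a b c, r a b → s b c → t a c)
    (hex : ∀ a c, t a c → ∃ b, r a b ∧ s b c)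
    (huniq : ∀ a b b' c, r a b → s b c → r a b' → s b' c → b = b') :
    relMatrix K r * relMatrix K s = relMatrix K t := by
  classical
  ext a c
  rw [relMatrix_mul_apply, relMatrix_apply]
  split_ifs with ht
  · obtain ⟨b, hb, hb'⟩ := hex a c ht
    rw [Finset.card_eq_one.2 ⟨b, ?_⟩, Nat.cast_one]
    ext b'
    simp only [Finset.mem_filter, Finset.mem_univ, true_and, Finset.mem_singleton]
    exact ⟨fun hr => huniq a b' b c hr.1 hr.2 hb hb', fun e => e ▸ ⟨hb, hb'⟩⟩
  · rw [Finset.card_eq_zero.2, Nat.cast_zero]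
    exact Finset.filter_eq_empty_iff.2 fun b _ hb => ht (h a b c hb.1 hb.2)

end RelMatrix

section Opposition

variable {F : Type} [Field F] {m : ℕ} {c d e : MaxFlag2 F m}

/-- Flags agreeing above dimension `k`, and opposite within their common member of dimension
`k + 1`. -/
def OppUpTo (k : ℕ) (c d : MaxFlag2 F m) : Prop :=
  (∀ i, k + 1 ≤ i → flagMem2 d i = flagMem2 c i) ∧
    ∀ i, i ≤ k + 1 → flagMem2 d i ⊓ flagMem2 c (k + 1 - i) = ⊥

theorem OppUpTo.symm {k : ℕ} (h : OppUpTo k c d) : OppUpTo k d c := by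
  refine ⟨fun i hi => (h.1 i hi).symm, fun i hi => ?_⟩
  have := h.2 (k + 1 - i) (by omega)
  rwa [show k + 1 - (k + 1 - i) = i by omega, inf_comm] at this

theorem oppUpTo_zero : OppUpTo 0 c d ↔ c = d := by
  constructor
  · exact fun h => flagMem2_injective fun k hk _ => (h.1 k hk).symm
  · rintro rfl
    refine ⟨fun _ _ => rfl, fun i hi => ?_⟩
    obtain rfl | rfl : i = 0 ∨ i = 1 := by omega
    · rw [flagMem2_zero, bot_inf_eq]
    · rw [Nat.sub_self, flagMem2_zero, inf_bot_eq]

theorem oppUpTo_top (hm : 1 ≤ m) : OppUpTo (2 * m - 1) c d ↔ Opp2 c d := by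
  constructor
  · intro h i
    rw [flagMem2_eq, flagMem2_eq, inf_comm, Fin.val_rev]
    have h1 := h.2 (2 * m + 1 - (i + 1)) (by omega)
    rwa [show 2 * m - 1 + 1 - (2 * m + 1 - (i + 1)) = (i : ℕ) by omega] at h1
  · intro h
    refine ⟨fun i hi => by rw [flagMem2_of_le _ (by omega), flagMem2_of_le _ (by omega)], ?_⟩
    intro i hi
    have h1 := h ⟨2 * m - i, by omega⟩
    rw [flagMem2_eq, flagMem2_eq, inf_comm, Fin.val_rev, Fin.val_mk] at h1
    rwa [show 2 * m + 1 - (2 * m - i + 1) = i by omega,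
      show 2 * m - i = 2 * m - 1 + 1 - i by omega] at h1

/-- The relations interpolating between `OppUpTo k` and `OppUpTo (k + 1)`. -/
def OppStep (k j : ℕ) (c d : MaxFlag2 F m) : Prop :=
  (∀ i, k + 2 ≤ i → flagMem2 d i = flagMem2 c i) ∧
  (∀ i, j + 1 ≤ i → i ≤ k + 2 → flagMem2 d i ⊓ flagMem2 c (k + 2 - i) = ⊥) ∧
  flagMem2 d j ≤ flagMem2 c (k + 1) ∧
  ∀ i, i ≤ j → flagMem2 d i ⊓ flagMem2 c (k + 1 - i) = ⊥

theorem oppStep_self_succ {k : ℕ} (hk : k + 1 ≤ 2 * m) : OppStep k (k + 1) c d ↔ OppUpTo k c d := by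
  constructor
  · rintro ⟨h1, -, h3, h4⟩
    refine ⟨fun i hi => ?_, h4⟩
    rcases hi.eq_or_lt with rfl | hi
    · exact Submodule.eq_of_le_of_finrank_eq h3
        (by rw [finrank_flagMem2 _ hk, finrank_flagMem2 _ hk])
    · exact h1 i hi
  · rintro ⟨h1, h2⟩
    refine ⟨fun i hi => h1 i (by omega), fun i hi hi' => ?_, (h1 _ le_rfl).le, h2⟩
    rw [show k + 2 - i = 0 by omega, flagMem2_zero, inf_bot_eq]

theorem oppStep_zero {k : ℕ} : OppStep k 0 c d ↔ OppUpTo (k + 1) c d := by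
  constructor
  · rintro ⟨h1, h2, -, -⟩
    refine ⟨h1, fun i hi => ?_⟩
    rcases Nat.eq_zero_or_pos i with rfl | hi0
    · rw [flagMem2_zero, bot_inf_eq]
    · exact h2 i hi0 hi
  · rintro ⟨h1, h2⟩
    refine ⟨h1, fun i _ hi => h2 i hi, by rw [flagMem2_zero]; exact bot_le, fun i hi => ?_⟩
    rw [Nat.le_zero.1 hi, flagMem2_zero, bot_inf_eq]

theorem OppStep.not_le {k j i : ℕ} (hk : k + 2 ≤ 2 * m) (h : OppStep k j c d) (hi : j + 1 ≤ i)
    (hik : i ≤ k + 2) : ¬ flagMem2 d i ≤ flagMem2 c (k + 1) := by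
  refine not_le_of_inf_eq_bot (flagMem2_mono c (by omega)) (h.2.1 i hi hik) ?_
  rw [finrank_flagMem2 _ (by omega), finrank_flagMem2 _ (by omega), finrank_flagMem2 _ (by omega)]
  omega

theorem OppStep.finrank_inf {k j : ℕ} (hk : k + 2 ≤ 2 * m) (hj : j ≤ k) (h : OppStep k j c d) :
    Module.finrank F
      (flagMem2 d (j + 2) ⊓ flagMem2 c (k + 1) : Submodule F (Fin (2 * m) → F)) = j + 1 := by
  have h1 := finrank_inf_of_hyperplane (C := flagMem2 c (k + 2))
    (h.1 (k + 2) le_rfl ▸ flagMem2_mono d (by omega : j + 2 ≤ k + 2))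
    (flagMem2_mono c (by omega : k + 1 ≤ k + 2)) (h.not_le hk (by omega : j + 1 ≤ j + 2) (by omega))
    (by rw [finrank_flagMem2 _ (by omega), finrank_flagMem2 _ (by omega)])
  rw [finrank_flagMem2 _ (by omega)] at h1
  omega

theorem OppStep.panelAdj {k j : ℕ} (hk : k + 2 ≤ 2 * m) (hj : j ≤ k) (h : OppStep k (j + 1) c d)
    (hde : PanelAdj j d e) : OppStep k j c e := by
  have hj0 := hde.1 j (by omega)
  have hj2 := hde.1 (j + 2) (by omega)
  have hnle : ¬ flagMem2 e (j + 1) ≤ flagMem2 c (k + 1) := by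
    intro hle
    refine h.not_le hk (i := j + 2) le_rfl (by omega) ?_
    have h1 : ¬ flagMem2 d (j + 1) ≤ flagMem2 e (j + 1) := fun h' =>
      hde.2 (Submodule.eq_of_le_of_finrank_eq h'
        (by rw [finrank_flagMem2 _ (by omega), finrank_flagMem2 _ (by omega)]))
    have h2 := finrank_sup_of_inter (C := flagMem2 d j) (flagMem2_mono d (by omega : j ≤ j + 1))
      (hj0 ▸ flagMem2_mono e (by omega : j ≤ j + 1)) h1
      (by rw [finrank_flagMem2 _ (by omega), finrank_flagMem2 _ (by omega)])
    have h3 : flagMem2 d (j + 1) ⊔ flagMem2 e (j + 1) ≤ flagMem2 d (j + 2) :=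
      sup_le (flagMem2_mono d (by omega)) (hj2 ▸ flagMem2_mono e (by omega : j + 1 ≤ j + 2))
    rw [← Submodule.eq_of_le_of_finrank_eq h3 (by
      rw [h2, finrank_flagMem2 _ (by omega), finrank_flagMem2 _ (by omega)])]
    exact sup_le h.2.2.1 hle
  have hle : flagMem2 d j ≤ flagMem2 c (k + 1) := (flagMem2_mono d (by omega)).trans h.2.2.1
  refine ⟨fun i hi => ?_, fun i hi hik => ?_, hj0 ▸ hle, fun i hi => ?_⟩
  · rw [← hde.1 i (by omega), h.1 i hi]
  · rcases hi.eq_or_lt with rfl | hi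
    · have h1 : flagMem2 e (j + 1) ⊓ flagMem2 c (k + 1) = flagMem2 d j := by
        symm
        refine Submodule.eq_of_le_of_finrank_le
          (le_inf (hj0 ▸ flagMem2_mono e (by omega)) hle) ?_
        have h2 : Module.finrank F (flagMem2 e (j + 1) ⊓ flagMem2 c (k + 1) :
            Submodule F (Fin (2 * m) → F)) < Module.finrank F (flagMem2 e (j + 1)) :=
          Submodule.finrank_lt_finrank_of_lt (lt_of_le_of_ne inf_le_left fun h' =>
            hnle (h' ▸ inf_le_right))
        rw [finrank_flagMem2 _ (by omega)] at h2 ⊢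
        omega
      rw [eq_bot_iff, ← h.2.2.2 j (by omega), show k + 2 - (j + 1) = k + 1 - j by omega, ← h1,
        inf_assoc, inf_eq_right.2 (flagMem2_mono c (by omega : k + 1 - j ≤ k + 1))]
    · rw [← hde.1 i (by omega)]
      exact h.2.1 i hi hik
  · rw [← hde.1 i (by omega)]
    exact h.2.2.2 i (by omega)

theorem OppStep.eq_inf {k j : ℕ} (hk : k + 2 ≤ 2 * m) (hj : j ≤ k) (h : OppStep k (j + 1) c d)
    (hde : PanelAdj j d e) : flagMem2 d (j + 1) = flagMem2 e (j + 2) ⊓ flagMem2 c (k + 1) := by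
  refine Submodule.eq_of_le_of_finrank_eq (le_inf ?_ h.2.2.1) ?_
  · exact hde.1 (j + 2) (by omega) ▸ flagMem2_mono d (by omega : j + 1 ≤ j + 2)
  · rw [(h.panelAdj hk hj hde).finrank_inf hk hj, finrank_flagMem2 _ (by omega)]

theorem OppStep.exists_panelAdj {k j : ℕ} (hk : k + 2 ≤ 2 * m) (hj : j ≤ k) (h : OppStep k j c e) :
    ∃ d, OppStep k (j + 1) c d ∧ PanelAdj j d e := by
  obtain ⟨d, hd, hed⟩ := exists_samePanel e (by omega : j + 2 ≤ 2 * m)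
    (le_inf (flagMem2_mono e (by omega)) h.2.2.1) inf_le_left (h.finrank_inf hk hj)
  refine ⟨d, ⟨fun i hi => ?_, fun i hi hik => ?_, hd ▸ inf_le_right, fun i hi => ?_⟩, hed.symm, ?_⟩
  · rw [← hed i (by omega), h.1 i hi]
  · rw [← hed i (by omega)]
    exact h.2.1 i (by omega) hik
  · rcases hi.eq_or_lt with rfl | hi
    · rw [eq_bot_iff, ← h.2.1 (j + 2) (by omega) (by omega), hd,
        show k + 1 - (j + 1) = k + 2 - (j + 2) by omega]
      exact inf_le_inf_right _ inf_le_left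
    · rw [← hed i (by omega)]
      exact h.2.2.2 i (by omega)
  · intro h'
    exact h.not_le hk le_rfl (by omega) (h' ▸ hd ▸ inf_le_right)

/-- The adjacency matrix of the relation of differing exactly in dimension `k + 1`. -/
noncomputable def panelMatrix (F : Type) [Field F] (m : ℕ) (K : Type*) [Zero K] [One K] (k : ℕ) :
    Matrix (MaxFlag2 F m) (MaxFlag2 F m) K :=
  relMatrix K (PanelAdj k)

theorem panelMatrix_transpose {K : Type*} [Zero K] [One K] (k : ℕ) :
    (panelMatrix F m K k)ᵀ = panelMatrix F m K k :=
  relMatrix_transpose_of_symm fun _ _ => PanelAdj.symm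

variable [Fintype F] {K : Type*} [Semiring K]

theorem oppStep_mul_panelMatrix {k j : ℕ} (hk : k + 2 ≤ 2 * m) (hj : j ≤ k) :
    relMatrix K (OppStep (F := F) (m := m) k (j + 1)) * panelMatrix F m K j =
      relMatrix K (OppStep k j) := by
  refine relMatrix_mul (fun c d e h hde => h.panelAdj hk hj hde)
    (fun c e h => h.exists_panelAdj hk hj) fun c d d' e h hde h' hde' => ?_
  exact (hde.1.trans hde'.1.symm).eq_of_eq ((h.eq_inf hk hj hde).trans (h'.eq_inf hk hj hde').symm)

open Classical in
theorem oppStep_mul_descWord {k j : ℕ} (hk : k + 2 ≤ 2 * m) (hj : j ≤ k + 1) :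
    relMatrix K (OppStep (F := F) (m := m) k j) * descWord (panelMatrix F m K) j =
      relMatrix K (OppUpTo (k + 1)) := by
  induction j with
  | zero =>
    rw [descWord, mul_one]
    congr 1
    funext c d
    exact propext oppStep_zero
  | succ j ih =>
    rw [descWord, ← mul_assoc, oppStep_mul_panelMatrix hk (by omega), ih (by omega)]

open Classical in
theorem longWord_panelMatrix {k : ℕ} (hk : k + 1 ≤ 2 * m) :
    longWord (panelMatrix F m K) k = relMatrix K (OppUpTo k) := by
  induction k with
  | zero =>
    ext c d
    rw [longWord, relMatrix_apply, Matrix.one_apply]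
    simp only [oppUpTo_zero]
  | succ k ih =>
    rw [longWord, ih (by omega), ← oppStep_mul_descWord hk le_rfl]
    congr 2
    funext c d
    exact propext (oppStep_self_succ (by omega)).symm

open Classical in
theorem descWord_transpose {α K : Type*} [Fintype α] [CommSemiring K] {T : ℕ → Matrix α α K}
    (hT : ∀ k, (T k)ᵀ = T k) (k : ℕ) : (descWord T k)ᵀ = ascWord T k := by
  induction k with
  | zero => simp [descWord, ascWord]
  | succ k ih => rw [descWord, ascWord, Matrix.transpose_mul, ih, hT]

open Classical in
theorem longWord_panelMatrix_succ {K : Type*} [CommSemiring K] {k : ℕ} (hk : k + 2 ≤ 2 * m) :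
    longWord (panelMatrix F m K) (k + 1) =
      ascWord (panelMatrix F m K) (k + 1) * longWord (panelMatrix F m K) k := by
  have hsymm : ∀ k, k + 1 ≤ 2 * m → (longWord (panelMatrix F m K) k)ᵀ =
      longWord (panelMatrix F m K) k := by
    intro k hk
    rw [longWord_panelMatrix hk]
    exact relMatrix_transpose_of_symm fun _ _ => OppUpTo.symm
  rw [← hsymm _ hk, longWord, Matrix.transpose_mul, hsymm _ (by omega),
    descWord_transpose panelMatrix_transpose]

end Opposition

section Panels

variable {F : Type} [Field F] {m : ℕ} {c d e : MaxFlag2 F m}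

theorem flagMem2_eq_of_le {k : ℕ} (hk : k ≤ 2 * m) (h : flagMem2 c k ≤ flagMem2 d k) :
    flagMem2 c k = flagMem2 d k :=
  Submodule.eq_of_le_of_finrank_eq h (by rw [finrank_flagMem2 _ hk, finrank_flagMem2 _ hk])

theorem panelMatrix_mul_of_lt [Fintype F] {K : Type*} [Semiring K] {i j : ℕ} (hij : i + 2 ≤ j)
    (hj : j + 2 ≤ 2 * m) :
    panelMatrix F m K i * panelMatrix F m K j = relMatrix K fun c d =>
      (∀ k, k ≠ i + 1 → k ≠ j + 1 → flagMem2 c k = flagMem2 d k) ∧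
        flagMem2 c (i + 1) ≠ flagMem2 d (i + 1) ∧ flagMem2 c (j + 1) ≠ flagMem2 d (j + 1) := by
  refine relMatrix_mul ?_ ?_ ?_
  · intro c d e hcd hde
    refine ⟨fun k hki hkj => (hcd.1 k hki).trans (hde.1 k hkj), ?_, ?_⟩
    · rw [← hde.1 (i + 1) (by omega)]
      exact hcd.2
    · rw [hcd.1 (j + 1) (by omega)]
      exact hde.2
  · intro c e h
    obtain ⟨d, hd, hcd⟩ := exists_samePanel c (W := flagMem2 e (i + 1)) (by omega : i + 2 ≤ 2 * m)
      (h.1 i (by omega) (by omega) ▸ flagMem2_mono e (by omega))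
      (h.1 (i + 2) (by omega) (by omega) ▸ flagMem2_mono e (by omega))
      (finrank_flagMem2 _ (by omega))
    refine ⟨d, ⟨hcd, hd ▸ h.2.1⟩, fun k hk => ?_, hcd (j + 1) (by omega) ▸ h.2.2⟩
    rcases eq_or_ne k (i + 1) with rfl | hki
    · exact hd
    · rw [← hcd k hki, h.1 k hki hk]
  · intro c d d' e hcd hde hcd' hde'
    refine (hcd.1.symm.trans hcd'.1).eq_of_eq ?_
    rw [hde.1 _ (by omega), hde'.1 _ (by omega)]

theorem panelMatrix_comm [Fintype F] {K : Type*} [CommSemiring K] {i j : ℕ} (hij : i + 2 ≤ j)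
    (hj : j + 2 ≤ 2 * m) :
    panelMatrix F m K i * panelMatrix F m K j = panelMatrix F m K j * panelMatrix F m K i := by
  have h := congrArg Matrix.transpose (panelMatrix_mul_of_lt (F := F) (K := K) hij hj)
  rw [Matrix.transpose_mul, panelMatrix_transpose, panelMatrix_transpose,
    relMatrix_transpose_of_symm] at h
  · rw [h, panelMatrix_mul_of_lt hij hj]
  · exact fun c d h => ⟨fun k hki hkj => (h.1 k hki hkj).symm, h.2.1.symm, h.2.2.symm⟩

theorem panelMatrix_mul_succ [Fintype F] {K : Type*} [Semiring K] {i : ℕ} (hi : i + 3 ≤ 2 * m) :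
    panelMatrix F m K i * panelMatrix F m K (i + 1) = relMatrix K fun c d =>
      (∀ k, k ≠ i + 1 → k ≠ i + 2 → flagMem2 c k = flagMem2 d k) ∧
        flagMem2 c (i + 1) ≠ flagMem2 d (i + 1) ∧ flagMem2 c (i + 2) ≠ flagMem2 d (i + 2) ∧
        flagMem2 d (i + 1) ≤ flagMem2 c (i + 2) := by
  refine relMatrix_mul ?_ ?_ ?_
  · intro c d e hcd hde
    refine ⟨fun k hki hkj => (hcd.1 k hki).trans (hde.1 k hkj), ?_, ?_, ?_⟩
    · rw [← hde.1 (i + 1) (by omega)]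
      exact hcd.2
    · rw [hcd.1 (i + 2) (by omega)]
      exact hde.2
    · rw [← hde.1 (i + 1) (by omega), hcd.1 (i + 2) (by omega)]
      exact flagMem2_mono d (by omega)
  · intro c e h
    obtain ⟨d, hd, hcd⟩ := exists_samePanel c (W := flagMem2 e (i + 1)) (by omega : i + 2 ≤ 2 * m)
      (h.1 i (by omega) (by omega) ▸ flagMem2_mono e (by omega)) h.2.2.2
      (finrank_flagMem2 _ (by omega))
    refine ⟨d, ⟨hcd, hd ▸ h.2.1⟩, fun k hk => ?_, hcd (i + 2) (by omega) ▸ h.2.2.1⟩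
    rcases eq_or_ne k (i + 1) with rfl | hki
    · exact hd
    · rw [← hcd k hki, h.1 k hki hk]
  · intro c d d' e hcd hde hcd' hde'
    refine (hcd.1.symm.trans hcd'.1).eq_of_eq ?_
    rw [hde.1 _ (by omega), hde'.1 _ (by omega)]

theorem panelMatrix_succ_mul [Fintype F] {K : Type*} [CommSemiring K] {i : ℕ}
    (hi : i + 3 ≤ 2 * m) :
    panelMatrix F m K (i + 1) * panelMatrix F m K i = relMatrix K fun c d =>
      (∀ k, k ≠ i + 1 → k ≠ i + 2 → flagMem2 c k = flagMem2 d k) ∧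
        flagMem2 c (i + 1) ≠ flagMem2 d (i + 1) ∧ flagMem2 c (i + 2) ≠ flagMem2 d (i + 2) ∧
        flagMem2 c (i + 1) ≤ flagMem2 d (i + 2) := by
  rw [← panelMatrix_transpose (i + 1), ← panelMatrix_transpose i, ← Matrix.transpose_mul,
    panelMatrix_mul_succ hi, relMatrix_transpose]
  congr 1
  funext c d
  refine propext ⟨fun h => ⟨fun k hki hkj => (h.1 k hki hkj).symm, h.2.1.symm, h.2.2.1.symm,
    h.2.2.2⟩, fun h => ⟨fun k hki hkj => (h.1 k hki hkj).symm, h.2.1.symm, h.2.2.1.symm, h.2.2.2⟩⟩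

/-- Flags in a common residue of rank two that are opposite there. -/
def ResidueOpp (i : ℕ) (c d : MaxFlag2 F m) : Prop :=
  (∀ k, k ≠ i + 1 → k ≠ i + 2 → flagMem2 c k = flagMem2 d k) ∧
    ¬ flagMem2 d (i + 1) ≤ flagMem2 c (i + 2) ∧ ¬ flagMem2 c (i + 1) ≤ flagMem2 d (i + 2)

theorem panelMatrix_mul_succ_mul [Fintype F] {K : Type*} [Semiring K] {i : ℕ}
    (hi : i + 3 ≤ 2 * m) :
    panelMatrix F m K i * panelMatrix F m K (i + 1) * panelMatrix F m K i =
      relMatrix K (ResidueOpp i) := by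
  have hinf : ∀ c e : MaxFlag2 F m, flagMem2 c (i + 2) ≠ flagMem2 e (i + 2) →
      flagMem2 c (i + 3) = flagMem2 e (i + 3) → Module.finrank F
        (flagMem2 c (i + 2) ⊓ flagMem2 e (i + 2) : Submodule F (Fin (2 * m) → F)) = i + 1 := by
    intro c e h h'
    have := finrank_inf_of_hyperplane (flagMem2_mono c (by omega : i + 2 ≤ i + 3))
      (h' ▸ flagMem2_mono e (by omega : i + 2 ≤ i + 3))
      (fun hle => h (flagMem2_eq_of_le (by omega) hle))
      (by rw [finrank_flagMem2 _ (by omega), finrank_flagMem2 _ (by omega)])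
    rw [finrank_flagMem2 _ (by omega)] at this
    omega
  have hmid : ∀ c d e : MaxFlag2 F m, flagMem2 c (i + 2) ≠ flagMem2 d (i + 2) →
      flagMem2 c (i + 3) = flagMem2 d (i + 3) → flagMem2 d (i + 1) ≤ flagMem2 c (i + 2) →
      PanelAdj i d e → flagMem2 d (i + 1) = flagMem2 c (i + 2) ⊓ flagMem2 e (i + 2) := by
    intro c d e h h' hle hde
    rw [← hde.1 (i + 2) (by omega)]
    refine Submodule.eq_of_le_of_finrank_eq (le_inf hle (flagMem2_mono d (by omega))) ?_
    rw [hinf c d h h', finrank_flagMem2 _ (by omega)]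
  rw [panelMatrix_mul_succ hi]
  refine relMatrix_mul ?_ ?_ ?_
  · intro c d e hcd hde
    have h1 := hmid c d e hcd.2.2.1 (hcd.1 _ (by omega) (by omega)) hcd.2.2.2 hde
    refine ⟨fun k hki hkj => (hcd.1 k hki hkj).trans (hde.1 k hki), fun h => hde.2 ?_,
      fun h => hcd.2.1 ?_⟩
    · exact (flagMem2_eq_of_le (by omega)
        (h1.symm ▸ le_inf h (flagMem2_mono e (by omega)))).symm
    · exact flagMem2_eq_of_le (by omega)
        (h1.symm ▸ le_inf (flagMem2_mono c (by omega)) h)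
  · intro c e h
    have hne : flagMem2 c (i + 2) ≠ flagMem2 e (i + 2) := fun h' =>
      h.2.2 (h' ▸ flagMem2_mono c (by omega))
    obtain ⟨d, hd, hed⟩ := exists_samePanel e
      (W := flagMem2 c (i + 2) ⊓ flagMem2 e (i + 2)) (by omega : i + 2 ≤ 2 * m)
      (le_inf (h.1 i (by omega) (by omega) ▸ flagMem2_mono c (by omega))
        (flagMem2_mono e (by omega))) inf_le_right
      (hinf c e hne (h.1 _ (by omega) (by omega)))
    refine ⟨d, ⟨fun k hki hkj => (h.1 k hki hkj).trans (hed k hki), fun h' => h.2.2 ?_, ?_,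
      hd ▸ inf_le_left⟩, hed.symm, fun h' => h.2.1 ?_⟩
    · rw [h', hd]
      exact inf_le_right
    · rwa [← hed _ (by omega)]
    · rw [← h', hd]
      exact inf_le_left
  · intro c d d' e hcd hde hcd' hde'
    refine (hde.1.trans hde'.1.symm).eq_of_eq ?_
    rw [hmid c d e hcd.2.2.1 (hcd.1 _ (by omega) (by omega)) hcd.2.2.2 hde,
      hmid c d' e hcd'.2.2.1 (hcd'.1 _ (by omega) (by omega)) hcd'.2.2.2 hde']

theorem panelMatrix_succ_mul_mul [Fintype F] {K : Type*} [CommSemiring K] {i : ℕ}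
    (hi : i + 3 ≤ 2 * m) :
    panelMatrix F m K (i + 1) * panelMatrix F m K i * panelMatrix F m K (i + 1) =
      relMatrix K (ResidueOpp i) := by
  have hsup : ∀ c e : MaxFlag2 F m, flagMem2 c (i + 1) ≠ flagMem2 e (i + 1) →
      flagMem2 c i = flagMem2 e i → Module.finrank F
        (flagMem2 c (i + 1) ⊔ flagMem2 e (i + 1) : Submodule F (Fin (2 * m) → F)) = i + 2 := by
    intro c e h h'
    have := finrank_sup_of_inter (flagMem2_mono c (by omega : i ≤ i + 1))
      (h'.symm ▸ flagMem2_mono e (by omega : i ≤ i + 1))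
      (fun hle => h (flagMem2_eq_of_le (by omega) hle))
      (by rw [finrank_flagMem2 _ (by omega), finrank_flagMem2 _ (by omega)])
    rw [this, finrank_flagMem2 _ (by omega)]
  have hmid : ∀ c d e : MaxFlag2 F m, flagMem2 c (i + 1) ≠ flagMem2 d (i + 1) →
      flagMem2 c i = flagMem2 d i → flagMem2 c (i + 1) ≤ flagMem2 d (i + 2) →
      PanelAdj (i + 1) d e → flagMem2 d (i + 2) = flagMem2 c (i + 1) ⊔ flagMem2 e (i + 1) := by
    intro c d e h h' hle hde
    rw [← hde.1 (i + 1) (by omega)]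
    refine (Submodule.eq_of_le_of_finrank_eq (sup_le hle (flagMem2_mono d (by omega))) ?_).symm
    rw [hsup c d h h', finrank_flagMem2 _ (by omega)]
  rw [panelMatrix_succ_mul hi]
  refine relMatrix_mul ?_ ?_ ?_
  · intro c d e hcd hde
    have h1 := hmid c d e hcd.2.1 (hcd.1 _ (by omega) (by omega)) hcd.2.2.2 hde
    refine ⟨fun k hki hkj => (hcd.1 k hki hkj).trans (hde.1 k hkj), fun h => hcd.2.2.1 ?_,
      fun h => hde.2 ?_⟩
    · exact (flagMem2_eq_of_le (by omega)
        (h1 ▸ sup_le (flagMem2_mono c (by omega)) h)).symm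
    · exact flagMem2_eq_of_le (by omega)
        (h1 ▸ sup_le h (flagMem2_mono e (by omega)))
  · intro c e h
    have hne : flagMem2 c (i + 1) ≠ flagMem2 e (i + 1) := fun h' =>
      h.2.2 (h' ▸ flagMem2_mono e (by omega))
    obtain ⟨d, hd, hed⟩ := exists_samePanel e (k := i + 1)
      (W := flagMem2 c (i + 1) ⊔ flagMem2 e (i + 1)) (by omega) le_sup_right
      (sup_le (h.1 (i + 3) (by omega) (by omega) ▸ flagMem2_mono c (by omega))
        (flagMem2_mono e (by omega))) (hsup c e hne (h.1 _ (by omega) (by omega)))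
    refine ⟨d, ⟨fun k hki hkj => (h.1 k hki hkj).trans (hed k hkj), ?_, fun h' => h.2.1 ?_,
      hd ▸ le_sup_left⟩, hed.symm, fun h' => h.2.2 ?_⟩
    · rwa [← hed _ (by omega)]
    · rw [h', hd]
      exact le_sup_right
    · rw [← h', hd]
      exact le_sup_left
  · intro c d d' e hcd hde hcd' hde'
    refine (hde.1.trans hde'.1.symm).eq_of_eq ?_
    rw [hmid c d e hcd.2.1 (hcd.1 _ (by omega) (by omega)) hcd.2.2.2 hde,
      hmid c d' e hcd'.2.1 (hcd'.1 _ (by omega) (by omega)) hcd'.2.2.2 hde']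

end Panels

section Counting

variable {F V : Type*} [Field F] [Fintype F] [AddCommGroup V] [Module F V] [FiniteDimensional F V]

/-- The number of subspaces one dimension above `A` inside `B`. -/
theorem card_covering_mul {A B : Submodule F V} (hAB : A ≤ B) {a b : ℕ}
    (ha : Module.finrank F A = a) (hb : Module.finrank F B = b) :
    (Nat.card {W : Submodule F V // A ≤ W ∧ W ≤ B ∧ Module.finrank F W = a + 1} : ℤ) *
      ((Fintype.card F : ℤ) ^ (a + 1) - (Fintype.card F : ℤ) ^ a) =
        (Fintype.card F : ℤ) ^ b - (Fintype.card F : ℤ) ^ a := by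
  classical
  have : Finite V := Module.finite_of_finite F
  have : Fintype V := Fintype.ofFinite V
  have hsub : ∀ A B : Submodule F V, A ≤ B →
      ((Finset.univ.filter fun v => v ∈ B ∧ v ∉ A).card : ℤ) =
        (Fintype.card F : ℤ) ^ Module.finrank F B - (Fintype.card F : ℤ) ^ Module.finrank F A := by
    intro A B h
    have h1 : ∀ C : Submodule F V, ((Finset.univ.filter fun v => v ∈ C).card : ℤ) =
        (Fintype.card F : ℤ) ^ Module.finrank F C := by
      intro C
      rw [← Fintype.card_subtype, ← Nat.cast_pow, ← Module.card_eq_pow_finrank (K := F) (V := C)]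
    rw [← h1, ← h1, eq_sub_iff_add_eq, ← Nat.cast_add, ← Finset.card_union_of_disjoint]
    · congr 2
      ext v
      simp only [Finset.mem_union, Finset.mem_filter, Finset.mem_univ, true_and]
      have := @h v
      tauto
    · rw [Finset.disjoint_filter]
      tauto
  have : Fintype {W : Submodule F V // A ≤ W ∧ W ≤ B ∧ Module.finrank F W = a + 1} :=
    Fintype.ofFinite _
  have key : (Finset.univ.filter fun v => v ∈ B ∧ v ∉ A) =
      Finset.univ.biUnion
        fun W : {W : Submodule F V // A ≤ W ∧ W ≤ B ∧ Module.finrank F W = a + 1} =>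
          Finset.univ.filter fun v => v ∈ W.1 ∧ v ∉ A := by
    ext v
    simp only [Finset.mem_filter, Finset.mem_univ, true_and, Finset.mem_biUnion]
    constructor
    · rintro ⟨hvB, hvA⟩
      refine ⟨⟨A ⊔ F ∙ v, le_sup_left, sup_le hAB (by simpa using hvB), ?_⟩,
        Submodule.mem_sup_right (Submodule.mem_span_singleton_self v), hvA⟩
      have h1 := Submodule.finrank_sup_add_finrank_inf_eq A (F ∙ v)
      have h0 : v ≠ 0 := fun h => hvA (h ▸ A.zero_mem)
      rw [finrank_span_singleton h0, (Submodule.disjoint_span_singleton' h0).2 hvA |>.eq_bot,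
        finrank_bot] at h1
      omega
    · rintro ⟨W, hW, hvA⟩
      exact ⟨W.2.2.1 hW, hvA⟩
  have h2 := hsub A B hAB
  rw [key, Finset.card_biUnion, Nat.cast_sum, Finset.sum_congr rfl fun W _ => hsub A W.1 W.2.1,
    Finset.sum_congr rfl fun W _ => by rw [W.2.2.2, ha]] at h2
  · rw [Finset.sum_const, Finset.card_univ, nsmul_eq_mul, ha, hb] at h2
    rw [Nat.card_eq_fintype_card]
    exact h2
  · intro W _ W' _ hne
    rw [Function.onFun, Finset.disjoint_filter]
    rintro v - ⟨hv, hvA⟩ ⟨hv', -⟩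
    have hcov : ∀ W W' : Submodule F V, A ≤ W → A ≤ W' → Module.finrank F W = a + 1 → v ∈ W →
        v ∈ W' → W ≤ W' := by
      intro W W' hW hW' hfin hv hv'
      have hlt : Module.finrank F A < Module.finrank F (W ⊓ W' : Submodule F V) :=
        Submodule.finrank_lt_finrank_of_lt
          (lt_of_le_of_ne (le_inf hW hW') fun h => hvA (h ▸ ⟨hv, hv'⟩))
      rw [← Submodule.eq_of_le_of_finrank_le (inf_le_left : W ⊓ W' ≤ W) (by omega)]
      exact inf_le_right
    exact hne (Subtype.ext (le_antisymm (hcov _ _ W.2.1 W'.2.1 W.2.2.2 hv hv')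
      (hcov _ _ W'.2.1 W.2.1 W'.2.2.2 hv' hv)))

theorem card_pencil {A B : Submodule F V} (hAB : A ≤ B) {a : ℕ}
    (ha : Module.finrank F A = a) (hb : Module.finrank F B = a + 2) :
    Nat.card {W : Submodule F V // A ≤ W ∧ W ≤ B ∧ Module.finrank F W = a + 1} =
      Fintype.card F + 1 := by
  have h := card_covering_mul hAB ha hb
  have hq : (1 : ℤ) < Fintype.card F := by exact_mod_cast Fintype.one_lt_card
  have h1 : ((Fintype.card F : ℤ) ^ (a + 1) - (Fintype.card F : ℤ) ^ a) ≠ 0 := by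
    rw [pow_succ, ← mul_sub_one]
    exact mul_ne_zero (by positivity) (by omega)
  have h2 := mul_right_cancel₀ h1 (h.trans (b := _) (c := ((Fintype.card F + 1 : ℕ) : ℤ) * _)
    (by push_cast; ring))
  exact_mod_cast h2

end Counting

section Incidence

open Classical in
theorem relMatrix_samePanel {F : Type} [Field F] {m : ℕ} {K : Type*} [Semiring K] (k : ℕ) :
    relMatrix K (SamePanel (F := F) (m := m) k) = panelMatrix F m K k + 1 := by
  ext c d
  rw [Matrix.add_apply, panelMatrix, relMatrix_apply, relMatrix_apply, Matrix.one_apply]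
  by_cases h : c = d
  · subst h
    simp [SamePanel.refl, PanelAdj]
  · by_cases h1 : SamePanel k c d
    · have h2 : flagMem2 c (k + 1) ≠ flagMem2 d (k + 1) := fun h' => h (h1.eq_of_eq h')
      simp [h, h1, h2, PanelAdj]
    · simp [h, h1, PanelAdj]

variable {F : Type} [Field F] [Fintype F] {m : ℕ} {c d e : MaxFlag2 F m}

/-- The panel of a flag corresponds to the pencil of subspaces between its neighbours. -/
noncomputable def panelEquiv (c : MaxFlag2 F m) {k : ℕ} (hk : k + 2 ≤ 2 * m) :
    {d : MaxFlag2 F m // SamePanel k c d} ≃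
      {W : Submodule F (Fin (2 * m) → F) //
        flagMem2 c k ≤ W ∧ W ≤ flagMem2 c (k + 2) ∧ Module.finrank F W = k + 1} :=
  Equiv.ofBijective
    (fun d => ⟨flagMem2 d.1 (k + 1), d.2 k (by omega) ▸ flagMem2_mono d.1 (by omega),
      d.2 (k + 2) (by omega) ▸ flagMem2_mono d.1 (by omega), finrank_flagMem2 _ (by omega)⟩) <| by
    constructor
    · intro d d' h
      exact Subtype.ext ((d.2.symm.trans d'.2).eq_of_eq (congrArg Subtype.val h))
    · rintro ⟨W, h1, h2, h3⟩
      obtain ⟨d, hd, hcd⟩ := exists_samePanel c hk h1 h2 h3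
      exact ⟨⟨d, hcd⟩, Subtype.ext hd⟩

open Classical in
theorem card_panel (c : MaxFlag2 F m) {k : ℕ} (hk : k + 2 ≤ 2 * m) :
    (Finset.univ.filter fun d => SamePanel k c d).card = Fintype.card F + 1 := by
  rw [← Fintype.card_subtype, ← Nat.card_eq_fintype_card, Nat.card_congr (panelEquiv c hk),
    card_pencil (flagMem2_mono c (by omega)) (finrank_flagMem2 _ (by omega))
      (finrank_flagMem2 _ (by omega))]

variable {K : Type*} [CommRing K]

open Classical in
theorem relMatrix_samePanel_sq {k : ℕ} (hk : k + 2 ≤ 2 * m) :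
    relMatrix K (SamePanel (F := F) (m := m) k) * relMatrix K (SamePanel k) =
      ((Fintype.card F : K) + 1) • relMatrix K (SamePanel k) := by
  ext c d
  rw [relMatrix_mul_apply, Matrix.smul_apply, relMatrix_apply]
  split_ifs with h
  · rw [Finset.filter_congr (q := fun b => SamePanel k c b)
      fun b _ => ⟨fun hb => hb.1, fun hb => ⟨hb, hb.symm.trans h⟩⟩, card_panel c hk]
    simp
  · rw [Finset.filter_eq_empty_iff.2 fun b _ hb => h (hb.1.trans hb.2)]
    simp

open Classical in
theorem panelMatrix_sq {k : ℕ} (hk : k + 2 ≤ 2 * m) :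
    panelMatrix F m K k * panelMatrix F m K k =
      ((Fintype.card F : K) - 1) • panelMatrix F m K k + (Fintype.card F : K) • 1 := by
  have h := relMatrix_samePanel_sq (F := F) (K := K) hk
  rw [relMatrix_samePanel, mul_add, add_mul, mul_one, one_mul] at h
  have h1 : panelMatrix F m K k * panelMatrix F m K k =
      ((Fintype.card F : K) + 1) • (panelMatrix F m K k + 1) - panelMatrix F m K k -
        (panelMatrix F m K k + 1) := by
    rw [← h]
    abel
  rw [h1]
  module

open Classical in
theorem heckeRel_panelMatrix :
    HeckeRel (Fintype.card F : K) (2 * m - 1) (panelMatrix F m K) where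
  quad i hi := panelMatrix_sq (by omega)
  braid i hi := by
    rw [panelMatrix_mul_succ_mul (by omega), panelMatrix_succ_mul_mul (by omega)]
  comm i j hij hj := panelMatrix_comm hij (by omega)

/-- The incidence matrix between flags and the points of their `i`-dimensional member. -/
noncomputable def incidenceMatrix (F : Type) [Field F] (m : ℕ) (K : Type*) [Zero K] [One K]
    (i : ℕ) : Matrix (MaxFlag2 F m) (Point2 F m) K :=
  relMatrix K fun c X => X.1 ≤ flagMem2 c i

theorem samePanel_mul_incidenceMatrix_of_ne {k j : ℕ} (hk : k + 2 ≤ 2 * m) (hj : j ≠ k + 1) :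
    relMatrix K (SamePanel (F := F) (m := m) k) * incidenceMatrix F m K j =
      ((Fintype.card F : K) + 1) • incidenceMatrix F m K j := by
  classical
  ext c X
  rw [incidenceMatrix, relMatrix_mul_apply, Matrix.smul_apply, relMatrix_apply]
  split_ifs with h
  · rw [Finset.filter_congr (q := fun b => SamePanel k c b)
      fun b _ => ⟨fun hb => hb.1, fun hb => ⟨hb, hb j hj ▸ h⟩⟩, card_panel c hk]
    simp
  · rw [Finset.filter_false_of_mem]
    · simp
    · exact fun b _ hb => h (hb.1 j hj ▸ hb.2)

theorem samePanel_mul_incidenceMatrix_succ {k : ℕ} (hk : k + 2 ≤ 2 * m) :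
    relMatrix K (SamePanel (F := F) (m := m) k) * incidenceMatrix F m K (k + 1) =
      (Fintype.card F : K) • incidenceMatrix F m K k + incidenceMatrix F m K (k + 2) := by
  classical
  ext c X
  rw [incidenceMatrix, relMatrix_mul_apply, Matrix.add_apply, Matrix.smul_apply, incidenceMatrix,
    incidenceMatrix, relMatrix_apply, relMatrix_apply]
  by_cases h0 : X.1 ≤ flagMem2 c k
  · have h2 : X.1 ≤ flagMem2 c (k + 2) := h0.trans (flagMem2_mono c (by omega))
    rw [if_pos h0, if_pos h2, Finset.filter_congr (q := fun b => SamePanel k c b)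
      fun b _ => ⟨fun hb => hb.1, fun hb => ⟨hb, h0.trans
        (hb k (by omega) ▸ flagMem2_mono b (by omega))⟩⟩, card_panel c hk]
    simp
  · by_cases h2 : X.1 ≤ flagMem2 c (k + 2)
    · have hfin : Module.finrank F
          (X.1 ⊔ flagMem2 c k : Submodule F (Fin (2 * m) → F)) = k + 1 := by
        have := finrank_sup_of_inter (bot_le : ⊥ ≤ X.1) (bot_le : ⊥ ≤ flagMem2 c k) h0
          (by rw [X.2, finrank_bot])
        rw [this, finrank_flagMem2 _ (by omega)]
      obtain ⟨d, hd, hcd⟩ := exists_samePanel c hk le_sup_right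
        (sup_le h2 (flagMem2_mono c (by omega))) hfin
      rw [if_neg h0, if_pos h2, Finset.card_eq_one.2 ⟨d, ?_⟩]
      · simp
      ext b
      simp only [Finset.mem_filter, Finset.mem_univ, true_and, Finset.mem_singleton]
      constructor
      · rintro ⟨hcb, hX⟩
        refine (hcb.symm.trans hcd).eq_of_eq ?_
        rw [hd]
        symm
        refine Submodule.eq_of_le_of_finrank_eq
          (sup_le hX (hcb k (by omega) ▸ flagMem2_mono b (by omega))) ?_
        rw [hfin, finrank_flagMem2 _ (by omega)]
      · rintro rfl
        exact ⟨hcd, hd ▸ le_sup_left⟩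
    · rw [if_neg h0, if_neg h2, Finset.filter_false_of_mem]
      · simp
      · exact fun b _ hb => h2 (hb.2.trans
          (hb.1 (k + 2) (by omega) ▸ flagMem2_mono b (by omega)))

theorem panelMatrix_mul_incidenceMatrix_of_ne {k j : ℕ} (hk : k + 2 ≤ 2 * m) (hj : j ≠ k + 1) :
    panelMatrix F m K k * incidenceMatrix F m K j =
      (Fintype.card F : K) • incidenceMatrix F m K j := by
  classical
  have h := samePanel_mul_incidenceMatrix_of_ne (K := K) (F := F) hk hj
  rw [relMatrix_samePanel, Matrix.add_mul, Matrix.one_mul, add_smul, one_smul] at h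
  exact add_right_cancel h

theorem panelMatrix_mul_incidenceMatrix_succ {k : ℕ} (hk : k + 2 ≤ 2 * m) :
    panelMatrix F m K k * incidenceMatrix F m K (k + 1) =
      (Fintype.card F : K) • incidenceMatrix F m K k + incidenceMatrix F m K (k + 2) -
        incidenceMatrix F m K (k + 1) := by
  classical
  have h := samePanel_mul_incidenceMatrix_succ (K := K) (F := F) hk
  rw [relMatrix_samePanel, Matrix.add_mul, Matrix.one_mul] at h
  exact eq_sub_of_add_eq h

end Incidence

theorem map_descWord {R R' G : Type*} [Monoid R] [Monoid R'] [FunLike G R R']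
    [MonoidHomClass G R R'] (f : G) (T : ℕ → R) (k : ℕ) :
    f (descWord T k) = descWord (fun i => f (T i)) k := by
  induction k with
  | zero => simp [descWord]
  | succ k ih => rw [descWord, descWord, map_mul, ih]

theorem map_ascWord {R R' G : Type*} [Monoid R] [Monoid R'] [FunLike G R R']
    [MonoidHomClass G R R'] (f : G) (T : ℕ → R) (k : ℕ) :
    f (ascWord T k) = ascWord (fun i => f (T i)) k := by
  induction k with
  | zero => simp [ascWord]
  | succ k ih => rw [ascWord, ascWord, map_mul, ih]

theorem map_longWord {R R' G : Type*} [Monoid R] [Monoid R'] [FunLike G R R']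
    [MonoidHomClass G R R'] (f : G) (T : ℕ → R) (k : ℕ) :
    f (longWord T k) = longWord (fun i => f (T i)) k := by
  induction k with
  | zero => simp [longWord]
  | succ k ih => rw [longWord, longWord, map_mul, ih, map_descWord]

theorem HeckeRel.map {K R R' : Type*} [CommRing K] [Ring R] [Algebra K R] [Ring R'] [Algebra K R']
    {q : K} {n : ℕ} {T : ℕ → R} (h : HeckeRel q n T) (f : R ≃ₐ[K] R') :
    HeckeRel q n fun i => f (T i) where
  quad i hi := by rw [← map_mul, h.quad i hi, map_add, map_smul, map_smul, map_one]
  braid i hi := by simp only [← map_mul, h.braid i hi]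
  comm i j hij hj := by rw [← map_mul, ← map_mul, h.comm i j hij hj]

section Connectivity

variable {F : Type} [Field F] {m : ℕ}

/-- A function on flags that is constant on all panels of positive index depends only on the
one-dimensional member. -/
theorem apply_eq_of_agree {α : Type*} {φ : MaxFlag2 F m → α}
    (hφ : ∀ k, 1 ≤ k → k + 2 ≤ 2 * m → ∀ c d, SamePanel k c d → φ c = φ d) {k : ℕ} (hk : 1 ≤ k)
    (hkm : k ≤ 2 * m) : ∀ c d, (∀ i, i ≤ k → flagMem2 c i = flagMem2 d i) → φ c = φ d := by
  induction hkm using Nat.decreasingInduction with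
  | self =>
    intro c d h
    rw [flagMem2_injective fun i _ hi => h i hi.le]
  | of_succ k hkm ih =>
    intro c d h
    have key : ∀ j, k + 1 ≤ j → j ≤ 2 * m → ∀ d, (∀ i, i ≤ k → flagMem2 c i = flagMem2 d i) →
        flagMem2 c (k + 1) ≤ flagMem2 d j → φ c = φ d := by
      intro j hj
      induction j, hj using Nat.le_induction with
      | base =>
        intro _ d hd hle
        refine ih (by omega) c d fun i hi => ?_
        rcases hi.eq_or_lt with rfl | hi
        · exact flagMem2_eq_of_le hkm hle
        · exact hd i (by omega)
      | succ j hj ihj =>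
        intro hjm d hd hle
        by_cases hle' : flagMem2 c (k + 1) ≤ flagMem2 d j
        · exact ihj (by omega) d hd hle'
        obtain ⟨l, rfl⟩ : ∃ l, j = l + 1 := ⟨j - 1, by omega⟩
        have hfin : Module.finrank F
            (flagMem2 c (k + 1) ⊔ flagMem2 d l : Submodule F (Fin (2 * m) → F)) = l + 1 := by
          rw [finrank_sup_of_inter (flagMem2_mono c (by omega : k ≤ k + 1))
            (hd k le_rfl ▸ flagMem2_mono d (by omega : k ≤ l))
            (fun h' => hle' (h'.trans (flagMem2_mono d (by omega))))
            (by rw [finrank_flagMem2 _ (by omega), finrank_flagMem2 _ (by omega)]),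
            finrank_flagMem2 _ (by omega)]
        obtain ⟨e, he, hde⟩ := exists_samePanel d (by omega : l + 2 ≤ 2 * m) le_sup_right
          (sup_le hle (flagMem2_mono d (by omega))) hfin
        rw [hφ l (by omega) (by omega) d e hde]
        exact ihj (by omega) e (fun i hi => (hd i hi).trans (hde i (by omega)))
          (he ▸ le_sup_left)
    exact key (2 * m) hkm le_rfl d h (by rw [flagMem2_of_le d le_rfl]; exact le_top)

theorem eq_zero_of_incidence_one [Fintype F] {φ : MaxFlag2 F m → ℝ} (hm : 1 ≤ m)
    (hφ : ∀ k, 1 ≤ k → k + 2 ≤ 2 * m → ∀ c d, SamePanel k c d → φ c = φ d)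
    (h1 : (incidenceMatrix F m ℝ 1)ᵀ *ᵥ φ = 0) : φ = 0 := by
  classical
  funext c
  let X : Point2 F m := ⟨flagMem2 c 1, finrank_flagMem2 c (by omega)⟩
  have h2 := congrFun h1 X
  have h3 : ∀ d, (incidenceMatrix F m ℝ 1)ᵀ X d * φ d =
      (if flagMem2 c 1 ≤ flagMem2 d 1 then 1 else 0) * φ c := by
    intro d
    rw [Matrix.transpose_apply, incidenceMatrix, relMatrix_apply]
    split_ifs with h
    · rw [apply_eq_of_agree hφ le_rfl (by omega) c d fun i hi => ?_]
      obtain rfl | rfl : i = 0 ∨ i = 1 := by omega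
      · rw [flagMem2_zero, flagMem2_zero]
      · exact flagMem2_eq_of_le (by omega) h
    · simp
  rw [Matrix.mulVec, dotProduct, Finset.sum_congr rfl fun d _ => h3 d, ← Finset.sum_mul,
    Pi.zero_apply] at h2
  refine (mul_eq_zero.1 h2).resolve_left (ne_of_gt ?_)
  exact Finset.sum_pos' (fun d _ => by split_ifs <;> simp)
    ⟨c, Finset.mem_univ _, by rw [if_pos le_rfl]; exact one_pos⟩

theorem apply_eq_of_panelMatrix_mulVec [Fintype F] {φ : MaxFlag2 F m → ℝ} {k : ℕ}
    (h : panelMatrix F m ℝ k *ᵥ φ = (Fintype.card F : ℝ) • φ) {c d : MaxFlag2 F m}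
    (hcd : SamePanel k c d) : φ c = φ d := by
  classical
  have h1 : relMatrix ℝ (SamePanel k) *ᵥ φ = ((Fintype.card F : ℝ) + 1) • φ := by
    rw [relMatrix_samePanel, Matrix.add_mulVec, Matrix.one_mulVec, h, add_smul, one_smul]
  have h2 : (relMatrix ℝ (SamePanel k) *ᵥ φ) c = (relMatrix ℝ (SamePanel k) *ᵥ φ) d := by
    refine Finset.sum_congr rfl fun e _ => ?_
    simp only [relMatrix_apply]
    rw [if_congr (⟨hcd.symm.trans, hcd.trans⟩ : SamePanel k c e ↔ SamePanel k d e) rfl rfl]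
  rw [h1, Pi.smul_apply, Pi.smul_apply] at h2
  exact smul_right_injective ℝ (by positivity : (Fintype.card F : ℝ) + 1 ≠ 0) h2

end Connectivity

section Transverse

variable {F : Type} [Field F] [Fintype F] {m : ℕ} {K : Type*} [Field K]

/-- The vectors orthogonal to all columns of the incidence matrices. -/
noncomputable def incidencePerp (F : Type) [Field F] [Fintype F] (m : ℕ) (K : Type*) [Field K] :
    Submodule K (MaxFlag2 F m → K) :=
  ⨅ i : Fin (2 * m + 1), LinearMap.ker (incidenceMatrix F m K i)ᵀ.mulVecLin

theorem mem_incidencePerp {g : MaxFlag2 F m → K} :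
    g ∈ incidencePerp F m K ↔ ∀ i, i ≤ 2 * m → (incidenceMatrix F m K i)ᵀ *ᵥ g = 0 := by
  simp only [incidencePerp, Submodule.mem_iInf, LinearMap.mem_ker, Matrix.mulVecLin_apply]
  exact ⟨fun h i hi => h ⟨i, by omega⟩, fun h i => h i (by omega)⟩

theorem panelMatrix_mulVec_mem_incidencePerp {g : MaxFlag2 F m → K} (hg : g ∈ incidencePerp F m K)
    {k : ℕ} (hk : k + 2 ≤ 2 * m) : panelMatrix F m K k *ᵥ g ∈ incidencePerp F m K := by
  rw [mem_incidencePerp] at hg ⊢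
  intro i hi
  rw [Matrix.mulVec_mulVec, ← panelMatrix_transpose k, ← Matrix.transpose_mul]
  rcases eq_or_ne i (k + 1) with rfl | hik
  · rw [panelMatrix_mul_incidenceMatrix_succ hk, Matrix.transpose_sub, Matrix.transpose_add,
      Matrix.transpose_smul, Matrix.sub_mulVec, Matrix.add_mulVec, Matrix.smul_mulVec,
      hg _ (by omega), hg _ (by omega), hg _ (by omega)]
    simp
  · rw [panelMatrix_mul_incidenceMatrix_of_ne hk hik, Matrix.transpose_smul, Matrix.smul_mulVec,
      hg i hi, smul_zero]

open Classical in
theorem ascWord_mulVec_mem_incidencePerp {k : ℕ} (hk : k + 1 ≤ 2 * m) {g : MaxFlag2 F m → K}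
    (hg : g ∈ incidencePerp F m K) :
    ascWord (panelMatrix F m K) k *ᵥ g ∈ incidencePerp F m K := by
  induction k generalizing g with
  | zero => simpa [ascWord] using hg
  | succ k ih =>
    rw [ascWord, ← Matrix.mulVec_mulVec]
    exact ih (by omega) (panelMatrix_mulVec_mem_incidencePerp hg hk)

open Classical in
theorem longWord_mulVec_mem_incidencePerp {k : ℕ} (hk : k + 1 ≤ 2 * m) {g : MaxFlag2 F m → K}
    (hg : g ∈ incidencePerp F m K) :
    longWord (panelMatrix F m K) k *ᵥ g ∈ incidencePerp F m K := by
  induction k with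
  | zero => simpa [longWord] using hg
  | succ k ih =>
    rw [longWord_panelMatrix_succ hk, ← Matrix.mulVec_mulVec]
    exact ascWord_mulVec_mem_incidencePerp hk (ih (by omega))

end Transverse

section Real

variable {F : Type} [Field F] [Fintype F] {m : ℕ}

theorem isUnit_of_quad {K R : Type*} [Field K] [Ring R] [Algebra K R] {q : K} (hq : q ≠ 0) {t : R}
    (h : t * t = (q - 1) • t + q • (1 : R)) : IsUnit t := by
  have h1 : t * (q⁻¹ • (t - (q - 1) • 1)) = 1 := by
    rw [mul_smul_comm, mul_sub, h, mul_smul_comm, mul_one, add_sub_cancel_left, smul_smul,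
      inv_mul_cancel₀ hq, one_smul]
  have h2 : (q⁻¹ • (t - (q - 1) • 1)) * t = 1 := by
    rw [smul_mul_assoc, sub_mul, h, smul_mul_assoc, one_mul, add_sub_cancel_left, smul_smul,
      inv_mul_cancel₀ hq, one_smul]
  exact ⟨⟨t, _, h1, h2⟩, rfl⟩

theorem isUnit_ascWord {R : Type*} [Monoid R] {T : ℕ → R} {k : ℕ}
    (h : ∀ i, i < k → IsUnit (T i)) : IsUnit (ascWord T k) := by
  induction k with
  | zero => exact isUnit_one
  | succ k ih => exact (ih fun i hi => h i (by omega)).mul (h k (by omega))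

open Classical in
/-- No nonzero vector orthogonal to the incidence columns is an eigenvector for the extreme
eigenvalues of the longest word. -/
theorem eq_zero_of_mem_incidencePerp (hm : 1 ≤ m) {g : MaxFlag2 F m → ℝ}
    (hg : g ∈ incidencePerp F m ℝ)
    (hA : longWord (panelMatrix F m ℝ) (2 * m - 1) *ᵥ g =
      (-(Fintype.card F : ℝ) ^ (2 * m ^ 2 - 2 * m)) • g) : g = 0 := by
  by_contra hg0
  set q : ℝ := ((Fintype.card F : ℕ) : ℝ) with hqdef
  have hq : 1 < q := by
    rw [hqdef]
    exact_mod_cast Fintype.one_lt_card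
  let f := Matrix.toLpLinAlgEquiv (R := ℝ) (n := MaxFlag2 F m) 2
  have hf : ∀ (A : Matrix (MaxFlag2 F m) (MaxFlag2 F m) ℝ) (v : EuclideanSpace ℝ (MaxFlag2 F m)),
      f A v = WithLp.toLp 2 (A *ᵥ v.ofLp) := fun A v => rfl
  let T : ℕ → Module.End ℝ (EuclideanSpace ℝ (MaxFlag2 F m)) := fun i => f (panelMatrix F m ℝ i)
  have hH : HeckeRel q (2 * m - 1) T := (heckeRel_panelMatrix (F := F) (K := ℝ) (m := m)).map f
  let M : Submodule ℝ (EuclideanSpace ℝ (MaxFlag2 F m)) :=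
    (incidencePerp F m ℝ).comap (WithLp.linearEquiv 2 ℝ (MaxFlag2 F m → ℝ)).toLinearMap
  have hμ : q ^ (2 * (2 * m ^ 2 - 2 * m)) * q = q ^ ((2 * m - 1) * (2 * m - 1)) := by
    rw [← pow_succ]
    congr 1
    obtain ⟨l, rfl⟩ : ∃ l, m = l + 1 := ⟨m - 1, by omega⟩
    rw [show 2 * (l + 1) - 1 = 2 * l + 1 by omega,
      show 2 * (l + 1) ^ 2 - 2 * (l + 1) = 2 * l * (l + 1) by
        rw [Nat.sub_eq_iff_eq_add (by nlinarith)]; ring]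
    ring
  have hAA : (longWord T (2 * m - 1) * longWord T (2 * m - 1)) (WithLp.toLp 2 g) =
      q ^ (2 * (2 * m ^ 2 - 2 * m)) • WithLp.toLp 2 g := by
    rw [← map_longWord, Module.End.mul_apply, hf, hf, WithLp.ofLp_toLp, hA,
      Matrix.mulVec_smul, hA, smul_smul, ← WithLp.toLp_smul, neg_mul_neg, ← pow_add,
      ← two_mul]
  obtain ⟨w, hwM, hw0, hw⟩ := hH.exists_indexInvariant hq
    (fun i _ => Matrix.isSymmetric_toEuclideanLin_iff.2
      (by rw [Matrix.IsHermitian, Matrix.conjTranspose_eq_transpose_of_trivial,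
        panelMatrix_transpose]))
    (fun k hk => by
      rw [← map_longWord, ← map_longWord, ← map_ascWord, ← map_mul,
        longWord_panelMatrix_succ (by omega)])
    (M := M) (fun i hi v hv => panelMatrix_mulVec_mem_incidencePerp (k := i) hv (by omega))
    (v := WithLp.toLp 2 g) hg (fun h => hg0 (by simpa using h)) hμ hAA
  have hunit : IsUnit (ascWord T (2 * m - 1)) :=
    isUnit_ascWord fun i hi => isUnit_of_quad (by positivity : q ≠ 0) (hH.quad i hi)
  have hw'0 : ascWord T (2 * m - 1) w ≠ 0 := by
    intro h
    refine hw0 (((Module.End.isUnit_iff _).1 hunit).1 ?_)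
    rw [h, map_zero]
  refine hw'0 ?_
  rw [← map_ascWord, hf] at hw'0 ⊢
  have hT : ∀ i, i + 1 < 2 * m - 1 → panelMatrix F m ℝ (i + 1) *ᵥ
      (ascWord (panelMatrix F m ℝ) (2 * m - 1) *ᵥ w.ofLp) =
        q • (ascWord (panelMatrix F m ℝ) (2 * m - 1) *ᵥ w.ofLp) := by
    intro i hi
    have h1 := (heckeRel_panelMatrix (F := F) (K := ℝ) (m := m)).mul_ascWord hi le_rfl
    have h2 : panelMatrix F m ℝ i *ᵥ w.ofLp = q • w.ofLp :=
      congrArg WithLp.ofLp (hw i (by omega))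
    rw [Matrix.mulVec_mulVec, h1, ← Matrix.mulVec_mulVec, h2, Matrix.mulVec_smul]
  rw [eq_zero_of_incidence_one (φ := ascWord (panelMatrix F m ℝ) (2 * m - 1) *ᵥ w.ofLp) hm ?_ ?_,
    WithLp.toLp_zero]
  · intro k hk hkm c d hcd
    obtain ⟨i, rfl⟩ : ∃ i, k = i + 1 := ⟨k - 1, by omega⟩
    exact apply_eq_of_panelMatrix_mulVec (hT i (by omega)) hcd
  · exact mem_incidencePerp.1 (ascWord_mulVec_mem_incidencePerp (by omega) hwM) 1 (by omega)

end Real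

section OrthogonalDecomposition

theorem exists_mulVec_add_of_transpose_mulVec_eq_zero {α β : Type*} [Fintype α] [Fintype β]
    (C : Matrix α β ℚ) (f : α → ℚ) : ∃ x g, Cᵀ *ᵥ g = 0 ∧ f = C *ᵥ x + g := by
  classical
  have hle : LinearMap.range (Cᵀ * C).mulVecLin ≤ LinearMap.range Cᵀ.mulVecLin := by
    rw [Matrix.mulVecLin_mul]
    exact LinearMap.range_comp_le_range _ _
  have heq := Submodule.eq_of_le_of_finrank_eq hle
    ((Matrix.rank_transpose_mul_self C).trans (Matrix.rank_transpose C).symm)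
  obtain ⟨x, hx⟩ : Cᵀ *ᵥ f ∈ LinearMap.range (Cᵀ * C).mulVecLin := heq ▸ ⟨f, rfl⟩
  refine ⟨x, f - C *ᵥ x, ?_, by abel⟩
  rw [Matrix.mulVec_sub, Matrix.mulVec_mulVec, sub_eq_zero]
  exact hx.symm

theorem relMatrix_mulVec_ratCast {α β : Type*} [Fintype β] (r : α → β → Prop) (g : β → ℚ) :
    (relMatrix ℝ r *ᵥ fun b => (g b : ℝ)) = fun a => ((relMatrix ℚ r *ᵥ g) a : ℝ) := by
  funext a
  simp only [Matrix.mulVec, dotProduct, relMatrix_apply, Rat.cast_sum, Rat.cast_mul]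
  exact Finset.sum_congr rfl fun b _ => by split_ifs <;> simp

end OrthogonalDecomposition

section PointModule

variable {F : Type} [Field F] [Fintype F] {m : ℕ}

/-- The operators of the panel matrices on rational functions on flags. -/
noncomputable def panelOp (F : Type) [Field F] [Fintype F] (m k : ℕ) :
    Module.End ℚ (MaxFlag2 F m → ℚ) :=
  (panelMatrix F m ℚ k).mulVecLin

theorem adj2_eq_relMatrix (hm : 1 ≤ m) : adj2 F m = relMatrix ℚ (OppUpTo (2 * m - 1)) := by
  classical
  ext c d
  exact if_congr (oppUpTo_top hm).symm rfl rfl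

open Classical in
theorem longWord_panelOp (hm : 1 ≤ m) :
    longWord (panelOp F m) (2 * m - 1) = (adj2 F m).mulVecLin := by
  rw [adj2_eq_relMatrix hm, ← longWord_panelMatrix (by omega)]
  exact (map_longWord (Matrix.toLinAlgEquiv' (R := ℚ) (n := MaxFlag2 F m)) _ _).symm

/-- The rational functions on points with zero sum. -/
noncomputable def sumZero (F : Type) [Field F] [Fintype F] (m : ℕ) :
    Submodule ℚ (Point2 F m → ℚ) :=
  LinearMap.ker (∑ X : Point2 F m, LinearMap.proj X : (Point2 F m → ℚ) →ₗ[ℚ] ℚ)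

theorem mem_sumZero {u : Point2 F m → ℚ} : u ∈ sumZero F m ↔ ∑ X, u X = 0 := by
  simp [sumZero, LinearMap.sum_apply]

theorem exists_eq_sumZero_add (x : Point2 F m → ℚ) :
    ∃ (u : sumZero F m) (a : ℚ), x = u.1 + a • 1 := by
  rcases isEmpty_or_nonempty (Point2 F m) with h | h
  · exact ⟨0, 0, Subsingleton.elim _ _⟩
  · refine ⟨⟨x - ((∑ X, x X) / Fintype.card (Point2 F m)) • 1, mem_sumZero.2 ?_⟩, _,
      (sub_add_cancel _ _).symm⟩
    simp [Finset.sum_sub_distrib, mul_div_cancel₀]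

/-- The incidence matrices as maps on functions with zero sum. -/
noncomputable def incidenceMap (F : Type) [Field F] [Fintype F] (m i : ℕ) :
    sumZero F m →ₗ[ℚ] MaxFlag2 F m → ℚ :=
  (incidenceMatrix F m ℚ i).mulVecLin ∘ₗ (sumZero F m).subtype

theorem incidenceMap_apply (i : ℕ) (u : sumZero F m) :
    incidenceMap F m i u = incidenceMatrix F m ℚ i *ᵥ u.1 := rfl

omit [Fintype F] in
open Classical in
theorem incidenceMatrix_apply (i : ℕ) (c : MaxFlag2 F m) (X : Point2 F m) :
    incidenceMatrix F m ℚ i c X = if X.1 ≤ flagMem2 c i then 1 else 0 := rfl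

theorem incidenceChain_incidenceMap (hm : 1 ≤ m) :
    IncidenceChain (Fintype.card F : ℚ) (2 * m - 1) (panelOp F m) (incidenceMap F m) where
  bot := by
    ext u c
    rw [incidenceMap_apply]
    refine Finset.sum_eq_zero fun X _ => ?_
    beta_reduce
    have h : ¬ X.1 ≤ flagMem2 c 0 := by
      rw [flagMem2_zero, le_bot_iff]
      intro h
      have := X.2
      rw [h, finrank_bot] at this
      omega
    rw [incidenceMatrix_apply, if_neg h, zero_mul]
  top := by
    rw [Nat.sub_add_cancel (by omega)]
    ext u c
    rw [incidenceMap_apply, LinearMap.zero_apply, Pi.zero_apply, ← mem_sumZero.1 u.2]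
    refine Finset.sum_congr rfl fun X _ => ?_
    beta_reduce
    rw [incidenceMatrix_apply, if_pos (by rw [flagMem2_of_le c le_rfl]; exact le_top),
      one_mul]
  apply_of_ne k j hk _ hj u := by
    rw [incidenceMap_apply, panelOp, Matrix.mulVecLin_apply, Matrix.mulVec_mulVec,
      panelMatrix_mul_incidenceMatrix_of_ne (by omega) hj, Matrix.smul_mulVec]
  apply_succ k hk u := by
    simp only [incidenceMap_apply]
    rw [panelOp, Matrix.mulVecLin_apply, Matrix.mulVec_mulVec,
      panelMatrix_mul_incidenceMatrix_succ (by omega), Matrix.sub_mulVec, Matrix.add_mulVec,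
      Matrix.smul_mulVec]

theorem sub_one_smul_incidenceMatrix_mulVec_one {i : ℕ} (hi : i ≤ 2 * m) :
    ((Fintype.card F : ℚ) - 1) • (incidenceMatrix F m ℚ i *ᵥ 1) =
      ((Fintype.card F : ℚ) ^ i - 1) • 1 := by
  classical
  funext c
  have h1 : (incidenceMatrix F m ℚ i *ᵥ 1) c = (Nat.card {W : Submodule F (Fin (2 * m) → F) //
      ⊥ ≤ W ∧ W ≤ flagMem2 c i ∧ Module.finrank F W = 0 + 1} : ℚ) := by
    let e : {X : Point2 F m // X.1 ≤ flagMem2 c i} ≃ {W : Submodule F (Fin (2 * m) → F) //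
        ⊥ ≤ W ∧ W ≤ flagMem2 c i ∧ Module.finrank F W = 0 + 1} :=
      { toFun := fun X => ⟨X.1.1, bot_le, X.2, X.1.2⟩
        invFun := fun W => ⟨⟨W.1, W.2.2.2⟩, W.2.2.1⟩
        left_inv := fun _ => rfl
        right_inv := fun _ => rfl }
    rw [← Nat.card_congr e, Nat.card_eq_fintype_card, Fintype.card_subtype]
    simp [Matrix.mulVec, dotProduct, incidenceMatrix, relMatrix_apply]
  have h2 := card_covering_mul (F := F) (bot_le : ⊥ ≤ flagMem2 c i) (finrank_bot F _)
    (finrank_flagMem2 c hi)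
  have h3 : (Nat.card {W : Submodule F (Fin (2 * m) → F) //
      ⊥ ≤ W ∧ W ≤ flagMem2 c i ∧ Module.finrank F W = 0 + 1} : ℚ) *
        ((Fintype.card F : ℚ) ^ (0 + 1) - (Fintype.card F : ℚ) ^ 0) =
          (Fintype.card F : ℚ) ^ i - (Fintype.card F : ℚ) ^ 0 := by
    exact_mod_cast h2
  rw [zero_add, pow_one, pow_zero] at h3
  rw [Pi.smul_apply, Pi.smul_apply, h1, smul_eq_mul, smul_eq_mul, mul_comm, Pi.one_apply, mul_one]
  exact h3

theorem one_lt_card_rat (F : Type) [Field F] [Fintype F] : (1 : ℚ) < Fintype.card F := by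
  exact_mod_cast Fintype.one_lt_card

omit [Fintype F] in
theorem flagType2_eq_succ_iff {c : MaxFlag2 F m} {X : Submodule F (Fin (2 * m) → F)} {i : ℕ} :
    flagType2 c X = i + 1 ↔ X ≤ flagMem2 c (i + 1) ∧ ¬ X ≤ flagMem2 c i := by
  constructor
  · intro h
    refine ⟨?_, fun h' => ?_⟩
    · have : flagType2 c X ∈ {k : ℕ | X ≤ flagMem2 c k} :=
        Nat.sInf_mem ⟨2 * m, by simp [flagMem2_of_le c le_rfl]⟩
      rwa [h] at this
    · have : flagType2 c X ≤ i := Nat.sInf_le h'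
      omega
  · rintro ⟨h1, h2⟩
    refine le_antisymm (Nat.sInf_le h1) (le_csInf ⟨_, h1⟩ fun k hk => ?_)
    by_contra! hlt
    exact h2 (le_trans hk (flagMem2_mono c (by omega)))

theorem Tmat2_succ (i : ℕ) :
    Tmat2 F m (i + 1) = incidenceMatrix F m ℚ (i + 1) - incidenceMatrix F m ℚ i := by
  classical
  ext c X
  have := flagMem2_mono c (Nat.le_succ i)
  have h := flagType2_eq_succ_iff (c := c) (X := X.1) (i := i)
  rw [Matrix.sub_apply, incidenceMatrix_apply, incidenceMatrix_apply, Tmat2]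
  by_cases h1 : X.1 ≤ flagMem2 c i
  · rw [if_neg fun h' => (h.1 h').2 h1, if_pos h1, if_pos (h1.trans this), sub_self]
  · rw [if_neg h1, sub_zero]
    exact if_congr (h.trans (and_iff_left h1)) rfl rfl

theorem sum_Icc_Tmat2 (a d : ℕ) : ∑ i ∈ Finset.Icc (a + 1) (a + d), Tmat2 F m i =
    incidenceMatrix F m ℚ (a + d) - incidenceMatrix F m ℚ a := by
  induction d with
  | zero => simp
  | succ d ih =>
    rw [← add_assoc, Finset.sum_Icc_succ_top (by omega), ih, Tmat2_succ]
    abel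

theorem Fmat2_eq {j : ℕ} (hj : j ≤ m) :
    Fmat2 F m j = ((Fintype.card F : ℚ) ^ j + 1) • incidenceMatrix F m ℚ m -
      (Fintype.card F : ℚ) ^ j • incidenceMatrix F m ℚ (m - j) -
        incidenceMatrix F m ℚ (m + j) := by
  have h := sum_Icc_Tmat2 (F := F) (m := m) (m - j) j
  rw [Nat.sub_add_cancel hj] at h
  rw [Fmat2, h, sum_Icc_Tmat2]
  module

theorem Fmat2_mulVec_one {j : ℕ} (hj : j ≤ m) : Fmat2 F m j *ᵥ 1 = 0 := by
  have hq := one_lt_card_rat F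
  refine (smul_eq_zero.1 (?_ : ((Fintype.card F : ℚ) - 1) • (Fmat2 F m j *ᵥ 1) = 0)).resolve_left
    (by linarith)
  rw [Fmat2_eq hj, Matrix.sub_mulVec, Matrix.sub_mulVec, Matrix.smul_mulVec, Matrix.smul_mulVec,
    smul_sub, smul_sub, smul_comm _ (_ + _), smul_comm _ (_ ^ _),
    sub_one_smul_incidenceMatrix_mulVec_one (by omega),
    sub_one_smul_incidenceMatrix_mulVec_one (by omega),
    sub_one_smul_incidenceMatrix_mulVec_one (by omega), smul_smul, smul_smul, ← sub_smul,
    ← sub_smul]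
  have hp : (Fintype.card F : ℚ) ^ j * (Fintype.card F : ℚ) ^ (m - j) =
      (Fintype.card F : ℚ) ^ m := by
    rw [← pow_add, Nat.add_sub_cancel' hj]
  refine smul_eq_zero_of_left ?_ _
  linear_combination -hp

theorem range_Fmat2 {j : ℕ} (hj : j ≤ m) : LinearMap.range (Fmat2 F m j).mulVecLin =
    LinearMap.range
      (IncidenceChain.minEigenMap (Fintype.card F : ℚ) m (incidenceMap F m) j) := by
  have h : ∀ u : sumZero F m, Fmat2 F m j *ᵥ u.1 =
      IncidenceChain.minEigenMap (Fintype.card F : ℚ) m (incidenceMap F m) j u := by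
    intro u
    rw [IncidenceChain.minEigenMap_apply, Fmat2_eq hj, Matrix.sub_mulVec, Matrix.sub_mulVec,
      Matrix.smul_mulVec, Matrix.smul_mulVec]
    rfl
  apply le_antisymm
  · rintro _ ⟨x, rfl⟩
    obtain ⟨u, a, rfl⟩ := exists_eq_sumZero_add x
    refine ⟨u, ?_⟩
    rw [← h, Matrix.mulVecLin_apply, Matrix.mulVec_add, Matrix.mulVec_smul, Fmat2_mulVec_one hj,
      smul_zero, add_zero]
  · rintro _ ⟨u, rfl⟩
    exact ⟨u.1, h u⟩

end PointModule

section MinimalEigenspace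

variable {F : Type} [Field F] [Fintype F] {m : ℕ}

theorem adj2_mulVec_one (hm : 1 ≤ m) :
    adj2 F m *ᵥ 1 = (Fintype.card F : ℚ) ^ (∑ i ∈ Finset.range (2 * m), i) • 1 := by
  classical
  have h : ∀ k, k < 2 * m - 1 → panelOp F m k 1 = (Fintype.card F : ℚ) • 1 := by
    intro k hk
    have h1 : relMatrix ℚ (SamePanel (F := F) (m := m) k) *ᵥ 1 =
        ((Fintype.card F : ℚ) + 1) • 1 := by
      funext c
      have := card_panel c (k := k) (by omega)
      simp [Matrix.mulVec, dotProduct, relMatrix_apply, this]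
    rw [relMatrix_samePanel, Matrix.add_mulVec, Matrix.one_mulVec, add_smul, one_smul] at h1
    exact add_right_cancel h1
  have h2 := longWord_apply_of_forall_smul h
  rwa [longWord_panelOp hm, Nat.sub_add_cancel (by omega)] at h2

theorem adj2_mulVec_adj2_mulVec_incidenceMap (hm : 1 ≤ m) {i : ℕ} (hi : i ≤ 2 * m)
    (u : sumZero F m) : adj2 F m *ᵥ (adj2 F m *ᵥ incidenceMap F m i u) =
      ((Fintype.card F : ℚ) ^ (2 * m ^ 2 - 2 * m)) ^ 2 • incidenceMap F m i u := by
  have hq := one_lt_card_rat F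
  have h : ∀ i, i ≤ 2 * m → ∀ u, adj2 F m *ᵥ incidenceMap F m i u =
      -(((Fintype.card F : ℚ) ^ (2 * m ^ 2 - 2 * m) * (Fintype.card F : ℚ) ^ i *
        ((Fintype.card F : ℚ) ^ m)⁻¹) • incidenceMap F m (2 * m - i) u) := fun i hi u => by
    have := (incidenceChain_incidenceMap (F := F) hm).longWord_top_apply hq
      (Nat.sub_add_cancel (by omega)) hi u
    rwa [longWord_panelOp hm] at this
  rw [h i hi, Matrix.mulVec_neg, Matrix.mulVec_smul, h _ (Nat.sub_le _ _), Nat.sub_sub_self hi,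
    smul_neg, neg_neg, smul_smul]
  congr 1
  have hq0 : (Fintype.card F : ℚ) ≠ 0 := by positivity
  have hp : (Fintype.card F : ℚ) ^ i * (Fintype.card F : ℚ) ^ (2 * m - i) =
      (Fintype.card F : ℚ) ^ m * (Fintype.card F : ℚ) ^ m := by
    rw [← pow_add, ← pow_add]
    congr 1
    omega
  field_simp
  linear_combination hp

theorem dotProduct_incidenceMatrix_mulVec {g : MaxFlag2 F m → ℚ} (hg : g ∈ incidencePerp F m ℚ)
    {i : ℕ} (hi : i ≤ 2 * m) (x : Point2 F m → ℚ) : g ⬝ᵥ (incidenceMatrix F m ℚ i *ᵥ x) = 0 := by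
  rw [Matrix.dotProduct_mulVec, ← Matrix.mulVec_transpose, mem_incidencePerp.1 hg i hi,
    zero_dotProduct]

theorem adj2_mulVec_mem_incidencePerp (hm : 1 ≤ m) {g : MaxFlag2 F m → ℚ}
    (hg : g ∈ incidencePerp F m ℚ) : adj2 F m *ᵥ g ∈ incidencePerp F m ℚ := by
  classical
  have h := longWord_mulVec_mem_incidencePerp (by omega : 2 * m - 1 + 1 ≤ 2 * m) hg
  rw [longWord_panelMatrix (by omega)] at h
  rwa [adj2_eq_relMatrix hm]

/-- The rational version of `eq_zero_of_mem_incidencePerp`. -/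
theorem eq_zero_of_adj2_mulVec_eq (hm : 1 ≤ m) {g : MaxFlag2 F m → ℚ}
    (hg : g ∈ incidencePerp F m ℚ)
    (hA : adj2 F m *ᵥ g = (-(Fintype.card F : ℚ) ^ (2 * m ^ 2 - 2 * m)) • g) : g = 0 := by
  have h : (fun c => (g c : ℝ)) = 0 := by
    refine eq_zero_of_mem_incidencePerp hm (mem_incidencePerp.2 fun i hi => ?_) ?_
    · have h1 := relMatrix_mulVec_ratCast
        (fun (X : Point2 F m) (c : MaxFlag2 F m) => X.1 ≤ flagMem2 c i) g
      rw [incidenceMatrix, relMatrix_transpose, h1]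
      funext X
      have h2 := congrFun (mem_incidencePerp.1 hg i hi) X
      rw [incidenceMatrix, relMatrix_transpose] at h2
      rw [h2]
      simp
    · rw [longWord_panelMatrix (by omega), relMatrix_mulVec_ratCast, ← adj2_eq_relMatrix hm, hA]
      funext c
      simp
  funext c
  exact Rat.cast_eq_zero.1 (congrFun h c)

theorem exists_sum_incidenceMatrix_mulVec_of_adj2_mulVec_eq (hm : 1 ≤ m) {f : MaxFlag2 F m → ℚ}
    (hf : adj2 F m *ᵥ f = (-(Fintype.card F : ℚ) ^ (2 * m ^ 2 - 2 * m)) • f) :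
    ∃ x : ℕ → Point2 F m → ℚ,
      f = ∑ i ∈ Finset.range (2 * m + 1), incidenceMatrix F m ℚ i *ᵥ x i := by
  obtain ⟨x, g, hg, rfl⟩ := exists_mulVec_add_of_transpose_mulVec_eq_zero
    (Matrix.of fun (c : MaxFlag2 F m) (p : Fin (2 * m + 1) × Point2 F m) =>
      incidenceMatrix F m ℚ p.1 c p.2) f
  have hgperp : g ∈ incidencePerp F m ℚ := mem_incidencePerp.2 fun i hi =>
    funext fun X => congrFun hg (⟨i, by omega⟩, X)
  set z := (Matrix.of fun (c : MaxFlag2 F m) (p : Fin (2 * m + 1) × Point2 F m) =>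
      incidenceMatrix F m ℚ p.1 c p.2) *ᵥ x with hz
  have hz' : z = ∑ i : Fin (2 * m + 1), incidenceMatrix F m ℚ i *ᵥ fun X => x (i, X) := by
    funext c
    rw [hz, Matrix.mulVec, dotProduct, Fintype.sum_prod_type, Finset.sum_apply]
    rfl
  have horth : ∀ h ∈ incidencePerp F m ℚ, h ⬝ᵥ z = 0 := by
    intro h hh
    rw [hz', dotProduct_sum]
    exact Finset.sum_eq_zero fun i _ => dotProduct_incidenceMatrix_mulVec hh (by omega) _
  set l := -(Fintype.card F : ℚ) ^ (2 * m ^ 2 - 2 * m) with hl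
  have hsymm : (adj2 F m)ᵀ = adj2 F m := by
    rw [adj2_eq_relMatrix hm]
    exact relMatrix_transpose_of_symm fun _ _ => OppUpTo.symm
  have hp : adj2 F m *ᵥ g - l • g ∈ incidencePerp F m ℚ :=
    sub_mem (adj2_mulVec_mem_incidencePerp hm hgperp) (Submodule.smul_mem _ _ hgperp)
  have hp' : adj2 F m *ᵥ g - l • g = l • z - adj2 F m *ᵥ z := by
    rw [Matrix.mulVec_add, smul_add] at hf
    linear_combination hf
  have hg0 : g = 0 := by
    refine eq_zero_of_adj2_mulVec_eq hm hgperp (sub_eq_zero.1 (dotProduct_self_eq_zero.1 ?_))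
    rw [← hl]
    nth_rw 2 [hp']
    rw [dotProduct_sub, dotProduct_smul, horth _ hp, Matrix.dotProduct_mulVec,
      ← Matrix.mulVec_transpose, hsymm, horth _ (adj2_mulVec_mem_incidencePerp hm hp)]
    simp
  refine ⟨fun i X => if hi : i < 2 * m + 1 then x (⟨i, hi⟩, X) else 0, ?_⟩
  rw [hg0, add_zero, hz', Finset.sum_range]
  exact Finset.sum_congr rfl fun i _ => by simp only [dif_pos i.2]

theorem mem_iSup_range_of_adj2_mulVec_eq (hm : 1 ≤ m) {f : MaxFlag2 F m → ℚ}
    (hf : adj2 F m *ᵥ f = (-(Fintype.card F : ℚ) ^ (2 * m ^ 2 - 2 * m)) • f) :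
    f ∈ ⨆ j : Fin m, LinearMap.range (IncidenceChain.minEigenMap (Fintype.card F : ℚ) m
      (incidenceMap F m) (j + 1)) := by
  have hq := one_lt_card_rat F
  obtain ⟨x, hx⟩ := exists_sum_incidenceMatrix_mulVec_of_adj2_mulVec_eq hm hf
  choose u a hua using fun i => exists_eq_sumZero_add (x i)
  set e := ∑ i ∈ Finset.range (2 * m + 1), incidenceMap F m i (u i) with he
  obtain ⟨c, hc⟩ : ∃ c : ℚ, f = e + c • 1 := by
    refine ⟨∑ i ∈ Finset.range (2 * m + 1),
      a i * (((Fintype.card F : ℚ) - 1)⁻¹ * ((Fintype.card F : ℚ) ^ i - 1)), ?_⟩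
    rw [hx, he, Finset.sum_smul, ← Finset.sum_add_distrib]
    refine Finset.sum_congr rfl fun i hi => ?_
    have hi' : i ≤ 2 * m := Nat.lt_succ_iff.1 (Finset.mem_range.1 hi)
    have h1 := sub_one_smul_incidenceMatrix_mulVec_one (F := F) hi'
    rw [← eq_inv_smul_iff₀ (by linarith), smul_smul] at h1
    rw [hua i, Matrix.mulVec_add, Matrix.mulVec_smul, h1, smul_smul, incidenceMap_apply]
  have hAe : adj2 F m *ᵥ (adj2 F m *ᵥ e) =
      ((Fintype.card F : ℚ) ^ (2 * m ^ 2 - 2 * m)) ^ 2 • e := by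
    rw [he, Matrix.mulVec_sum, Matrix.mulVec_sum, Finset.smul_sum]
    exact Finset.sum_congr rfl fun i hi =>
      adj2_mulVec_adj2_mulVec_incidenceMap hm (Nat.lt_succ_iff.1 (Finset.mem_range.1 hi)) _
  have hAf : adj2 F m *ᵥ (adj2 F m *ᵥ f) =
      ((Fintype.card F : ℚ) ^ (2 * m ^ 2 - 2 * m)) ^ 2 • f := by
    rw [hf, Matrix.mulVec_smul, hf, smul_smul, neg_mul_neg, ← sq]
  have hc0 : c • (1 : MaxFlag2 F m → ℚ) = 0 := by
    rw [hc, Matrix.mulVec_add, Matrix.mulVec_add, hAe, smul_add, add_right_inj,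
      Matrix.mulVec_smul, Matrix.mulVec_smul, adj2_mulVec_one hm, Matrix.mulVec_smul,
      adj2_mulVec_one hm, smul_smul (_ ^ _), ← sq, smul_comm c, ← sub_eq_zero, ← sub_smul] at hAf
    refine (smul_eq_zero.1 hAf).resolve_left (sub_ne_zero.2 (ne_of_gt ?_))
    refine pow_lt_pow_left₀ (pow_lt_pow_right₀ hq ?_) (by positivity) two_ne_zero
    have hs := Finset.sum_range_id_mul_two (2 * m)
    obtain ⟨k, rfl⟩ : ∃ k, m = k + 1 := ⟨m - 1, by omega⟩
    rw [show 2 * (k + 1) - 1 = 2 * k + 1 by omega] at hs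
    rw [Nat.sub_lt_iff_lt_add (by nlinarith)]
    nlinarith
  rw [hc0, add_zero] at hc
  refine (incidenceChain_incidenceMap hm).mem_iSup_range_minEigenMap hq
    (Nat.sub_add_cancel (by omega)) (hc.trans he) ?_
  rw [longWord_panelOp hm]
  exact hf

end MinimalEigenspace

/-- The eigenspace of the smallest eigenvalue `-q^((n²-1)/2) = -q^(2m²-2m)` of the
opposition graph on maximal flags of `F_q^(2m)` is the (internal) direct sum
`col(F_1) ⊕ ⋯ ⊕ col(F_m)` of the column spaces of the matrices `F_j`. -/
theorem eigenspace_eq_direct_sum_col (F : Type) [Field F] [Fintype F] (q : ℕ)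
    (hq : Fintype.card F = q) (m : ℕ) (hm : 1 ≤ m) :
    iSupIndep (fun j : Fin m => LinearMap.range (Fmat2 F m (j.1 + 1)).mulVecLin) ∧
    (⨆ j : Fin m, LinearMap.range (Fmat2 F m (j.1 + 1)).mulVecLin) =
      Module.End.eigenspace (adj2 F m).mulVecLin (-((q : ℚ) ^ (2 * m ^ 2 - 2 * m))) := by
  subst hq
  have hchain := incidenceChain_incidenceMap (F := F) hm
  have hnm : 2 * m - 1 + 1 = 2 * m := Nat.sub_add_cancel (by omega)
  simp only [fun j : Fin m => range_Fmat2 (F := F) (j := j.1 + 1) j.2]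
  refine ⟨hchain.iSupIndep_range_minEigenMap (one_lt_card_rat F) hnm,
    le_antisymm (iSup_le fun j => ?_) fun f hf =>
      mem_iSup_range_of_adj2_mulVec_eq hm (Module.End.mem_eigenspace_iff.1 hf)⟩
  rintro _ ⟨u, rfl⟩
  rw [Module.End.mem_eigenspace_iff, ← longWord_panelOp hm]
  exact hchain.longWord_apply_minEigenMap (one_lt_card_rat F) hnm j.2 u
end

section
/- Let B be a nondegenerate alternating bilinear form on F_q^{2n} with n ≥ 2, let A be the adjacency matrix of the opposition graph on maximal isotropic flags, and for j ∈ {1,…,n} let F_j := q^j ∑_{i=n−j+1}^{n} T_i − ∑_{i=n+1}^{n+j} T_i. Then A·F_j = −q^{n(n−1)}·F_j; in particular every column of F_j (equivalently, every function χ_j^P) is an eigenvector of the opposition graph for the smallest eigenvalue −q^{n(n−1)}. -/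
open Matrix

/-- A maximal isotropic flag for the bilinear form `B` on `F^(2n)`: a chain
`U 0 ⊆ U 1 ⊆ ⋯ ⊆ U n` with `dim (U k) = k` (so `U 0 = ⊥`) whose top member (and hence
every member) is totally isotropic. -/
def SympFlag (F : Type) [Field F] (n : ℕ) (B : LinearMap.BilinForm F (Fin (2 * n) → F)) :
    Type :=
  {U : Fin (n + 1) → Submodule F (Fin (2 * n) → F) //
    Monotone U ∧ (∀ k : Fin (n + 1), Module.finrank F (U k) = (k : ℕ)) ∧
    ∀ x ∈ U (Fin.last n), ∀ y ∈ U (Fin.last n), B x y = 0}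

/-- The `k`-th member (for `k : ℕ`, `1`-based) of the chain
`U_1 ⊆ ⋯ ⊆ U_n ⊆ U_(n-1)^⊥ ⊆ ⋯ ⊆ U_1^⊥`; equal to `⊤` for `k ≥ 2n`. -/
noncomputable def sympMem {F : Type} [Field F] {n : ℕ}
    {B : LinearMap.BilinForm F (Fin (2 * n) → F)} (c : SympFlag F n B) (k : ℕ) :
    Submodule F (Fin (2 * n) → F) :=
  if h : k ≤ n then c.1 ⟨k, by omega⟩
  else if h2 : k ≤ 2 * n - 1 then B.orthogonal (c.1 ⟨2 * n - k, by omega⟩)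
  else ⊤

/-- The type of a maximal isotropic flag with respect to a point `X`: the smallest `k`
such that `X` is contained in the `k`-th member of the chain
`U_1 ⊆ ⋯ ⊆ U_n ⊆ U_(n-1)^⊥ ⊆ ⋯ ⊆ U_1^⊥`, and `2n` if `X ⊄ U_1^⊥`. -/
noncomputable def sympType {F : Type} [Field F] {n : ℕ}
    {B : LinearMap.BilinForm F (Fin (2 * n) → F)} (c : SympFlag F n B)
    (X : Submodule F (Fin (2 * n) → F)) : ℕ :=
  sInf {k : ℕ | X ≤ sympMem c k}

/-- `c(k,1) = ∏_{i=1}^{k} (q^(2i)-1)/(q-1)`. -/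
noncomputable def cB (q : ℚ) (k : ℕ) : ℚ :=
  ∏ i ∈ Finset.Icc 1 k, (q ^ (2 * i) - 1) / (q - 1)

instance (F : Type) [Field F] [Fintype F] (n : ℕ)
    (B : LinearMap.BilinForm F (Fin (2 * n) → F)) : Finite (SympFlag F n B) :=
  Subtype.finite

noncomputable instance (F : Type) [Field F] [Fintype F] (n : ℕ)
    (B : LinearMap.BilinForm F (Fin (2 * n) → F)) : Fintype (SympFlag F n B) :=
  Fintype.ofFinite _

/-- The points: one-dimensional subspaces of `F^(2n)`. -/
def PointS (F : Type) [Field F] (n : ℕ) : Type :=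
  {X : Submodule F (Fin (2 * n) → F) // Module.finrank F X = 1}

instance (F : Type) [Field F] [Fintype F] (n : ℕ) : Finite (PointS F n) :=
  Subtype.finite

noncomputable instance (F : Type) [Field F] [Fintype F] (n : ℕ) : Fintype (PointS F n) :=
  Fintype.ofFinite _

/-- Two maximal isotropic flags are opposite when `U_i ∩ V_i^⊥ = 0` for all `i`
(trivial for `i = 0`). -/
def OppS {F : Type} [Field F] {n : ℕ} {B : LinearMap.BilinForm F (Fin (2 * n) → F)}
    (c d : SympFlag F n B) : Prop :=
  ∀ i : Fin (n + 1), c.1 i ⊓ B.orthogonal (d.1 i) = ⊥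

open Classical in
/-- The adjacency matrix of the opposition graph on maximal isotropic flags. -/
noncomputable def adjS (F : Type) [Field F] [Fintype F] (n : ℕ)
    (B : LinearMap.BilinForm F (Fin (2 * n) → F)) :
    Matrix (SympFlag F n B) (SympFlag F n B) ℚ :=
  fun c d => if OppS c d then 1 else 0

open Classical in
/-- `T_i`: the flag-by-point `{0,1}` matrix of the `type i` relation. -/
noncomputable def TmatS (F : Type) [Field F] [Fintype F] (n : ℕ)
    (B : LinearMap.BilinForm F (Fin (2 * n) → F)) (i : ℕ) :
    Matrix (SympFlag F n B) (PointS F n) ℚ :=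
  fun c X => if sympType c X.1 = i then 1 else 0

/-- `F_j = q^j ∑_{i=n-j+1}^{n} T_i - ∑_{i=n+1}^{n+j} T_i`. -/
noncomputable def FmatS (F : Type) [Field F] [Fintype F] (n : ℕ)
    (B : LinearMap.BilinForm F (Fin (2 * n) → F)) (j : ℕ) :
    Matrix (SympFlag F n B) (PointS F n) ℚ :=
  (Fintype.card F : ℚ) ^ j • (∑ i ∈ Finset.Icc (n - j + 1) n, TmatS F n B i) -
    ∑ i ∈ Finset.Icc (n + 1) (n + j), TmatS F n B i

section SympOpposition

variable {F : Type} [Field F] {n : ℕ} {B : LinearMap.BilinForm F (Fin (2 * n) → F)}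

theorem BilinForm.swap_of_alternating (hBalt : ∀ v, B v v = 0) (v w : Fin (2 * n) → F) :
    B w v = -B v w := by
  have h := hBalt (v + w)
  simp only [map_add, LinearMap.add_apply, hBalt] at h
  linear_combination h

theorem BilinForm.isRefl_of_alternating (hBalt : ∀ v, B v v = 0) : B.IsRefl :=
  LinearMap.IsAlt.isRefl hBalt

namespace SympFlag

theorem isotropic (c : SympFlag F n B) {i k : Fin (n + 1)} {x y : Fin (2 * n) → F}
    (hx : x ∈ c.1 i) (hy : y ∈ c.1 k) : B x y = 0 :=
  c.2.2.2 x (c.2.1 (Fin.le_last i) hx) y (c.2.1 (Fin.le_last k) hy)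

theorem le_orthogonal (c : SympFlag F n B) (i k : Fin (n + 1)) :
    c.1 i ≤ B.orthogonal (c.1 k) :=
  fun _ hx _ hy => c.isotropic hy hx

theorem finrank_orthogonal (hB : B.Nondegenerate) (c : SympFlag F n B) (i : Fin (n + 1)) :
    Module.finrank F (B.orthogonal (c.1 i)) = 2 * n - i := by
  rw [LinearMap.BilinForm.finrank_orthogonal hB, c.2.2.1]
  simp

theorem bot_eq (c : SympFlag F n B) : c.1 0 = ⊥ := by
  have := c.2.2.1 0
  simpa using this

theorem orthogonal_last (hB : B.Nondegenerate) (c : SympFlag F n B) :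
    B.orthogonal (c.1 (Fin.last n)) = c.1 (Fin.last n) := by
  refine (Submodule.eq_of_le_of_finrank_eq (c.le_orthogonal _ _) ?_).symm
  rw [finrank_orthogonal hB, c.2.2.1]
  simp
  omega

/-- The action of an isometry on maximal isotropic flags. -/
def map (g : (Fin (2 * n) → F) →ₗ[F] (Fin (2 * n) → F)) (hg : Function.Injective g)
    (hiso : ∀ v w, B (g v) (g w) = B v w) (c : SympFlag F n B) : SympFlag F n B :=
  ⟨fun i => (c.1 i).map g, fun _ _ h => Submodule.map_mono (c.2.1 h),
    fun k => by
      rw [← c.2.2.1 k]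
      exact (LinearEquiv.finrank_eq (Submodule.equivMapOfInjective g hg (c.1 k))).symm,
    by
      rintro _ ⟨x, hx, rfl⟩ _ ⟨y, hy, rfl⟩
      rw [hiso]
      exact c.isotropic hx hy⟩

theorem map_injective (g : (Fin (2 * n) → F) →ₗ[F] (Fin (2 * n) → F))
    (hg : Function.Injective g) (hiso : ∀ v w, B (g v) (g w) = B v w) :
    Function.Injective (map (B := B) g hg hiso) := by
  intro c d h
  apply Subtype.ext
  funext i
  exact Submodule.map_injective_of_injective hg (congrFun (congrArg Subtype.val h) i)

theorem mem_map (g : (Fin (2 * n) → F) →ₗ[F] (Fin (2 * n) → F))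
    (hg : Function.Injective g) (hiso : ∀ v w, B (g v) (g w) = B v w) {c : SympFlag F n B}
    {i : Fin (n + 1)} {x : Fin (2 * n) → F} (hx : x ∈ c.1 i) : g x ∈ (map g hg hiso c).1 i :=
  Submodule.mem_map_of_mem hx

theorem mem_orthogonal_map (g : (Fin (2 * n) → F) →ₗ[F] (Fin (2 * n) → F))
    (hg : Function.Injective g) (hiso : ∀ v w, B (g v) (g w) = B v w) {c : SympFlag F n B}
    {i : Fin (n + 1)} {x : Fin (2 * n) → F} (hx : x ∈ B.orthogonal (c.1 i)) :
    g x ∈ B.orthogonal ((map g hg hiso c).1 i) := by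
  rintro _ ⟨y, hy, rfl⟩
  show B _ _ = 0
  rw [hiso]
  exact hx y hy

end SympFlag

theorem injective_of_isometry (hB : B.Nondegenerate)
    (g : (Fin (2 * n) → F) →ₗ[F] (Fin (2 * n) → F))
    (hiso : ∀ v w, B (g v) (g w) = B v w) : Function.Injective g := by
  rw [injective_iff_map_eq_zero]
  intro v hv
  apply hB.1
  intro w
  rw [← hiso, hv]
  simp

theorem OppS.map_right (hB : B.Nondegenerate) {c d : SympFlag F n B} (h : OppS c d)
    (g : (Fin (2 * n) → F) →ₗ[F] (Fin (2 * n) → F))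
    (hiso : ∀ v w, B (g v) (g w) = B v w) (hgc : ∀ i, (c.1 i).map g = c.1 i) :
    OppS c (d.map g (injective_of_isometry hB g hiso) hiso) := by
  intro i
  rw [eq_bot_iff]
  rintro z ⟨hz, hz'⟩
  rw [← hgc i] at hz
  obtain ⟨y, hy, rfl⟩ := hz
  have : y ∈ c.1 i ⊓ B.orthogonal (d.1 i) := by
    refine ⟨hy, fun v hv => ?_⟩
    have := hz' (g v) (Submodule.mem_map_of_mem hv)
    rw [← hiso]
    exact this
  rw [h i, Submodule.mem_bot] at this
  simp [this]

theorem OppS.isCompl (hB : B.Nondegenerate) {c d : SympFlag F n B} (h : OppS c d)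
    (i : Fin (n + 1)) : IsCompl (c.1 i) (B.orthogonal (d.1 i)) := by
  have hdis : Disjoint (c.1 i) (B.orthogonal (d.1 i)) := disjoint_iff.2 (h i)
  refine ⟨hdis, codisjoint_iff.2 (Submodule.eq_top_of_disjoint _ _ ?_ hdis)⟩
  rw [c.2.2.1, d.finrank_orthogonal hB]
  simp
  omega

theorem OppS.symm (hB : B.Nondegenerate) (hBalt : ∀ v, B v v = 0) {c d : SympFlag F n B}
    (h : OppS c d) : OppS d c := by
  intro i
  rw [eq_bot_iff]
  rintro z ⟨hz, hz'⟩
  refine (Submodule.mem_bot F).2 (hB.2 z fun v => ?_)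
  obtain ⟨a, ha, b, hb, rfl⟩ := Submodule.mem_sup.1
    ((h.isCompl hB i).sup_eq_top ▸ Submodule.mem_top : v ∈ c.1 i ⊔ B.orthogonal (d.1 i))
  have h1 : B a z = 0 := hz' a ha
  have h2 : B z b = 0 := hb z hz
  rw [map_add, LinearMap.add_apply, h1, BilinForm.swap_of_alternating hBalt z b, h2]
  simp

/-- The Siegel transformation `v ↦ v + B(v,u) w + B(v,w) u + l B(v,u) u`. -/
def siegel (B : LinearMap.BilinForm F (Fin (2 * n) → F)) (u w : Fin (2 * n) → F) (l : F) :
    (Fin (2 * n) → F) →ₗ[F] (Fin (2 * n) → F) :=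
  LinearMap.id + (B.flip u).smulRight w + (B.flip w).smulRight u +
    (l • B.flip u).smulRight u

theorem siegel_apply (u w v : Fin (2 * n) → F) (l : F) :
    siegel B u w l v = v + B v u • w + B v w • u + (l * B v u) • u := by
  simp [siegel]

theorem siegel_isometry (hBalt : ∀ v, B v v = 0) {u w : Fin (2 * n) → F} (huw : B u w = 0)
    (l : F) (v v' : Fin (2 * n) → F) : B (siegel B u w l v) (siegel B u w l v') = B v v' := by
  have hwu : B w u = 0 := by rw [BilinForm.swap_of_alternating hBalt u w, huw, neg_zero]
  have h1 : B u v' = -B v' u := BilinForm.swap_of_alternating hBalt _ _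
  have h2 : B w v' = -B v' w := BilinForm.swap_of_alternating hBalt _ _
  simp only [siegel_apply, map_add, map_smul, LinearMap.add_apply, LinearMap.smul_apply,
    smul_eq_mul, huw, hwu, hBalt, h1, h2]
  ring

theorem siegel_fix {u w v : Fin (2 * n) → F} (l : F) (h1 : B v u = 0) (h2 : B v w = 0) :
    siegel B u w l v = v := by
  simp [siegel_apply, h1, h2]

theorem siegel_map_flag (hB : B.Nondegenerate) (hBalt : ∀ v, B v v = 0) (c : SympFlag F n B)
    (m : Fin (n + 1)) {u w : Fin (2 * n) → F} (hu : u ∈ c.1 m) (hw : w ∈ B.orthogonal (c.1 m))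
    (l : F) (i : Fin (n + 1)) : (c.1 i).map (siegel B u w l) = c.1 i := by
  refine Submodule.eq_of_le_of_finrank_eq ?_ ?_
  · rintro _ ⟨v, hv, rfl⟩
    have h1 : B v u = 0 := c.isotropic hv hu
    rcases le_total i m with h | h
    · rw [siegel_fix l h1 (hw v (c.2.1 h hv))]
      exact hv
    · rw [siegel_apply, h1]
      have hu' := c.2.1 h hu
      simp only [zero_smul, mul_zero, add_zero]
      exact add_mem hv (Submodule.smul_mem _ _ hu')
  · exact (LinearEquiv.finrank_eq (Submodule.equivMapOfInjective _
      (injective_of_isometry hB _ (siegel_isometry hBalt (hw u hu) l)) (c.1 i))).symm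

open Classical in
/-- If the members of `S` each select exactly one element of the coset `x + K`, and injections
of `S` move the elements of the coset around, then each element is selected equally often. -/
theorem card_filter_mul_of_coset [Fintype F] {α : Type*} (S : Finset α)
    (p : α → (Fin (2 * n) → F) → Prop) (x : Fin (2 * n) → F)
    (K : Submodule F (Fin (2 * n) → F))
    (hmove : ∀ w ∈ K, ∀ w' ∈ K, ∃ f : α → α, Function.Injective f ∧
      ∀ d ∈ S, p d (x + w) → f d ∈ S ∧ p (f d) (x + w'))
    (huniq : ∀ d ∈ S, ∃! w : K, p d (x + w)) :
    (S.filter fun d => p d x).card * Fintype.card F ^ Module.finrank F K = S.card := by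
  have hle : ∀ w ∈ K, ∀ w' ∈ K,
      (S.filter fun d => p d (x + w)).card ≤ (S.filter fun d => p d (x + w')).card := by
    intro w hw w' hw'
    obtain ⟨f, hf, h⟩ := hmove w hw w' hw'
    refine Finset.card_le_card_of_injOn f ?_ hf.injOn
    intro d hd
    simp only [Finset.coe_filter, Set.mem_ofPred_eq] at hd ⊢
    exact h d hd.1 hd.2
  have hconst : ∀ w : K, (S.filter fun d => p d (x + w)).card =
      (S.filter fun d => p d x).card := by
    intro w
    have h1 := hle w w.2 0 K.zero_mem
    have h2 := hle 0 K.zero_mem w w.2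
    rw [add_zero] at h1 h2
    exact le_antisymm h1 h2
  calc _ = ∑ w : K, (S.filter fun d => p d (x + w)).card := by
        rw [Finset.sum_congr rfl fun w _ => hconst w, Finset.sum_const, Finset.card_univ,
          Module.card_eq_pow_finrank (K := F) (V := K), smul_eq_mul, mul_comm]
    _ = ∑ w : K, ∑ d ∈ S, if p d (x + w) then 1 else 0 := by
        simp only [Finset.card_filter]
    _ = ∑ d ∈ S, ∑ w : K, if p d (x + w) then 1 else 0 := Finset.sum_comm
    _ = ∑ d ∈ S, 1 := by
        refine Finset.sum_congr rfl fun d hd => ?_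
        obtain ⟨w, hw, hw'⟩ := huniq d hd
        rw [Finset.sum_eq_single w]
        · rw [if_pos hw]
        · intro b _ hb
          exact if_neg fun h => hb (hw' b h)
        · simp
    _ = S.card := by simp

/-- A set of flags is stable under the isometries that fix the flag `c` and fix the subspace
`Z` pointwise. -/
def StableFlags (c : SympFlag F n B) (Z : Submodule F (Fin (2 * n) → F))
    (S : Finset (SympFlag F n B)) : Prop :=
  ∀ (g : (Fin (2 * n) → F) →ₗ[F] (Fin (2 * n) → F)) (hg : Function.Injective g)
    (hiso : ∀ v w, B (g v) (g w) = B v w), (∀ i, (c.1 i).map g = c.1 i) →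
    (∀ z ∈ Z, g z = z) → ∀ d ∈ S, d.map g hg hiso ∈ S

open Classical in
theorem card_filter_mem_mul [Fintype F] (hB : B.Nondegenerate) (hBalt : ∀ v, B v v = 0)
    {c : SympFlag F n B} {Z : Submodule F (Fin (2 * n) → F)} {S : Finset (SympFlag F n B)}
    (hS : StableFlags c Z S) (hopp : ∀ d ∈ S, OppS c d) (m : Fin (n + 1))
    (hZ : ∀ d ∈ S, Z ≤ d.1 m) {x u : Fin (2 * n) → F} (hxZ : x ∈ B.orthogonal Z)
    (huc : u ∈ c.1 m) (huZ : u ∈ B.orthogonal Z) (hxu : B x u ≠ 0) :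
    (S.filter fun d => x ∈ d.1 m).card * Fintype.card F ^
      Module.finrank F (B.orthogonal (c.1 m) ⊓ B.orthogonal Z : Submodule F (Fin (2 * n) → F))
      = S.card := by
  apply card_filter_mul_of_coset S (fun d y => y ∈ d.1 m) x
  · rintro w ⟨hw, hwZ⟩ w' ⟨hw', hwZ'⟩
    set e := (B x u)⁻¹ • (w' - w) with he
    have hec : e ∈ B.orthogonal (c.1 m) := Submodule.smul_mem _ _ (sub_mem hw' hw)
    have heZ : e ∈ B.orthogonal Z := Submodule.smul_mem _ _ (sub_mem hwZ' hwZ)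
    set l := -(B (x + w) e * (B x u)⁻¹) with hl
    have hiso := siegel_isometry hBalt (hec u huc) l
    have hg := injective_of_isometry hB _ hiso
    refine ⟨SympFlag.map _ hg hiso, SympFlag.map_injective _ hg hiso, fun d hd hp => ⟨?_, ?_⟩⟩
    · refine hS _ hg hiso (siegel_map_flag hB hBalt c m huc hec l) ?_ d hd
      intro z hz
      exact siegel_fix l (huZ z hz) (heZ z hz)
    · have hmem := SympFlag.mem_map _ hg hiso hp
      convert hmem using 1
      have hwu : B w u = 0 := by
        rw [BilinForm.swap_of_alternating hBalt u w, hw u huc, neg_zero]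
      have h1 : B (x + w) u = B x u := by rw [map_add, LinearMap.add_apply, hwu, add_zero]
      rw [siegel_apply, h1, hl, neg_mul, inv_mul_cancel_right₀ hxu, neg_smul,
        add_neg_cancel_right, he, smul_inv_smul₀ hxu]
      abel
  · intro d hd
    have hcompl := (hopp d hd).symm hB hBalt |>.isCompl hB m
    obtain ⟨a, ha, b, hb, hab⟩ := Submodule.mem_sup.1
      (hcompl.sup_eq_top ▸ Submodule.mem_top : x ∈ d.1 m ⊔ B.orthogonal (c.1 m))
    have haZ : a ∈ B.orthogonal Z := fun z hz => d.isotropic (hZ d hd hz) ha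
    have hbZ : b ∈ B.orthogonal Z := by
      have : b = x - a := by rw [← hab]; abel
      rw [this]
      exact sub_mem hxZ haZ
    refine ⟨⟨-b, neg_mem hb, neg_mem hbZ⟩, ?_, ?_⟩
    · simpa [← hab] using ha
    · rintro ⟨w, hw, hwZ⟩ hp
      have h1 : b + w ∈ d.1 m := by
        have : b + w = (x + w) - a := by rw [← hab]; abel
        rw [this]
        exact sub_mem hp ha
      have h2 := hcompl.disjoint.le_bot ⟨h1, add_mem hb hw⟩
      exact Subtype.ext (eq_neg_of_add_eq_zero_right h2)

open Classical in
theorem card_filter_mem_orthogonal_mul [Fintype F] (hB : B.Nondegenerate)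
    (hBalt : ∀ v, B v v = 0) {c : SympFlag F n B} {S : Finset (SympFlag F n B)}
    (hS : StableFlags c ⊥ S) (hopp : ∀ d ∈ S, OppS c d) (m : Fin (n + 1))
    {x : Fin (2 * n) → F} (hx : x ∉ c.1 m) :
    (S.filter fun d => x ∈ B.orthogonal (d.1 m)).card * Fintype.card F ^ (m : ℕ) = S.card := by
  rw [← c.2.2.1 m]
  apply card_filter_mul_of_coset S (fun d y => y ∈ B.orthogonal (d.1 m)) x
  · intro w hw w' hw'
    obtain ⟨u, v, l, hu, hv, huvl⟩ : ∃ u v l, u ∈ c.1 m ∧ v ∈ B.orthogonal (c.1 m) ∧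
        siegel B u v l (x + w) = x + w' := by
      have hy : x + w ∉ B.orthogonal (B.orthogonal (c.1 m)) := by
        rw [LinearMap.BilinForm.orthogonal_orthogonal hB
          (BilinForm.isRefl_of_alternating hBalt)]
        intro h
        exact hx ((Submodule.add_mem_iff_left _ hw).1 h)
      have hsub : w' - w ∈ c.1 m := sub_mem hw' hw
      by_cases h0 : B (x + w) (w' - w) = 0
      · obtain ⟨v, hv, hne⟩ : ∃ v ∈ B.orthogonal (c.1 m), B (x + w) v ≠ 0 := by
          by_contra! hcon
          refine hy fun v hv => ?_
          show B v (x + w) = 0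
          rw [BilinForm.swap_of_alternating hBalt, hcon v hv, neg_zero]
        refine ⟨w' - w, (B (x + w) v)⁻¹ • v, 0, hsub, Submodule.smul_mem _ _ hv, ?_⟩
        rw [siegel_apply, h0, map_smul, smul_eq_mul, inv_mul_cancel₀ hne]
        simp
      · refine ⟨w' - w, 0, (B (x + w) (w' - w))⁻¹, hsub, zero_mem _, ?_⟩
        rw [siegel_apply, inv_mul_cancel₀ h0]
        simp
    have hiso := siegel_isometry hBalt (hv u hu) l
    have hg := injective_of_isometry hB _ hiso
    refine ⟨SympFlag.map _ hg hiso, SympFlag.map_injective _ hg hiso, fun d hd hp => ⟨?_, ?_⟩⟩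
    · refine hS _ hg hiso (siegel_map_flag hB hBalt c m hu hv l) ?_ d hd
      intro z hz
      rw [(Submodule.mem_bot F).1 hz, map_zero]
    · have hmem := SympFlag.mem_orthogonal_map _ hg hiso hp
      rwa [huvl] at hmem
  · intro d hd
    have hcompl := (hopp d hd).isCompl hB m
    obtain ⟨a, ha, b, hb, hab⟩ := Submodule.mem_sup.1
      (hcompl.sup_eq_top ▸ Submodule.mem_top : x ∈ c.1 m ⊔ B.orthogonal (d.1 m))
    refine ⟨⟨-a, neg_mem ha⟩, ?_, ?_⟩
    · simpa [← hab] using hb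
    · rintro ⟨w, hw⟩ hp
      have h1 : a + w ∈ B.orthogonal (d.1 m) := by
        have : a + w = (x + w) - b := by rw [← hab]; abel
        rw [this]
        exact sub_mem hp hb
      have h2 := hcompl.disjoint.le_bot ⟨add_mem ha hw, h1⟩
      exact Subtype.ext (eq_neg_of_add_eq_zero_right h2)

theorem exists_ne_zero_mem_orthogonal (hB : B.Nondegenerate)
    {W T : Submodule F (Fin (2 * n) → F)} (h : Module.finrank F T < Module.finrank F W) :
    ∃ u ∈ W, u ∈ B.orthogonal T ∧ u ≠ 0 := by
  by_contra! hcon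
  have hbot : W ⊓ B.orthogonal T = ⊥ := by
    rw [eq_bot_iff]
    rintro u ⟨hu, hu'⟩
    exact (Submodule.mem_bot F).2 (hcon u hu hu')
  have h1 := Submodule.finrank_sup_add_finrank_inf_eq W (B.orthogonal T)
  rw [hbot, finrank_bot, LinearMap.BilinForm.finrank_orthogonal hB] at h1
  have h2 := Submodule.finrank_le (W ⊔ B.orthogonal T)
  have h3 := Submodule.finrank_le T
  omega

theorem sup_span_singleton_eq {V W : Submodule F (Fin (2 * n) → F)} (hVW : V ≤ W)
    (hdim : Module.finrank F W = Module.finrank F V + 1) {x : Fin (2 * n) → F} (hxW : x ∈ W)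
    (hxV : x ∉ V) : V ⊔ F ∙ x = W := by
  have hle : V ⊔ F ∙ x ≤ W := sup_le hVW ((Submodule.span_singleton_le_iff_mem x W).2 hxW)
  refine Submodule.eq_of_le_of_finrank_le hle ?_
  rw [hdim]
  refine Submodule.finrank_lt_finrank_of_lt (lt_of_le_of_ne le_sup_left fun h => hxV ?_)
  rw [h]
  exact Submodule.mem_sup_right (Submodule.mem_span_singleton_self x)

theorem exists_partial_opposite (hB : B.Nondegenerate) (hBalt : ∀ v, B v v = 0)
    (c : SympFlag F n B) (k : ℕ) (hk : k ≤ n) :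
    ∃ V : ℕ → Submodule F (Fin (2 * n) → F), Monotone V ∧ (∀ i, V i ≤ V k) ∧
      (∀ i ≤ k, Module.finrank F (V i) = i) ∧ (∀ x ∈ V k, ∀ y ∈ V k, B x y = 0) ∧
      ∀ (i : ℕ) (hi : i ≤ k), V i ⊓ B.orthogonal (c.1 ⟨i, by omega⟩) = ⊥ := by
  induction k with
  | zero =>
    refine ⟨fun _ => ⊥, fun _ _ _ => le_rfl, fun _ => le_rfl, ?_, ?_, ?_⟩
    · intro i hi
      simp [Nat.le_zero.1 hi]
    · simp
    · simp
  | succ k ih =>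
    obtain ⟨V, hmono, hle, hdim, hisot, hopp⟩ := ih (by omega)
    obtain ⟨u, huc, huV, hu0⟩ := exists_ne_zero_mem_orthogonal hB
      (W := c.1 ⟨k + 1, by omega⟩) (T := V k) (by rw [hdim k le_rfl, c.2.2.1]; simp)
    have huV' : u ∉ B.orthogonal (B.orthogonal (V k)) := by
      rw [LinearMap.BilinForm.orthogonal_orthogonal hB
        (BilinForm.isRefl_of_alternating hBalt)]
      intro h
      have : u ∈ V k ⊓ B.orthogonal (c.1 ⟨k, by omega⟩) :=
        ⟨h, c.le_orthogonal _ _ huc⟩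
      rw [hopp k le_rfl] at this
      exact hu0 ((Submodule.mem_bot F).1 this)
    obtain ⟨x, hxV, hxu⟩ : ∃ x ∈ B.orthogonal (V k), B x u ≠ 0 := by
      by_contra! hcon
      exact huV' hcon
    have hx : x ∉ V k := fun h => hxu (huV x h)
    obtain ⟨W, hW, hW'⟩ : ∃ W : ℕ → Submodule F (Fin (2 * n) → F),
        (∀ i ≤ k, W i = V i) ∧ ∀ i, k < i → W i = V k ⊔ F ∙ x :=
      ⟨fun i => if i ≤ k then V i else V k ⊔ F ∙ x, fun i hi => if_pos hi,
        fun i hi => if_neg (not_le.2 hi)⟩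
    refine ⟨W, ?_, ?_, ?_, ?_, ?_⟩
    · intro i i' hii
      rcases le_or_gt i' k with h1 | h1
      · rw [hW i' h1, hW i (hii.trans h1)]
        exact hmono hii
      · rw [hW' i' h1]
        rcases le_or_gt i k with h2 | h2
        · rw [hW i h2]
          exact (hle i).trans le_sup_left
        · exact (hW' i h2).le
    · intro i
      rw [hW' (k + 1) k.lt_succ_self]
      rcases le_or_gt i k with h2 | h2
      · rw [hW i h2]
        exact (hle i).trans le_sup_left
      · exact (hW' i h2).le
    · intro i hi
      rcases le_or_gt i k with h1 | h1
      · rw [hW i h1]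
        exact hdim i h1
      · have hlt : Module.finrank F (V k) < Module.finrank F (V k ⊔ F ∙ x : Submodule F _) := by
          refine Submodule.finrank_lt_finrank_of_lt (lt_of_le_of_ne le_sup_left fun h => hx ?_)
          rw [h]
          exact Submodule.mem_sup_right (Submodule.mem_span_singleton_self x)
        have hub := Submodule.finrank_add_le_finrank_add_finrank (V k) (F ∙ x)
        have h1' : Module.finrank F (F ∙ x) ≤ 1 :=
          (finrank_span_le_card ({x} : Set (Fin (2 * n) → F))).trans (by simp)
        rw [hdim k le_rfl] at hlt hub
        rw [hW' i h1]
        omega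
    · rw [hW' (k + 1) k.lt_succ_self]
      intro y hy z hz
      obtain ⟨y, hyV, _, hy', rfl⟩ := Submodule.mem_sup.1 hy
      obtain ⟨a, rfl⟩ := Submodule.mem_span_singleton.1 hy'
      obtain ⟨z, hzV, _, hz', rfl⟩ := Submodule.mem_sup.1 hz
      obtain ⟨b, rfl⟩ := Submodule.mem_span_singleton.1 hz'
      have h1 : B y x = 0 := hxV y hyV
      have h2 : B x z = 0 := by
        rw [BilinForm.swap_of_alternating hBalt z x, hxV z hzV, neg_zero]
      simp [hisot y hyV z hzV, h1, h2, hBalt]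
    · intro i hi
      rcases le_or_gt i k with h1 | h1
      · rw [hW i h1]
        exact hopp i h1
      · obtain rfl : i = k + 1 := by omega
        rw [hW' (k + 1) h1, eq_bot_iff]
        rintro y ⟨hy, hyc⟩
        obtain ⟨y, hyV, _, hy', rfl⟩ := Submodule.mem_sup.1 hy
        obtain ⟨a, rfl⟩ := Submodule.mem_span_singleton.1 hy'
        have h2 : B u (y + a • x) = 0 := hyc u huc
        have h3 : B u y = 0 := by
          rw [BilinForm.swap_of_alternating hBalt y u, huV y hyV, neg_zero]
        have h4 : B u x ≠ 0 := by
          rw [BilinForm.swap_of_alternating hBalt x u]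
          exact neg_ne_zero.2 hxu
        have ha : a = 0 := by simpa [h3, h4] using h2
        rw [ha, zero_smul, add_zero] at hyc ⊢
        rw [← hopp k le_rfl]
        exact ⟨hyV, fun v hv => hyc v (c.2.1 (by simp [Fin.le_def]) hv)⟩

theorem exists_opposite (hB : B.Nondegenerate) (hBalt : ∀ v, B v v = 0)
    (c : SympFlag F n B) : ∃ d : SympFlag F n B, OppS c d := by
  obtain ⟨V, hmono, -, hdim, hisot, hopp⟩ := exists_partial_opposite hB hBalt c n le_rfl
  let d : SympFlag F n B := ⟨fun i => V i, fun i k h => hmono h,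
    fun k => hdim k (Nat.lt_succ_iff.1 k.2), hisot⟩
  have hd : OppS d c := fun i => hopp i (Nat.lt_succ_iff.1 i.2)
  exact ⟨d, hd.symm hB hBalt⟩

open Classical in
/-- The flags opposite to `c` that agree with `d` up to index `k`. -/
noncomputable def oppAgree [Fintype F] (c d : SympFlag F n B) (k : ℕ) :
    Finset (SympFlag F n B) :=
  Finset.univ.filter fun d' => OppS c d' ∧ ∀ i : Fin (n + 1), (i : ℕ) ≤ k → d'.1 i = d.1 i

theorem mem_oppAgree [Fintype F] {c d d' : SympFlag F n B} {k : ℕ} :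
    d' ∈ oppAgree c d k ↔
      OppS c d' ∧ ∀ i : Fin (n + 1), (i : ℕ) ≤ k → d'.1 i = d.1 i := by
  simp [oppAgree]

theorem stableFlags_oppAgree [Fintype F] (hB : B.Nondegenerate) (c d : SympFlag F n B)
    (k : Fin (n + 1)) : StableFlags c (d.1 k) (oppAgree c d k) := by
  intro g hg hiso hgc hgZ d' hd'
  rw [mem_oppAgree] at hd' ⊢
  refine ⟨hd'.1.map_right hB g hiso hgc, fun i hi => ?_⟩
  show (d'.1 i).map g = d.1 i
  rw [hd'.2 i hi]
  ext y
  constructor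
  · rintro ⟨z, hz, rfl⟩
    rw [hgZ z (d.2.1 hi hz)]
    exact hz
  · intro hy
    exact ⟨y, hy, hgZ y (d.2.1 hi hy)⟩

theorem card_oppAgree_succ_mul [Fintype F] (hB : B.Nondegenerate) (hBalt : ∀ v, B v v = 0)
    {c d : SympFlag F n B} (h : OppS c d) (k : ℕ) (hk : k < n) :
    (oppAgree c d (k + 1)).card * Fintype.card F ^ (2 * n - 2 * k - 1) =
      (oppAgree c d k).card := by
  classical
  set K : Fin (n + 1) := ⟨k, by omega⟩ with hK
  set L : Fin (n + 1) := ⟨k + 1, by omega⟩ with hL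
  have hKL : K ≤ L := by simp [hK, hL, Fin.le_def]
  have hdim : ∀ e : SympFlag F n B, Module.finrank F (e.1 L) = Module.finrank F (e.1 K) + 1 := by
    intro e
    rw [e.2.2.1, e.2.2.1]
  obtain ⟨x, hxL, hxK⟩ : ∃ x ∈ d.1 L, x ∉ d.1 K := by
    by_contra! hcon
    have := Submodule.finrank_mono (show d.1 L ≤ d.1 K from hcon)
    rw [hdim] at this
    omega
  have hspan := sup_span_singleton_eq (d.2.1 hKL) (hdim d) hxL hxK
  obtain ⟨u, huc, huK, hu0⟩ := exists_ne_zero_mem_orthogonal hB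
    (W := c.1 L) (T := d.1 K) (by rw [d.2.2.1, c.2.2.1]; simp [hK, hL])
  have hxu : B x u ≠ 0 := by
    intro h0
    have : u ∈ c.1 L ⊓ B.orthogonal (d.1 L) := by
      refine ⟨huc, fun v hv => ?_⟩
      rw [← hspan] at hv
      obtain ⟨y, hy, _, hy', rfl⟩ := Submodule.mem_sup.1 hv
      obtain ⟨a, rfl⟩ := Submodule.mem_span_singleton.1 hy'
      have hyu : B y u = 0 := huK y hy
      show B _ _ = 0
      simp [hyu, h0]
    rw [h L] at this
    exact hu0 ((Submodule.mem_bot F).1 this)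
  have key := card_filter_mem_mul hB hBalt (stableFlags_oppAgree hB c d K)
    (fun d' hd' => (mem_oppAgree.1 hd').1) L
    (fun d' hd' => by
      rw [← (mem_oppAgree.1 hd').2 K le_rfl]
      exact d'.2.1 hKL)
    (fun z hz => d.isotropic hz hxL) huc huK hxu
  have hfin : Module.finrank F
      (B.orthogonal (c.1 L) ⊓ B.orthogonal (d.1 K) : Submodule F (Fin (2 * n) → F)) =
      2 * n - 2 * k - 1 := by
    have htop : B.orthogonal (c.1 L) ⊔ B.orthogonal (d.1 K) = ⊤ := by
      rw [eq_top_iff, ← (h.isCompl hB L).sup_eq_top]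
      exact sup_le_sup (c.le_orthogonal L L)
        (LinearMap.BilinForm.orthogonal_le (d.2.1 hKL))
    have h1 := Submodule.finrank_sup_add_finrank_inf_eq (B.orthogonal (c.1 L))
      (B.orthogonal (d.1 K))
    rw [htop, finrank_top, c.finrank_orthogonal hB, d.finrank_orthogonal hB] at h1
    simp [hK, hL] at h1
    omega
  rw [hfin] at key
  rw [← key]
  congr 2
  ext d'
  rw [Finset.mem_filter, mem_oppAgree, mem_oppAgree]
  constructor
  · rintro ⟨ho, hd'⟩
    refine ⟨⟨ho, fun i hi => hd' i (Nat.le_succ_of_le hi)⟩, ?_⟩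
    rw [hd' L le_rfl]
    exact hxL
  · rintro ⟨⟨ho, hd'⟩, hx⟩
    refine ⟨ho, fun i hi => ?_⟩
    rcases Nat.lt_or_ge k i with hki | hki
    · obtain rfl : i = L := Fin.ext (by simp [hL]; omega)
      have hKd : d'.1 K = d.1 K := hd' K le_rfl
      rw [← hspan, ← hKd]
      exact (sup_span_singleton_eq (d'.2.1 hKL) (hdim d') hx (by rwa [hKd])).symm
    · exact hd' i hki

theorem card_oppAgree [Fintype F] (hB : B.Nondegenerate) (hBalt : ∀ v, B v v = 0)
    {c d : SympFlag F n B} (h : OppS c d) (r : ℕ) (hr : r ≤ n) :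
    (oppAgree c d (n - r)).card = Fintype.card F ^ r ^ 2 := by
  induction r with
  | zero =>
    rw [Finset.card_eq_one.2 ⟨d, ?_⟩]
    · simp
    · ext d'
      rw [mem_oppAgree, Finset.mem_singleton]
      constructor
      · rintro ⟨-, hd'⟩
        exact Subtype.ext (funext fun i => hd' i (by omega))
      · rintro rfl
        exact ⟨h, fun _ _ => rfl⟩
  | succ r ih =>
    rw [← card_oppAgree_succ_mul hB hBalt h (n - (r + 1)) (by omega),
      show n - (r + 1) + 1 = n - r by omega, ih (by omega), ← pow_add]
    congr 1
    have : 2 * n - 2 * (n - (r + 1)) - 1 = 2 * r + 1 := by omega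
    rw [this]
    ring

open Classical in
/-- The flags opposite to `c`. -/
noncomputable def oppFinset [Fintype F] (c : SympFlag F n B) : Finset (SympFlag F n B) :=
  Finset.univ.filter fun d => OppS c d

theorem mem_oppFinset [Fintype F] {c d : SympFlag F n B} : d ∈ oppFinset c ↔ OppS c d := by
  simp [oppFinset]

theorem stableFlags_oppFinset [Fintype F] (hB : B.Nondegenerate) (c : SympFlag F n B) :
    StableFlags c ⊥ (oppFinset c) := by
  intro g hg hiso hgc _ d hd
  rw [mem_oppFinset] at hd ⊢
  exact hd.map_right hB g hiso hgc

theorem card_oppFinset [Fintype F] (hB : B.Nondegenerate) (hBalt : ∀ v, B v v = 0)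
    (c : SympFlag F n B) : (oppFinset c).card = Fintype.card F ^ n ^ 2 := by
  obtain ⟨d, hd⟩ := exists_opposite hB hBalt c
  rw [← card_oppAgree hB hBalt hd n le_rfl]
  congr 1
  ext d'
  rw [mem_oppFinset, mem_oppAgree]
  refine ⟨fun h => ⟨h, fun i hi => ?_⟩, fun h => h.1⟩
  obtain rfl : i = 0 := Fin.ext (by simp at hi ⊢; omega)
  rw [d'.bot_eq, d.bot_eq]

open Classical in
theorem card_opposite_mem [Fintype F] (hB : B.Nondegenerate) (hBalt : ∀ v, B v v = 0)
    (c : SympFlag F n B) (m : Fin (n + 1)) {x : Fin (2 * n) → F} (hx0 : x ≠ 0) :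
    (((oppFinset c).filter fun d => x ∈ d.1 m).card : ℚ) =
      (Fintype.card F : ℚ) ^ (n * (n - 1)) / (Fintype.card F : ℚ) ^ (n - m : ℕ) *
        if x ∈ B.orthogonal (c.1 m) then 0 else 1 := by
  have hq : (Fintype.card F : ℚ) ≠ 0 := by simp
  split_ifs with hx
  · rw [mul_zero, Nat.cast_eq_zero, Finset.card_eq_zero, Finset.filter_eq_empty_iff]
    intro d hd hxd
    have := (mem_oppFinset.1 hd).symm hB hBalt m
    exact hx0 ((Submodule.mem_bot F).1 (this ▸ ⟨hxd, hx⟩))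
  · obtain ⟨u, hu, hux⟩ : ∃ u ∈ c.1 m, B u x ≠ 0 := by
      by_contra! hcon
      exact hx hcon
    have hxu : B x u ≠ 0 := by
      rw [BilinForm.swap_of_alternating hBalt u x]
      exact neg_ne_zero.2 hux
    have key := card_filter_mem_mul hB hBalt (stableFlags_oppFinset hB c)
      (fun d hd => mem_oppFinset.1 hd) m (fun _ _ => bot_le) (by simp) hu (by simp) hxu
    rw [LinearMap.BilinForm.orthogonal_bot, inf_top_eq, c.finrank_orthogonal hB,
      card_oppFinset hB hBalt] at key
    rw [mul_one, eq_div_iff (pow_ne_zero _ hq)]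
    have key' : (((oppFinset c).filter fun d => x ∈ d.1 m).card : ℚ) *
        (Fintype.card F : ℚ) ^ (2 * n - m : ℕ) = (Fintype.card F : ℚ) ^ n ^ 2 := by
      exact_mod_cast key
    apply mul_right_cancel₀ (pow_ne_zero n hq)
    rw [mul_assoc, ← pow_add, ← pow_add]
    convert key' using 2
    · congr 1
      omega
    · obtain _ | k := n
      · rfl
      · rw [Nat.add_sub_cancel]
        ring

open Classical in
theorem card_opposite_mem_orthogonal [Fintype F] (hB : B.Nondegenerate)
    (hBalt : ∀ v, B v v = 0) (c : SympFlag F n B) (m : Fin (n + 1))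
    {x : Fin (2 * n) → F} (hx0 : x ≠ 0) :
    (((oppFinset c).filter fun d => x ∈ B.orthogonal (d.1 m)).card : ℚ) =
      (Fintype.card F : ℚ) ^ (n * (n - 1)) * (Fintype.card F : ℚ) ^ (n - m : ℕ) *
        if x ∈ c.1 m then 0 else 1 := by
  have hq : (Fintype.card F : ℚ) ≠ 0 := by simp
  split_ifs with hx
  · rw [mul_zero, Nat.cast_eq_zero, Finset.card_eq_zero, Finset.filter_eq_empty_iff]
    intro d hd hxd
    exact hx0 ((Submodule.mem_bot F).1 (mem_oppFinset.1 hd m ▸ ⟨hx, hxd⟩))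
  · have key := card_filter_mem_orthogonal_mul hB hBalt (stableFlags_oppFinset hB c)
      (fun d hd => mem_oppFinset.1 hd) m hx
    rw [card_oppFinset hB hBalt] at key
    have key' : (((oppFinset c).filter fun d => x ∈ B.orthogonal (d.1 m)).card : ℚ) *
        (Fintype.card F : ℚ) ^ (m : ℕ) = (Fintype.card F : ℚ) ^ n ^ 2 := by
      exact_mod_cast key
    apply mul_right_cancel₀ (pow_ne_zero (m : ℕ) hq)
    rw [key', mul_one, mul_assoc, ← pow_add, ← pow_add]
    congr 1
    rw [show n - (m : ℕ) + m = n by omega]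
    obtain _ | k := n
    · rfl
    · rw [Nat.add_sub_cancel]
      ring

theorem sympMem_of_le (c : SympFlag F n B) {k : ℕ} (hk : k ≤ n) :
    sympMem c k = c.1 ⟨k, by omega⟩ := by
  rw [sympMem, dif_pos hk]

theorem sympMem_of_ge (hB : B.Nondegenerate) (c : SympFlag F n B) {k : ℕ} (hk : n ≤ k) :
    sympMem c k = B.orthogonal (c.1 ⟨2 * n - k, by omega⟩) := by
  rw [sympMem]
  split_ifs with h1 h2
  · obtain rfl : k = n := le_antisymm h1 hk
    have := c.orthogonal_last hB
    simp only [show 2 * k - k = k by omega]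
    exact this.symm
  · rfl
  · simp only [show 2 * n - k = 0 by omega]
    have := c.bot_eq
    rw [show (⟨0, by omega⟩ : Fin (n + 1)) = 0 from rfl, this,
      LinearMap.BilinForm.orthogonal_bot]

theorem sympMem_mono (hB : B.Nondegenerate) (c : SympFlag F n B) : Monotone (sympMem c) := by
  intro i k hik
  rcases le_total k n with hk | hk
  · rw [sympMem_of_le c hk, sympMem_of_le c (hik.trans hk)]
    exact c.2.1 hik
  · rw [sympMem_of_ge hB c hk]
    rcases le_total i n with hi | hi
    · rw [sympMem_of_le c hi]
      exact c.le_orthogonal _ _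
    · rw [sympMem_of_ge hB c hi]
      apply LinearMap.BilinForm.orthogonal_le
      apply c.2.1
      simp [Fin.le_def]
      omega

theorem sympType_le_iff (hB : B.Nondegenerate) (c : SympFlag F n B)
    (X : Submodule F (Fin (2 * n) → F)) (k : ℕ) : sympType c X ≤ k ↔ X ≤ sympMem c k := by
  constructor
  · intro h
    have hne : {k : ℕ | X ≤ sympMem c k}.Nonempty := by
      refine ⟨2 * n, ?_⟩
      show X ≤ _
      rw [sympMem_of_ge hB c (by omega)]
      simp only [Nat.sub_self]
      have := c.bot_eq
      rw [show (⟨0, by omega⟩ : Fin (n + 1)) = 0 from rfl, this,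
        LinearMap.BilinForm.orthogonal_bot]
      exact le_top
    exact (Nat.sInf_mem hne : X ≤ _).trans (sympMem_mono hB c h)
  · intro h
    exact Nat.sInf_le h

open Classical in
theorem sum_TmatS [Fintype F] (c : SympFlag F n B) (X : PointS F n) (a b : ℕ) (hab : a ≤ b) :
    (∑ i ∈ Finset.Icc (a + 1) b, TmatS F n B i) c X =
      (if sympType c X.1 ≤ b then 1 else 0) - if sympType c X.1 ≤ a then 1 else 0 := by
  rw [Matrix.sum_apply]
  simp only [TmatS, Finset.sum_ite_eq, Finset.mem_Icc]
  split_ifs <;> first | omega | norm_num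

open Classical in
theorem FmatS_apply [Fintype F] (hB : B.Nondegenerate) (c : SympFlag F n B) (X : PointS F n)
    {x : Fin (2 * n) → F} (hx : X.1 = F ∙ x) (j : ℕ) (hj : j ≤ n) :
    FmatS F n B j c X =
      ((Fintype.card F : ℚ) ^ j + 1) * (if x ∈ c.1 (Fin.last n) then 1 else 0) -
      (Fintype.card F : ℚ) ^ j * (if x ∈ c.1 ⟨n - j, by omega⟩ then 1 else 0) -
      if x ∈ B.orthogonal (c.1 ⟨n - j, by omega⟩) then 1 else 0 := by
  have h1 : sympType c X.1 ≤ n ↔ x ∈ c.1 (Fin.last n) := by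
    rw [sympType_le_iff hB, sympMem_of_le c le_rfl, hx, Submodule.span_singleton_le_iff_mem]
    rfl
  have h2 : sympType c X.1 ≤ n - j ↔ x ∈ c.1 ⟨n - j, by omega⟩ := by
    rw [sympType_le_iff hB, sympMem_of_le c (by omega), hx,
      Submodule.span_singleton_le_iff_mem]
  have h3 : sympType c X.1 ≤ n + j ↔ x ∈ B.orthogonal (c.1 ⟨n - j, by omega⟩) := by
    rw [sympType_le_iff hB, sympMem_of_ge hB c (by omega), hx,
      Submodule.span_singleton_le_iff_mem]
    simp only [show 2 * n - (n + j) = n - j by omega]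
  rw [FmatS, Matrix.sub_apply, Matrix.smul_apply, sum_TmatS c X (n - j) n (by omega),
    sum_TmatS c X n (n + j) (by omega)]
  simp only [h1, h2, h3, smul_eq_mul]
  ring

end SympOpposition

/-- `A·F_j = -q^(n(n-1))·F_j`: every column of `F_j` (i.e. every function `χ_j^P`) is an
eigenvector of the opposition graph for the smallest eigenvalue `-q^(n(n-1))`. -/
theorem adj_mul_Fmat_symp (F : Type) [Field F] [Fintype F] (q : ℕ)
    (hq : Fintype.card F = q) (n : ℕ) (hn : 2 ≤ n)
    (B : LinearMap.BilinForm F (Fin (2 * n) → F))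
    (hB : B.Nondegenerate) (hBalt : ∀ v, B v v = 0)
    (j : ℕ) (hj1 : 1 ≤ j) (hj2 : j ≤ n) :
    adjS F n B * FmatS F n B j = (-((q : ℚ) ^ (n * (n - 1)))) • FmatS F n B j := by
  classical
  subst hq
  ext c X
  obtain ⟨⟨x, hxX⟩, hx0, hxs⟩ := finrank_eq_one_iff'.1 X.2
  have hx0' : x ≠ 0 := fun h => hx0 (Subtype.ext h)
  have hX : X.1 = F ∙ x := by
    refine le_antisymm (fun y hy => ?_) ((Submodule.span_singleton_le_iff_mem x _).2 hxX)
    obtain ⟨a, ha⟩ := hxs ⟨y, hy⟩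
    exact Submodule.mem_span_singleton.2 ⟨a, congrArg Subtype.val ha⟩
  have hq : (Fintype.card F : ℚ) ^ j ≠ 0 := pow_ne_zero _ (by simp)
  have hm : n - (n - j) = j := by omega
  have h1 := card_opposite_mem hB hBalt c (Fin.last n) hx0'
  have h2 := card_opposite_mem hB hBalt c ⟨n - j, by omega⟩ hx0'
  have h3 := card_opposite_mem_orthogonal hB hBalt c ⟨n - j, by omega⟩ hx0'
  simp only [c.orthogonal_last hB, Fin.val_last, Nat.sub_self, pow_zero, div_one] at h1
  simp only [hm] at h2 h3
  have hsum : (adjS F n B * FmatS F n B j) c X = ∑ d ∈ oppFinset c, FmatS F n B j d X := by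
    rw [Matrix.mul_apply, oppFinset, Finset.sum_filter]
    refine Finset.sum_congr rfl fun d _ => ?_
    simp only [adjS, ite_mul, one_mul, zero_mul]
  rw [hsum, Matrix.smul_apply, FmatS_apply hB c X hX j hj2,
    Finset.sum_congr rfl fun d _ => FmatS_apply hB d X hX j hj2]
  simp only [Finset.sum_sub_distrib, ← Finset.mul_sum, Finset.sum_boole]
  rw [h1, h2, h3, smul_eq_mul]
  split_ifs <;> field_simp <;> ring
end
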